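/- Let H be a cyclically 4-edge-connected cubic graph that is not cyclically 5-edge-connected. If G is a graph of order n obtained from H by replacing some (possibly none) of its vertices with triangles, then G has at least 3n/4 − 9 perfect matchings. -/

import Mathlib

open scoped Classical

noncomputable section

/-- A finite multigraph: finitely many vertices and edges, each edge has an
unordered pair of endpoints (parallel edges and loops are allowed). -/
structure Multigraph where
  V : Type
  E : Type
  fintypeV : Fintype V := by infer_instance
  fintypeE : Fintype E := by infer_instance
  ends : E → Sym2 V

namespace Multigraph

instance (G : Multigraph) : Fintype G.V := G.fintypeV
instance (G : Multigraph) : Fintype G.E := G.fintypeE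

/-- The number of endpoints of the edge `e` that are equal to `v`
(a loop at `v` counts twice). -/
def inc (G : Multigraph) (v : G.V) (e : G.E) : ℕ :=
  if G.ends e = Sym2.diag v then 2 else if v ∈ G.ends e then 1 else 0

/-- The degree of a vertex: the number of edge-ends at it (loops count twice). -/
def degree (G : Multigraph) (v : G.V) : ℕ := ∑ e : G.E, G.inc v e

/-- A graph is cubic if every vertex has degree three. -/
def IsCubic (G : Multigraph) : Prop := ∀ v : G.V, G.degree v = 3

/-- A perfect matching: a set of (non-loop) edges such that every vertex is
incident with exactly one edge of the set. -/
def IsPerfectMatching (G : Multigraph) (M : Finset G.E) : Prop :=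
  (∀ e ∈ M, ¬ (G.ends e).IsDiag) ∧
  ∀ v : G.V, ∃! e, e ∈ M ∧ v ∈ G.ends e

/-- The number of perfect matchings of `G`. -/
def pmCount (G : Multigraph) : ℕ :=
  Nat.card {M : Finset G.E // G.IsPerfectMatching M}

/-- Every edge lies in some perfect matching. -/
def MatchingCovered (G : Multigraph) : Prop :=
  ∀ e : G.E, ∃ M, G.IsPerfectMatching M ∧ e ∈ M

/-- Every edge lies in at least two perfect matchings. -/
def MatchingDoubleCovered (G : Multigraph) : Prop :=
  ∀ e : G.E, 2 ≤ Nat.card {M : Finset G.E // G.IsPerfectMatching M ∧ e ∈ M}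

/-- Adjacency via some edge. -/
def Adj (G : Multigraph) (u v : G.V) : Prop := ∃ e : G.E, G.ends e = s(u, v)

/-- The graph is connected. -/
def Connected (G : Multigraph) : Prop :=
  Nonempty G.V ∧ ∀ u v : G.V, Relation.ReflTransGen G.Adj u v

/-- The edge-cut `E(A, Aᶜ)`: edges with one end in `A` and the other outside. -/
def cutEdges (G : Multigraph) (A : Set G.V) : Set G.E :=
  {e | ∃ u v, G.ends e = s(u, v) ∧ u ∈ A ∧ v ∉ A}

/-- `G` is `k`-edge-connected: no edge-cut has fewer than `k` edges. -/
def EdgeConnected (G : Multigraph) (k : ℕ) : Prop :=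
  ∀ A : Set G.V, A.Nonempty → A ≠ Set.univ → k ≤ (G.cutEdges A).ncard

/-- Bridgeless = 2-edge-connected: connected with no edge-cut of size `< 2`. -/
def Bridgeless (G : Multigraph) : Prop := G.Connected ∧ G.EdgeConnected 2

/-- The subgraph induced on `A` contains a cycle (two parallel edges count as a
cycle of length two): there is a nonempty set of edges inside `A` in which every
vertex is incident with zero or at least two edge-ends. -/
def HasCycleWithin (G : Multigraph) (A : Set G.V) : Prop :=
  ∃ F : Finset G.E, F.Nonempty ∧ (∀ e ∈ F, ∀ v ∈ G.ends e, v ∈ A) ∧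
    ∀ v : G.V, (∑ e ∈ F, G.inc v e) ≠ 1

/-- The edge-cut `E(A, Aᶜ)` is cyclic: both sides contain a cycle. -/
def IsCyclicCut (G : Multigraph) (A : Set G.V) : Prop :=
  G.HasCycleWithin A ∧ G.HasCycleWithin Aᶜ

/-- `G` is cyclically `k`-edge-connected: no cyclic edge-cut has fewer than `k` edges. -/
def CyclicallyEdgeConnected (G : Multigraph) (k : ℕ) : Prop :=
  ∀ A : Set G.V, G.IsCyclicCut A → k ≤ (G.cutEdges A).ncard

/-- A cut is tight: every perfect matching contains exactly one of its edges. -/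
def IsTightCut (G : Multigraph) (A : Set G.V) : Prop :=
  ∀ M : Finset G.E, G.IsPerfectMatching M →
    (M.filter (fun e => e ∈ G.cutEdges A)).card = 1

/-- Adjacency within a set `A` of vertices. -/
def AdjOn (G : Multigraph) (A : Set G.V) (u v : G.V) : Prop :=
  u ∈ A ∧ v ∈ A ∧ G.Adj u v

/-- The subgraph induced on `A` is connected (any two of its vertices are joined
by a walk inside `A`). -/
def ConnectedOn (G : Multigraph) (A : Set G.V) : Prop :=
  ∀ u ∈ A, ∀ v ∈ A, Relation.ReflTransGen (G.AdjOn A) u v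

/-- `G` is `k`-vertex-connected: it has at least `k+1` vertices and removing any
set of at most `k-1` vertices leaves it connected. -/
def VertexConnected (G : Multigraph) (k : ℕ) : Prop :=
  k + 1 ≤ Fintype.card G.V ∧
  ∀ T : Set G.V, T.ncard ≤ k - 1 → G.ConnectedOn Tᶜ

/-- `{x, y}` is a 2-vertex-cut: removing both vertices disconnects the graph. -/
def IsVertexCutPair (G : Multigraph) (x y : G.V) : Prop :=
  x ≠ y ∧ ¬ G.ConnectedOn ({x, y}ᶜ)

/-- `G` is bipartite: the vertices split into two classes so that each edge
joins the two classes. -/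
def Bipartite (G : Multigraph) : Prop :=
  ∃ X : Set G.V, ∀ e : G.E, ∃ u v, G.ends e = s(u, v) ∧ u ∈ X ∧ v ∉ X

/-- Delete a set of edges (keeping all vertices). -/
def deleteEdges (G : Multigraph) (F : Set G.E) : Multigraph where
  V := G.V
  E := {e : G.E // e ∉ F}
  ends e := G.ends e.1

/-- Contract the vertex set `A` to a single vertex (`none`), deleting the arising
loops and keeping parallel edges. -/
def contract (G : Multigraph) (A : Set G.V) : Multigraph where
  V := Option {x : G.V // x ∉ A}
  E := {e : G.E // ¬ ∀ v ∈ G.ends e, v ∈ A}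
  ends e := (G.ends e.1).map fun x => if h : x ∈ A then none else some ⟨x, h⟩

/-- Isomorphism of multigraphs. -/
def Iso (G₁ G₂ : Multigraph) : Prop :=
  ∃ (f : G₁.V ≃ G₂.V) (g : G₁.E ≃ G₂.E), ∀ e, G₂.ends (g e) = (G₁.ends e).map f

/-- The complete graph on four vertices. -/
def K4 : Multigraph where
  V := Fin 4
  E := {p : Fin 4 × Fin 4 // p.1 < p.2}
  ends p := s(p.1.1, p.1.2)

/-- The result of simultaneously replacing every vertex of `S` by a triangle;
`σ e v` records to which of the three triangle vertices at `v` the edge `e`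
(formerly ending at `v`) is attached. -/
def expandTriangles (H : Multigraph) (S : Set H.V) (σ : H.E → H.V → Fin 3) :
    Multigraph where
  V := {x : H.V // x ∉ S} ⊕ (S × Fin 3)
  E := H.E ⊕ (S × Fin 3)
  ends e :=
    match e with
    | Sum.inl e => (H.ends e).map fun x =>
        if h : x ∈ S then Sum.inr (⟨x, h⟩, σ e x) else Sum.inl ⟨x, h⟩
    | Sum.inr (w, i) => s(Sum.inr (w, i + 1), Sum.inr (w, i + 2))

/-- `G` is obtained from `H` by replacing each vertex of `S` with a triangle:
the three edges formerly incident with a vertex of `S` get attached to the three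
distinct new triangle vertices. -/
def IsTriangleExpansion (H : Multigraph) (S : Set H.V) (G : Multigraph) : Prop :=
  ∃ σ : H.E → H.V → Fin 3,
    (∀ v ∈ S, ∀ e : H.E, H.ends e ≠ Sym2.diag v) ∧
    (∀ v ∈ S, Set.InjOn (fun e => σ e v) {e : H.E | v ∈ H.ends e}) ∧
    Iso (expandTriangles H S σ) G

/-- Klee-graphs: `K₄` together with everything obtainable by repeatedly replacing
a vertex with a triangle. -/
inductive IsKlee : Multigraph → Prop
  | k4 (G : Multigraph) : Iso K4 G → IsKlee G
  | expand (G : Multigraph) (v : G.V) (H : Multigraph) :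
      IsKlee G → IsTriangleExpansion G {v} H → IsKlee H

/-- A nice 3-edge-cut (of a cubic graph). -/
def IsNiceCut (G : Multigraph) (A : Set G.V) : Prop :=
  A.Nonempty ∧ A ≠ Set.univ ∧ (G.cutEdges A).ncard = 3 ∧
  ¬ IsKlee (G.contract A) ∧
  (¬ IsKlee (G.contract Aᶜ) ∨
   9 ≤ A.ncard ∨
   (5 ≤ A.ncard ∧ ¬ G.IsTightCut A) ∨
   (A.ncard = 3 ∧
     2 ≤ Nat.card {M : Finset G.E // G.IsPerfectMatching M ∧
       ∀ e ∈ G.cutEdges A, e ∈ M}))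

/-- A brace: a bipartite matching covered graph without nontrivial tight edge-cuts. -/
def IsBrace (H : Multigraph) : Prop :=
  H.Bipartite ∧ H.MatchingCovered ∧
  ∀ A : Set H.V, 2 ≤ A.ncard → 2 ≤ Aᶜ.ncard → ¬ H.IsTightCut A

/-- Data describing a simultaneous gluing of graphs `K w` (through their vertices
`z w`) onto the vertices `w ∈ W` of `H`: the edge `e` of `H` incident with `w`
is identified with the edge `ε w e` of `K w` incident with `z w`, whose other
end is `y w e`. -/
structure GlueData (H : Multigraph) (W : Set H.V) where
  K : W → Multigraph
  z : (w : W) → (K w).V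
  d : (w : W) → {x : (K w).V // x ≠ z w}
  ε : (w : W) → H.E → (K w).E
  y : (w : W) → H.E → {x : (K w).V // x ≠ z w}
  noloop : ∀ (w : W) (e : H.E), H.ends e ≠ Sym2.diag (w : H.V)
  noloopK : ∀ (w : W) (k : (K w).E), (K w).ends k ≠ Sym2.diag (z w)
  ends_eq : ∀ (w : W) (e : H.E), (w : H.V) ∈ H.ends e →
      (K w).ends (ε w e) = s(z w, (y w e : (K w).V))
  inj : ∀ w : W, Set.InjOn (ε w) {e : H.E | (w : H.V) ∈ H.ends e}
  surj : ∀ (w : W) (k : (K w).E), z w ∈ (K w).ends k →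
      ∃ e : H.E, (w : H.V) ∈ H.ends e ∧ ε w e = k

/-- The graph obtained by gluing each `D.K w` through `D.z w` onto the vertex
`w ∈ W` of `H`. -/
def glue (H : Multigraph) (W : Set H.V) (D : GlueData H W) : Multigraph where
  V := {x : H.V // x ∉ W} ⊕ (Σ w : W, {x : (D.K w).V // x ≠ D.z w})
  E := H.E ⊕ (Σ w : W, {k : (D.K w).E // D.z w ∉ (D.K w).ends k})
  ends e :=
    match e with
    | Sum.inl e => (H.ends e).map fun x =>
        if h : x ∈ W then Sum.inr ⟨⟨x, h⟩, D.y ⟨x, h⟩ e⟩ else Sum.inl ⟨x, h⟩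
    | Sum.inr ⟨w, k⟩ => ((D.K w).ends k.1).map fun x =>
        if h : x = D.z w then Sum.inr ⟨w, D.d w⟩ else Sum.inr ⟨w, ⟨x, h⟩⟩

/-- The multiset of vertex degrees different from three. -/
def nonCubicDegrees (G : Multigraph) : Multiset ℕ :=
  ((Finset.univ : Finset G.V).val.map G.degree).filter (· ≠ 3)

/-- `H` is an odd minor of `G`: it is obtained by contracting pairwise disjoint
connected subgraphs, each with an odd number of vertices (deleting arising loops
and keeping parallel edges). -/
def IsOddMinor (G H : Multigraph) : Prop :=
  ∃ π : G.V → H.V, Function.Surjective π ∧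
    (∀ w : H.V, G.ConnectedOn (π ⁻¹' {w}) ∧ Odd (π ⁻¹' {w}).ncard) ∧
    ∃ g : {e : G.E // ∃ u v, G.ends e = s(u, v) ∧ π u ≠ π v} ≃ H.E,
      ∀ e, H.ends (g e) = (G.ends e.1).map π

/-- The 6-vertex graph consisting of two nonadjacent vertices `x = 0`, `y = 1`
and four vertices `a = 2`, `b = 3`, `c = 4`, `d = 5`, with edges `ab`, `cd` and
an edge from each of `a`, `b`, `c`, `d` to each of `x` and `y`. -/
def specialGraph : Multigraph where
  V := Fin 6
  E := Fin 10
  ends := ![s(2, 3), s(4, 5), s(2, 0), s(2, 1), s(3, 0), s(3, 1),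
            s(4, 0), s(4, 1), s(5, 0), s(5, 1)]

/-- The perfect matching polytope: the convex hull of the characteristic vectors
of the perfect matchings. -/
def pmPolytope (G : Multigraph) : Set (G.E → ℝ) :=
  convexHull ℝ {w | ∃ M : Finset G.E, G.IsPerfectMatching M ∧
    w = fun e => if e ∈ M then (1 : ℝ) else 0}

end Multigraph

set_option linter.unusedSectionVars false

/-- A finite graph given by the two ends of each edge; edges with equal ends are inert. -/
structure Gr (V E : Type) where
  a : E → V
  b : E → V

namespace Gr

open Finset

variable {V E : Type} [Fintype V] [Fintype E] (G : Gr V E)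

/-- The edges with exactly one end in `X`. -/
def cut (X : Finset V) : Finset E := univ.filter fun e => ¬ (G.a e ∈ X ↔ G.b e ∈ X)

/-- The non-inert edges with both ends in `X`. -/
def ins (X : Finset V) : Finset E :=
  univ.filter fun e => G.a e ∈ X ∧ G.b e ∈ X ∧ G.a e ≠ G.b e

/-- The number of edges leaving `X`. -/
def d (X : Finset V) : ℕ := (G.cut X).card

/-- Every vertex lies on exactly three (non-inert) edges. -/
def Cubic : Prop := ∀ v, G.d {v} = 3

/-- 3-edge-connected. -/
def EC3 : Prop := ∀ X : Finset V, X.Nonempty → X ≠ univ → 3 ≤ G.d X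

/-- Cyclically 4-edge-connected, in terms of cuts. -/
def C4 : Prop := ∀ X : Finset V, X.Nonempty → X ≠ univ →
  3 ≤ G.d X ∧ (G.d X = 3 → X.card = 1 ∨ Xᶜ.card = 1)

/-- The class `P` meets every non-inert edge in exactly one end. -/
def BipOn (X P : Finset V) : Prop :=
  ∀ e, G.a e ∈ X → G.b e ∈ X → G.a e ≠ G.b e → ¬ (G.a e ∈ P ↔ G.b e ∈ P)

def Bip (X : Finset V) : Prop := ∃ P, G.BipOn X P

variable {G}

lemma mem_cut {X : Finset V} {e : E} : e ∈ G.cut X ↔ ¬ (G.a e ∈ X ↔ G.b e ∈ X) := by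
  simp [cut]

lemma mem_ins {X : Finset V} {e : E} :
    e ∈ G.ins X ↔ G.a e ∈ X ∧ G.b e ∈ X ∧ G.a e ≠ G.b e := by
  simp [ins]

lemma mem_star {v : V} {e : E} : e ∈ G.cut {v} ↔ ¬ (G.a e = v ↔ G.b e = v) := by
  simp [cut]

lemma link_of_mem_cut {X : Finset V} {e : E} (h : e ∈ G.cut X) : G.a e ≠ G.b e := by
  intro h'; rw [mem_cut, h'] at h; exact h Iff.rfl

lemma cut_compl (X : Finset V) : G.cut Xᶜ = G.cut X := by
  ext e; simp only [mem_cut, mem_compl]; tauto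

lemma d_compl (X : Finset V) : G.d Xᶜ = G.d X := by rw [d, cut_compl, d]

lemma cut_univ : G.cut univ = ∅ := by ext e; simp [mem_cut]

lemma cut_empty : G.cut ∅ = ∅ := by ext e; simp [mem_cut]

lemma EC3.of_C4 (h : G.C4) : G.EC3 := fun X h1 h2 => (h X h1 h2).1

lemma sum_star {R : Type*} [CommSemiring R] (w : E → R) (X : Finset V) :
    ∑ v ∈ X, ∑ e ∈ G.cut {v}, w e = ∑ e ∈ G.cut X, w e + 2 * ∑ e ∈ G.ins X, w e := by
  have h1 : ∀ v, ∑ e ∈ G.cut {v}, w e = ∑ e, if e ∈ G.cut {v} then w e else 0 := by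
    intro v; rw [← sum_filter]; congr 1; ext e; simp
  have h2 : ∑ e ∈ G.cut X, w e = ∑ e, if e ∈ G.cut X then w e else 0 := by
    rw [← sum_filter]; congr 1; ext e; simp
  have h3 : ∑ e ∈ G.ins X, w e = ∑ e, if e ∈ G.ins X then w e else 0 := by
    rw [← sum_filter]; congr 1; ext e; simp
  simp_rw [h1]
  rw [h2, h3, sum_comm, mul_sum, ← sum_add_distrib]
  refine sum_congr rfl fun e _ => ?_
  simp only [mem_cut, mem_ins, mem_singleton]
  by_cases hl : G.a e = G.b e
  · simp [hl]
  have h4 : ∀ v, (if ¬(G.a e = v ↔ G.b e = v) then w e else 0)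
      = (if G.a e = v then w e else 0) + (if G.b e = v then w e else 0) := by
    intro v
    by_cases h5 : G.a e = v
    · have : G.b e ≠ v := fun h => hl (h5.trans h.symm)
      simp [h5, this]
    · by_cases h6 : G.b e = v <;> simp [h5, h6]
  simp_rw [h4]
  rw [sum_add_distrib, sum_ite_eq, sum_ite_eq]
  by_cases h5 : G.a e ∈ X <;> by_cases h6 : G.b e ∈ X <;> simp [h5, h6, hl, two_mul]

lemma card_star (F : Finset E) (X : Finset V) :
    ∑ v ∈ X, (F ∩ G.cut {v}).card = (F ∩ G.cut X).card + 2 * (F ∩ G.ins X).card := by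
  have := sum_star (G := G) (fun e => if e ∈ F then (1:ℕ) else 0) X
  simp only [sum_ite_mem, sum_const, smul_eq_mul, mul_one] at this
  simpa only [inter_comm] using this

lemma d_star (X : Finset V) : ∑ v ∈ X, G.d {v} = G.d X + 2 * (G.ins X).card := by
  have := card_star (G := G) univ X
  simpa [d] using this

lemma Cubic.sum (h : G.Cubic) (X : Finset V) : 3 * X.card = G.d X + 2 * (G.ins X).card := by
  rw [← d_star, sum_congr rfl (fun v _ => h v)]; simp [mul_comm]

lemma Cubic.parity (h : G.Cubic) (X : Finset V) : G.d X % 2 = X.card % 2 := by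
  have := h.sum X; omega

lemma Cubic.even (h : G.Cubic) : Fintype.card V % 2 = 0 := by
  have := h.parity univ; rw [d, cut_univ] at this; simpa using this.symm

/-- `d` as a sum of indicators over all edges. -/
lemma d_eq_sum (X : Finset V) : G.d X = ∑ e, if (G.a e ∈ X ↔ G.b e ∈ X) then 0 else 1 := by
  rw [d, cut, card_filter]
  refine sum_congr rfl fun e _ => ?_
  by_cases h : (G.a e ∈ X ↔ G.b e ∈ X) <;> simp [h]

/-! ### Factors -/

variable (G)

/-- `F` uses non-inert edges meeting `A` only, its trace on the cut around `A` is `X`, and it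
has degree one (or three, inside `S`) at every vertex of `A`. -/
def IsPart (A S : Finset V) (X F : Finset E) : Prop :=
  F ⊆ G.cut A ∪ G.ins A ∧ F ∩ G.cut A = X ∧
    ∀ v ∈ A, (F ∩ G.cut {v}).card = 1 ∨ (v ∈ S ∧ (F ∩ G.cut {v}).card = 3)

def part (A S : Finset V) (X : Finset E) : Finset (Finset E) :=
  univ.filter fun F => G.IsPart A S X F

def N (A S : Finset V) (X : Finset E) : ℕ := (G.part A S X).card

/-- The number of factors with degree one everywhere, degree three being allowed in `S`. -/
def count (S : Finset V) : ℕ := G.N univ S ∅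

variable {G}

lemma mem_part {A S : Finset V} {X F : Finset E} : F ∈ G.part A S X ↔ G.IsPart A S X F := by
  simp [part]

lemma part_mono {A S T : Finset V} {X : Finset E} (h : S ⊆ T) :
    G.part A S X ⊆ G.part A T X := by
  intro F hF
  rw [mem_part] at *
  exact ⟨hF.1, hF.2.1, fun v hv => (hF.2.2 v hv).imp id fun h' => ⟨h h'.1, h'.2⟩⟩

lemma N_mono {A S T : Finset V} {X : Finset E} (h : S ⊆ T) : G.N A S X ≤ G.N A T X :=
  card_le_card (part_mono h)

lemma N_pos {A S : Finset V} {X F : Finset E} (h : G.IsPart A S X F) : 1 ≤ G.N A S X :=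
  card_pos.mpr ⟨F, mem_part.mpr h⟩

lemma two_le_N {A S : Finset V} {X F F' : Finset E} (h : G.IsPart A S X F)
    (h' : G.IsPart A S X F') (hne : F ≠ F') : 2 ≤ G.N A S X :=
  Finset.one_lt_card.mpr ⟨F, mem_part.mpr h, F', mem_part.mpr h', hne⟩

lemma isPart_univ {S : Finset V} {F : Finset E} : G.IsPart univ S ∅ F ↔
    (∀ e ∈ F, G.a e ≠ G.b e) ∧
      ∀ v, (F ∩ G.cut {v}).card = 1 ∨ (v ∈ S ∧ (F ∩ G.cut {v}).card = 3) := by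
  simp [IsPart, cut_univ, subset_iff, mem_ins]

lemma ins_compl_disj {A : Finset V} {e : E} (h : e ∈ G.ins Aᶜ) : e ∉ G.cut A ∪ G.ins A := by
  simp only [mem_ins, mem_cut, mem_union, mem_compl] at *; tauto

/-- Edges at a vertex of `A` meet `A`. -/
lemma star_subset {A : Finset V} {v : V} (hv : v ∈ A) : G.cut {v} ⊆ G.cut A ∪ G.ins A := by
  intro e he
  have hl := link_of_mem_cut he
  simp only [mem_ins, mem_cut, mem_union, mem_singleton] at *
  by_cases h1 : G.a e = v <;> by_cases h2 : G.b e = v <;> simp_all <;> tauto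

lemma IsPart.union_inter {A S : Finset V} {X F F' : Finset E} (hF : G.IsPart A S X F)
    (hF' : G.IsPart Aᶜ S X F') :
    (F ∪ F') ∩ (G.cut A ∪ G.ins A) = F ∧ (F ∪ F') ∩ (G.cut Aᶜ ∪ G.ins Aᶜ) = F' ∧
      F ∩ F' = X := by
  obtain ⟨h1, h2, -⟩ := hF
  obtain ⟨h3, h4, -⟩ := hF'
  rw [cut_compl] at h3 h4 ⊢
  have h5 : ∀ e, e ∈ G.ins A → e ∉ G.ins Aᶜ := by
    intro e; simp only [mem_ins, mem_compl]; tauto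
  have h6 : ∀ e, e ∈ G.cut A → e ∉ G.ins Aᶜ ∧ e ∉ G.ins A := by
    intro e; simp only [mem_ins, mem_compl, mem_cut]; tauto
  have h7 : ∀ e, e ∈ X ↔ e ∈ F ∧ e ∈ G.cut A := by
    intro e; rw [← h2, mem_inter]
  have h8 : ∀ e, e ∈ X ↔ e ∈ F' ∧ e ∈ G.cut A := by
    intro e; rw [← h4, mem_inter]
  refine ⟨?_, ?_, ?_⟩ <;>
  · ext e
    have := @h1 e; have := @h3 e; have := h5 e; have := h6 e; have := h7 e; have := h8 e
    clear h1 h2 h3 h4 h5 h6 h7 h8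
    simp only [mem_union, mem_inter] at *
    grind

lemma IsPart.union {A S : Finset V} {X F F' : Finset E} (hF : G.IsPart A S X F)
    (hF' : G.IsPart Aᶜ S X F') : G.IsPart univ S ∅ (F ∪ F') := by
  obtain ⟨h2, h3, -⟩ := hF.union_inter hF'
  rw [isPart_univ]
  constructor
  · intro e he
    have : e ∈ G.cut A ∪ G.ins A ∪ G.ins Aᶜ := by
      rcases mem_union.mp he with he | he
      · exact mem_union_left _ (hF.1 he)
      · have := hF'.1 he
        rw [cut_compl] at this
        simp only [mem_union] at this ⊢; tauto
    simp only [mem_union] at this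
    rcases this with (h | h) | h
    · exact link_of_mem_cut h
    · exact (mem_ins.mp h).2.2
    · exact (mem_ins.mp h).2.2
  · intro v
    by_cases hv : v ∈ A
    · have : (F ∪ F') ∩ G.cut {v} = F ∩ G.cut {v} := by
        conv_rhs => rw [← h2, inter_assoc, inter_eq_right.mpr (star_subset hv)]
      rw [this]; exact hF.2.2 v hv
    · have hv' : v ∈ Aᶜ := by simpa using hv
      have : (F ∪ F') ∩ G.cut {v} = F' ∩ G.cut {v} := by
        conv_rhs => rw [← h3, inter_assoc, inter_eq_right.mpr (star_subset hv')]
      rw [this]; exact hF'.2.2 v hv'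

/-- Gluing the two sides of a cut. -/
lemma glue (A S : Finset V) (𝒳 : Finset (Finset E)) :
    ∑ X ∈ 𝒳, G.N A S X * G.N Aᶜ S X ≤ G.count S := by
  have h1 : ∑ X ∈ 𝒳, G.N A S X * G.N Aᶜ S X
      = (𝒳.sigma fun X => G.part A S X ×ˢ G.part Aᶜ S X).card := by
    rw [card_sigma]; simp only [card_product, N]
  rw [h1]
  refine card_le_card_of_injOn (fun p => p.2.1 ∪ p.2.2) ?_ ?_
  · rintro ⟨X, F, F'⟩ h
    simp only [coe_sigma, Set.mem_sigma_iff, mem_coe, mem_product, mem_part] at h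
    obtain ⟨-, hF, hF'⟩ := h
    simp only [mem_coe, mem_part]
    exact hF.union hF'
  · rintro ⟨X, F, F'⟩ h ⟨Y, K, K'⟩ h' heq
    simp only [coe_sigma, Set.mem_sigma_iff, mem_coe, mem_product, mem_part] at h h'
    obtain ⟨-, hF, hF'⟩ := h
    obtain ⟨-, hK, hK'⟩ := h'
    have e1 := hF.union_inter hF'
    have e2 := hK.union_inter hK'
    simp only at heq
    rw [heq] at e1
    have e3 : F = K := e1.1.symm.trans e2.1
    have e4 : F' = K' := e1.2.1.symm.trans e2.2.1
    subst e3 e4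
    have : X = Y := hF.2.1.symm.trans hK.2.1
    subst this
    rfl

/-- The simple graph on `X` spanned by the edges outside `R`. -/
def sg (G : Gr V E) (X : Finset V) (R : Finset E) : SimpleGraph {x // x ∈ X} where
  Adj x y := x ≠ y ∧ ∃ e ∉ R, s(G.a e, G.b e) = s(x.1, y.1)
  symm := ⟨fun x y h => ⟨h.1.symm, by obtain ⟨e, h1, h2⟩ := h.2; exact ⟨e, h1, h2.trans Sym2.eq_swap⟩⟩⟩
  loopless := ⟨fun x h => h.1 rfl⟩

lemma exists_isPart_of_pm {X : Finset V} {R : Finset E} (M : (G.sg X R).Subgraph)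
    (hM : M.IsPerfectMatching) : ∃ F, G.IsPart X ∅ ∅ F ∧ Disjoint F R := by
  rw [SimpleGraph.Subgraph.isPerfectMatching_iff] at hM
  choose p hp hp' using hM
  have hex : ∀ z ∈ M.edgeSet, ∃ e, e ∈ G.ins X ∧ e ∉ R ∧
      s(G.a e, G.b e) = Sym2.map Subtype.val z := by
    intro z hz
    induction z using Sym2.ind with
    | _ x y =>
      have h1 : (G.sg X R).Adj x y := M.adj_sub hz
      obtain ⟨hne, e, he, h2⟩ := h1
      refine ⟨e, ?_, he, by simpa using h2⟩
      rw [mem_ins]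
      have hx := x.2; have hy := y.2
      have hne' : x.1 ≠ y.1 := fun h => hne (Subtype.ext h)
      rcases Sym2.eq_iff.mp h2 with ⟨h3, h4⟩ | ⟨h3, h4⟩ <;> rw [h3, h4]
      · exact ⟨hx, hy, hne'⟩
      · exact ⟨hy, hx, hne'.symm⟩
  choose ε h1 h2 h3 using hex
  refine ⟨univ.filter fun e => ∃ z, ∃ hz : z ∈ M.edgeSet, ε z hz = e, ⟨?_, ?_, ?_⟩, ?_⟩
  · intro e he
    simp only [mem_filter, mem_univ, true_and] at he
    obtain ⟨z, hz, rfl⟩ := he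
    exact mem_union_right _ (h1 z hz)
  · ext e
    simp only [mem_inter, mem_filter, mem_univ, true_and, notMem_empty, iff_false, not_and]
    rintro ⟨z, hz, rfl⟩
    have := h1 z hz
    rw [mem_ins] at this
    rw [mem_cut]; tauto
  · intro v hv
    left
    rw [card_eq_one]
    refine ⟨ε s(⟨v, hv⟩, p ⟨v, hv⟩) (hp ⟨v, hv⟩), ?_⟩
    ext e
    simp only [mem_inter, mem_filter, mem_univ, true_and, mem_singleton]
    have key : ∀ z (hz : z ∈ M.edgeSet), ε z hz ∈ G.cut {v} ↔ (⟨v, hv⟩ : {x // x ∈ X}) ∈ z := by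
      intro z hz
      have h4 := (mem_ins.mp (h1 z hz)).2.2
      have h5 : ε z hz ∈ G.cut {v} ↔ v ∈ s(G.a (ε z hz), G.b (ε z hz)) := by
        rw [mem_star, Sym2.mem_iff]; grind
      rw [h5, h3 z hz, Sym2.mem_map]
      constructor
      · rintro ⟨x, hx, hxv⟩
        have : x = ⟨v, hv⟩ := Subtype.ext hxv
        rwa [← this]
      · intro h; exact ⟨_, h, rfl⟩
    constructor
    · rintro ⟨⟨z, hz, rfl⟩, he⟩
      rw [key] at he
      obtain ⟨w, rfl⟩ := he
      have := hp' ⟨v, hv⟩ w hz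
      subst this; rfl
    · rintro rfl
      exact ⟨⟨_, _, rfl⟩, (key _ _).mpr (Sym2.mem_mk_left _ _)⟩
  · rw [disjoint_left]
    intro e he
    simp only [mem_filter, mem_univ, true_and] at he
    obtain ⟨z, hz, rfl⟩ := he
    exact h2 z hz

/-- Tutte's theorem on a vertex set `X` avoiding the edges of `R`. -/
lemma tutte (X : Finset V) (R : Finset E) (hX : X.card % 2 = 0) :
    (∃ F, G.IsPart X ∅ ∅ F ∧ Disjoint F R) ∨
    ∃ U ⊆ X, ∃ 𝒞 : Finset (Finset V), U.card + 2 ≤ 𝒞.card ∧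
      (𝒞 : Set (Finset V)).PairwiseDisjoint id ∧
      (∀ C ∈ 𝒞, C.card % 2 = 1 ∧ C ⊆ X ∧ Disjoint C U) ∧
      ∀ C ∈ 𝒞, ∀ e ∉ R, (G.a e ∈ C → G.b e ∈ X → G.b e ∈ C ∪ U) ∧
        (G.b e ∈ C → G.a e ∈ X → G.a e ∈ C ∪ U) := by
  by_cases h : ∃ M : (G.sg X R).Subgraph, M.IsPerfectMatching
  · obtain ⟨M, hM⟩ := h
    exact Or.inl (exists_isPart_of_pm M hM)
  right
  rw [SimpleGraph.tutte] at h
  push Not at h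
  obtain ⟨u, hu⟩ := h
  rw [SimpleGraph.IsTutteViolator] at hu
  set D := ((⊤ : (G.sg X R).Subgraph).deleteVerts u) with hD
  have hpar := SimpleGraph.odd_ncard_oddComponents D.coe
  have hverts : D.verts = uᶜ := by ext; simp [hD]
  have hcard : Nat.card D.verts + u.ncard = X.card := by
    rw [hverts]
    have := Set.ncard_add_ncard_compl u
    rw [Nat.card_eq_fintype_card, Fintype.card_coe] at this
    rw [Nat.card_coe_set_eq]; omega
  set f : D.coe.ConnectedComponent → Finset V := fun c =>
    univ.filter fun v => ∃ h : v ∈ X, ∃ h' : (⟨v, h⟩ : {x // x ∈ X}) ∈ D.verts,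
      D.coe.connectedComponentMk ⟨⟨v, h⟩, h'⟩ = c with hf
  have hfmem : ∀ c v, v ∈ f c ↔ ∃ h : v ∈ X, ∃ h' : (⟨v, h⟩ : {x // x ∈ X}) ∈ D.verts,
      D.coe.connectedComponentMk ⟨⟨v, h⟩, h'⟩ = c := by intro c v; simp [hf]
  have hfcard : ∀ c, (f c).card = c.supp.ncard := by
    intro c
    have : (f c : Set V) = (fun x : D.verts => (x.1.1 : V)) '' c.supp := by
      ext v
      rw [mem_coe, hfmem]
      simp only [Set.mem_image, SimpleGraph.ConnectedComponent.mem_supp_iff]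
      constructor
      · rintro ⟨h, h', h2⟩; exact ⟨⟨⟨v, h⟩, h'⟩, h2, rfl⟩
      · rintro ⟨⟨⟨v, h⟩, h'⟩, h2, rfl⟩; exact ⟨h, h', h2⟩
    rw [← Set.ncard_coe_finset, this, Set.ncard_image_of_injective]
    intro x y hxy
    exact Subtype.ext (Subtype.ext hxy)
  have hfin : D.coe.oddComponents.Finite := Set.toFinite _
  have hdisj : ∀ c c' v, v ∈ f c → v ∈ f c' → c = c' := by
    intro c c' v h1 h2
    rw [hfmem] at h1 h2
    obtain ⟨_, _, rfl⟩ := h1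
    obtain ⟨_, _, rfl⟩ := h2
    rfl
  have hodd : ∀ c ∈ D.coe.oddComponents, (f c).card % 2 = 1 := by
    intro c hc
    rw [hfcard]; exact Nat.odd_iff.mp hc
  have hinj : Set.InjOn f D.coe.oddComponents := by
    intro c hc c' hc' hcc
    have h1 : (f c).Nonempty := by
      rw [← card_pos]; have := hodd c hc; omega
    obtain ⟨v, hv⟩ := h1
    exact hdisj c c' v hv (hcc ▸ hv)
  have hadj : ∀ c (v w : V), v ∈ f c → (hv : v ∈ X) → (hw : w ∈ X) →
      (G.sg X R).Adj ⟨v, hv⟩ ⟨w, hw⟩ → (⟨w, hw⟩ : {x // x ∈ X}) ∉ u → w ∈ f c := by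
    intro c v w hvc hv hw hadj hwu
    rw [hfmem] at hvc ⊢
    obtain ⟨h1, h2, h3⟩ := hvc
    have h4 : (⟨w, hw⟩ : {x // x ∈ X}) ∈ D.verts := by rw [hverts]; exact hwu
    refine ⟨hw, h4, ?_⟩
    rw [← h3]
    refine SimpleGraph.ConnectedComponent.connectedComponentMk_eq_of_adj ?_
    have h5 : (⟨v, h1⟩ : {x // x ∈ X}) ∉ u := by rw [hverts] at h2; exact h2
    simp only [SimpleGraph.Subgraph.coe_adj, hD, SimpleGraph.Subgraph.deleteVerts_adj]
    simp only [SimpleGraph.Subgraph.verts_top, Set.mem_univ, true_and, SimpleGraph.Subgraph.top_adj]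
    exact ⟨hwu, h5, hadj.symm⟩
  refine ⟨univ.filter fun v => ∃ h : v ∈ X, (⟨v, h⟩ : {x // x ∈ X}) ∈ u, ?_,
    hfin.toFinset.image f, ?_, ?_, ?_, ?_⟩
  · intro v; simp only [mem_filter]; tauto
  · have h1 : (univ.filter fun v => ∃ h : v ∈ X, (⟨v, h⟩ : {x // x ∈ X}) ∈ u).card = u.ncard := by
      rw [← Set.ncard_coe_finset, ← Set.ncard_image_of_injective u Subtype.val_injective]
      congr 1; ext v; simp
    have h2 : (hfin.toFinset.image f).card = D.coe.oddComponents.ncard := by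
      rw [card_image_of_injOn (by simpa using hinj), Set.ncard_eq_toFinset_card _ hfin]
    rw [h1, h2]
    by_contra hcon
    have h3 : D.coe.oddComponents.ncard = u.ncard + 1 := by omega
    rw [h3, Nat.odd_iff, Nat.odd_iff] at hpar
    omega
  · intro C hC C' hC' hne
    simp only [coe_image, Set.Finite.coe_toFinset, Set.mem_image] at hC hC'
    obtain ⟨c, hc, rfl⟩ := hC
    obtain ⟨c', hc', rfl⟩ := hC'
    rw [Function.onFun, id, id, disjoint_left]
    intro v h1 h2
    exact hne (by rw [hdisj c c' v h1 h2])
  · intro C hC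
    simp only [mem_image, Set.Finite.mem_toFinset] at hC
    obtain ⟨c, hc, rfl⟩ := hC
    refine ⟨hodd c hc, ?_, ?_⟩
    · intro v hv; rw [hfmem] at hv; exact hv.1
    · rw [disjoint_left]
      intro v hv hv'
      rw [hfmem] at hv
      simp only [mem_filter, mem_univ, true_and] at hv'
      obtain ⟨h1, h2, -⟩ := hv
      obtain ⟨h3, h4⟩ := hv'
      rw [hverts] at h2
      exact h2 h4
  · intro C hC e heR
    simp only [mem_image, Set.Finite.mem_toFinset] at hC
    obtain ⟨c, hc, rfl⟩ := hC
    have hX' : ∀ v, v ∈ f c → v ∈ X := fun v hv => by rw [hfmem] at hv; exact hv.1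
    simp only [mem_union, mem_filter, mem_univ, true_and]
    constructor
    · intro h1 h2
      by_cases h3 : (⟨G.b e, h2⟩ : {x // x ∈ X}) ∈ u
      · exact Or.inr ⟨h2, h3⟩
      left
      by_cases h4 : G.a e = G.b e
      · rwa [← h4]
      exact hadj c _ _ h1 (hX' _ h1) h2 ⟨fun h => h4 (congrArg Subtype.val h), e, heR, rfl⟩ h3
    · intro h1 h2
      by_cases h3 : (⟨G.a e, h2⟩ : {x // x ∈ X}) ∈ u
      · exact Or.inr ⟨h2, h3⟩
      left
      by_cases h4 : G.a e = G.b e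
      · rwa [h4]
      exact hadj c _ _ h1 (hX' _ h1) h2
        ⟨fun h => h4 (congrArg Subtype.val h).symm, e, heR, Sym2.eq_swap⟩ h3

lemma sum_d_comm (𝒞 : Finset (Finset V)) :
    ∑ C ∈ 𝒞, G.d C = ∑ e, (𝒞.filter fun C => e ∈ G.cut C).card := by
  simp only [card_filter, d]
  rw [sum_comm]
  refine sum_congr rfl fun C _ => ?_
  rw [sum_boole]; simp

lemma sum_star_comm (U : Finset V) :
    ∑ v ∈ U, G.d {v} = ∑ e, (U.filter fun v => e ∈ G.cut {v}).card := by
  simp only [card_filter, d]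
  rw [sum_comm]
  refine sum_congr rfl fun C _ => ?_
  rw [sum_boole]; simp

/-- Edgewise comparison for a Tutte violator. -/
lemma tutte_edge {X U : Finset V} {R : Finset E} {𝒞 : Finset (Finset V)}
    (hdis : (𝒞 : Set (Finset V)).PairwiseDisjoint id)
    (hC : ∀ C ∈ 𝒞, C.card % 2 = 1 ∧ C ⊆ X ∧ Disjoint C U)
    (hadj : ∀ C ∈ 𝒞, ∀ e ∉ R, (G.a e ∈ C → G.b e ∈ X → G.b e ∈ C ∪ U) ∧
        (G.b e ∈ C → G.a e ∈ X → G.a e ∈ C ∪ U)) (e : E) :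
    (𝒞.filter fun C => e ∈ G.cut C).card ≤ (U.filter fun v => e ∈ G.cut {v}).card
      + (if e ∈ G.cut X then 1 else 0) + (if e ∈ R then 2 else 0) := by
  have huniq : ∀ C ∈ 𝒞, ∀ C' ∈ 𝒞, ∀ v, v ∈ C → v ∈ C' → C = C' := by
    intro C h C' h' v hv hv'
    by_contra hne
    exact disjoint_left.mp (hdis h h' hne) hv hv'
  have hA : (𝒞.filter fun C => G.a e ∈ C ∧ G.b e ∉ C).card ≤ 1 :=
    card_le_one.mpr fun C h C' h' => by
      simp only [mem_filter] at h h'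
      exact huniq C h.1 C' h'.1 _ h.2.1 h'.2.1
  have hB : (𝒞.filter fun C => G.b e ∈ C ∧ G.a e ∉ C).card ≤ 1 :=
    card_le_one.mpr fun C h C' h' => by
      simp only [mem_filter] at h h'
      exact huniq C h.1 C' h'.1 _ h.2.1 h'.2.1
  have hsplit : (𝒞.filter fun C => e ∈ G.cut C).card ≤
      (𝒞.filter fun C => G.a e ∈ C ∧ G.b e ∉ C).card +
      (𝒞.filter fun C => G.b e ∈ C ∧ G.a e ∉ C).card := by
    refine (card_le_card ?_).trans (card_union_le _ _)
    intro C h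
    simp only [mem_filter, mem_union, mem_cut] at *
    tauto
  by_cases hR : e ∈ R
  · simp only [hR, if_true]; omega
  by_cases hne : (𝒞.filter fun C => e ∈ G.cut C) = ∅
  · rw [hne]; simp
  have key : ∀ C ∈ 𝒞, e ∈ G.cut C →
      1 ≤ (U.filter fun v => e ∈ G.cut {v}).card + (if e ∈ G.cut X then 1 else 0) := by
    intro C h1 h2
    have hl := link_of_mem_cut h2
    have h3 := hadj C h1 e hR
    have h4 := hC C h1
    have h5 : ∀ v, v ∈ C → v ∉ U := fun v hv => disjoint_left.mp h4.2.2 hv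
    by_cases h6 : e ∈ G.cut X
    · simp [h6]
    suffices h : 0 < (U.filter fun v => e ∈ G.cut {v}).card by omega
    rw [card_pos]
    rw [mem_cut] at h2 h6
    by_cases ha : G.a e ∈ C
    · have hb : G.b e ∉ C := by tauto
      have hbX : G.b e ∈ X := by have := h4.2.1 ha; tauto
      have hbU := h3.1 ha hbX
      refine ⟨G.b e, mem_filter.mpr ⟨?_, ?_⟩⟩
      · rcases mem_union.mp hbU with h | h
        · exact absurd h hb
        · exact h
      · rw [mem_star]; tauto
    · have hb : G.b e ∈ C := by tauto
      have haX : G.a e ∈ X := by have := h4.2.1 hb; tauto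
      have haU := h3.2 hb haX
      refine ⟨G.a e, mem_filter.mpr ⟨?_, ?_⟩⟩
      · rcases mem_union.mp haU with h | h
        · exact absurd h ha
        · exact h
      · rw [mem_star]; have := Ne.symm hl; tauto
  obtain ⟨C, hCm⟩ := nonempty_iff_ne_empty.mpr hne
  rw [mem_filter] at hCm
  have h1 := key C hCm.1 hCm.2
  suffices h : (𝒞.filter fun C => e ∈ G.cut C).card ≤ 1 by omega
  rw [card_le_one]
  intro C₁ h₁ C₂ h₂
  simp only [mem_filter, mem_cut] at h₁ h₂
  have g1 := hadj C₁ h₁.1 e hR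
  have g2 := hadj C₂ h₂.1 e hR
  have k1 := hC C₁ h₁.1
  have k2 := hC C₂ h₂.1
  have l1 : ∀ v, v ∈ C₁ → v ∈ X ∧ v ∉ U := fun v h => ⟨k1.2.1 h, disjoint_left.mp k1.2.2 h⟩
  have l2 : ∀ v, v ∈ C₂ → v ∈ X ∧ v ∉ U := fun v h => ⟨k2.2.1 h, disjoint_left.mp k2.2.2 h⟩
  simp only [mem_union] at g1 g2
  have m := huniq C₁ h₁.1 C₂ h₂.1
  have ma := m (G.a e)
  have mb := m (G.b e)
  have n1 := l1 (G.a e); have n2 := l1 (G.b e)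
  have n3 := l2 (G.a e); have n4 := l2 (G.b e)
  clear hA hB hsplit hne key h1 hCm hadj hC hdis k1 k2 l1 l2 m huniq
  grind

/-- Either a perfect matching of `X` avoiding `R`, or a violator for which everything is tight. -/
lemma tutte_tight (hG : G.Cubic) (h3 : G.EC3) (X : Finset V) (R : Finset E)
    (hX : X.card % 2 = 0) (hd : G.d X + 2 * R.card ≤ 6) :
    (∃ F, G.IsPart X ∅ ∅ F ∧ Disjoint F R) ∨
    (G.d X + 2 * R.card = 6 ∧ ∃ U ⊆ X, ∃ 𝒞 : Finset (Finset V), 𝒞.card = U.card + 2 ∧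
      (𝒞 : Set (Finset V)).PairwiseDisjoint id ∧
      (∀ C ∈ 𝒞, C.card % 2 = 1 ∧ C ⊆ X ∧ Disjoint C U ∧ G.d C = 3) ∧
      (∀ C ∈ 𝒞, ∀ e ∉ R, (G.a e ∈ C → G.b e ∈ X → G.b e ∈ C ∪ U) ∧
        (G.b e ∈ C → G.a e ∈ X → G.a e ∈ C ∪ U)) ∧
      ∀ e, (𝒞.filter fun C => e ∈ G.cut C).card = (U.filter fun v => e ∈ G.cut {v}).card
      + (if e ∈ G.cut X then 1 else 0) + (if e ∈ R then 2 else 0)) := by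
  rcases tutte (G := G) X R hX with h | ⟨U, hU, 𝒞, h1, h2, h4, h5⟩
  · exact Or.inl h
  right
  have hedge := tutte_edge h2 h4 h5
  have hdC : ∀ C ∈ 𝒞, 3 ≤ G.d C := by
    intro C hC
    refine h3 C ?_ ?_
    · rw [← card_pos]; have := (h4 C hC).1; omega
    · rintro rfl
      have := (h4 _ hC).1
      rw [card_univ] at this
      have := hG.even
      omega
  have hs1 : 3 * 𝒞.card ≤ ∑ C ∈ 𝒞, G.d C := by
    have := sum_le_sum hdC
    simpa [mul_comm] using this
  have hs2 := sum_le_sum fun e (_ : e ∈ (univ : Finset E)) => hedge e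
  have hs3 : ∑ e : E, ((U.filter fun v => e ∈ G.cut {v}).card
      + (if e ∈ G.cut X then 1 else 0) + (if e ∈ R then 2 else 0))
      = 3 * U.card + G.d X + 2 * R.card := by
    rw [sum_add_distrib, sum_add_distrib, ← sum_star_comm, sum_congr rfl fun v _ => hG v]
    simp [d, mul_comm]
  rw [← sum_d_comm, hs3] at hs2
  refine ⟨by omega, U, hU, 𝒞, by omega, h2, ?_, h5, ?_⟩
  · have heq : ∑ C ∈ 𝒞, 3 = ∑ C ∈ 𝒞, G.d C := by
      rw [sum_const, smul_eq_mul]; omega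
    have := (sum_eq_sum_iff_of_le hdC).mp heq
    intro C hC
    exact ⟨(h4 C hC).1, (h4 C hC).2.1, (h4 C hC).2.2, (this C hC).symm⟩
  · have heq : ∑ e : E, (𝒞.filter fun C => e ∈ G.cut C).card =
        ∑ e : E, ((U.filter fun v => e ∈ G.cut {v}).card
          + (if e ∈ G.cut X then 1 else 0) + (if e ∈ R then 2 else 0)) := by
      rw [hs3, ← sum_d_comm]; omega
    have := (sum_eq_sum_iff_of_le fun e _ => hedge e).mp heq
    intro e
    exact this e (mem_univ e)

lemma exists_pm_of_lt (hG : G.Cubic) (h3 : G.EC3) (X : Finset V) (R : Finset E)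
    (hX : X.card % 2 = 0) (hd : G.d X + 2 * R.card < 6) :
    ∃ F, G.IsPart X ∅ ∅ F ∧ Disjoint F R := by
  rcases tutte_tight hG h3 X R hX hd.le with h | ⟨h, -⟩
  · exact h
  · omega

/-- If `X` has no nontrivial 3-cuts, a tight violator is a near-bipartition of `X`. -/
lemma tutte_bip (hG : G.Cubic) (h3 : G.EC3) (X : Finset V) (R : Finset E)
    (hX : X.card % 2 = 0) (hd : G.d X + 2 * R.card ≤ 6)
    (hin : ∀ C ⊆ X, G.d C = 3 → C.card % 2 = 1 → C.card = 1) :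
    (∃ F, G.IsPart X ∅ ∅ F ∧ Disjoint F R) ∨
    (G.d X + 2 * R.card = 6 ∧ ∃ U ⊆ X, X.card = 2 * U.card + 2 ∧
      (∀ e ∈ R, G.a e ∈ X \ U ∧ G.b e ∈ X \ U) ∧
      (∀ e ∈ G.ins X, e ∉ R → ¬ (G.a e ∈ U ↔ G.b e ∈ U)) ∧
      ∀ e ∈ G.cut X, G.a e ∉ U ∧ G.b e ∉ U) := by
  rcases tutte_tight hG h3 X R hX hd with h | ⟨h, U, hU, 𝒞, h1, h2, h4, h5, h6⟩
  · exact Or.inl h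
  refine Or.inr ⟨h, U, hU, ?_⟩
  have hsing : ∀ C ∈ 𝒞, ∃ v, C = {v} := fun C hC =>
    card_eq_one.mp (hin C (h4 C hC).2.1 (h4 C hC).2.2.2 (h4 C hC).1)
  set W : Finset V := univ.filter fun v => {v} ∈ 𝒞 with hW
  have hWm : ∀ v, v ∈ W ↔ {v} ∈ 𝒞 := by intro v; simp [hW]
  have hWX : ∀ v ∈ W, v ∈ X ∧ v ∉ U := by
    intro v hv
    have := h4 _ ((hWm v).mp hv)
    exact ⟨this.2.1 (mem_singleton_self v), disjoint_left.mp this.2.2.1 (mem_singleton_self v)⟩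
  have hcard : W.card = 𝒞.card := by
    refine card_bij (fun v _ => {v}) (fun v hv => (hWm v).mp hv) (by simp) ?_
    intro C hC
    obtain ⟨v, rfl⟩ := hsing C hC
    exact ⟨v, (hWm v).mpr hC, rfl⟩
  -- number of `W`-ends of an edge
  have hk : ∀ e, (𝒞.filter fun C => e ∈ G.cut C).card = (W.filter fun v => e ∈ G.cut {v}).card := by
    intro e
    symm
    refine card_bij (fun v _ => {v}) (fun v hv => ?_) (by simp) ?_
    · rw [mem_filter] at hv ⊢; exact ⟨(hWm v).mp hv.1, hv.2⟩
    · intro C hC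
      rw [mem_filter] at hC
      obtain ⟨v, rfl⟩ := hsing C hC.1
      exact ⟨v, mem_filter.mpr ⟨(hWm v).mpr hC.1, hC.2⟩, rfl⟩
  have hcnt : ∀ (Y : Finset V) e, G.a e ≠ G.b e → (Y.filter fun v => e ∈ G.cut {v}).card =
      (if G.a e ∈ Y then 1 else 0) + (if G.b e ∈ Y then 1 else 0) := by
    intro Y e hl
    have h7 : (Y.filter fun v => e ∈ G.cut {v}) = Y ∩ {G.a e, G.b e} := by
      ext v; simp only [mem_filter, mem_inter, mem_star, mem_insert, mem_singleton]
      have := Ne.symm hl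
      grind
    rw [h7, inter_comm]
    by_cases p1 : G.a e ∈ Y <;> by_cases p2 : G.b e ∈ Y <;>
      simp [p1, p2, hl, insert_inter_of_mem, insert_inter_of_notMem, singleton_inter_of_mem, singleton_inter_of_notMem]
  have hE : ∀ e, G.a e ≠ G.b e →
      (if G.a e ∈ W then 1 else 0) + (if G.b e ∈ W then 1 else 0) =
      (if G.a e ∈ U then 1 else 0) + (if G.b e ∈ U then 1 else 0)
      + (if e ∈ G.cut X then 1 else 0) + (if e ∈ R then 2 else 0) := by
    intro e hl
    have := h6 e
    rwa [hk, hcnt _ _ hl, hcnt _ _ hl] at this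
  have hRl : ∀ e ∈ R, G.a e ≠ G.b e := by
    intro e he hl
    have h7 := h6 e
    have h8 : (𝒞.filter fun C => e ∈ G.cut C) = ∅ := by
      ext C; simp only [mem_filter, mem_cut, hl]; simp
    rw [h8, if_pos he] at h7
    simp at h7
  -- every vertex of `X` is in `U` or `W`
  have hrest : X \ (U ∪ W) = ∅ := by
    by_contra hne
    have h7 : G.d (X \ (U ∪ W)) = 0 := by
      rw [d, card_eq_zero]
      ext e
      simp only [notMem_empty, iff_false]
      intro he
      have hl := link_of_mem_cut he
      have h8 := hE e hl
      have wa := hWX (G.a e)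
      have wb := hWX (G.b e)
      have ua := @hU (G.a e)
      have ub := @hU (G.b e)
      rw [mem_cut] at he
      simp only [mem_cut, mem_sdiff, mem_union] at *
      by_cases q : e ∈ R
      · simp only [q, if_true] at h8
        grind
      · have w5 : G.b e ∈ W → G.a e ∈ X → G.a e = G.b e ∨ G.a e ∈ U := by
          intro hb ha
          have := (h5 _ ((hWm _).mp hb) e q).2 (by simp) ha
          simpa using this
        have w6 : G.a e ∈ W → G.b e ∈ X → G.b e = G.a e ∨ G.b e ∈ U := by
          intro hb ha
          have := (h5 _ ((hWm _).mp hb) e q).1 (by simp) ha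
          simpa using this
        grind
    have hWne : W.Nonempty := by rw [← card_pos]; omega
    obtain ⟨w, hw⟩ := hWne
    have := h3 (X \ (U ∪ W)) (nonempty_iff_ne_empty.mpr hne) (by
      intro hh
      have : w ∈ X \ (U ∪ W) := by rw [hh]; simp
      simp [hw] at this)
    omega
  have hXU : ∀ v, v ∈ X \ U ↔ v ∈ W := by
    intro v
    have := Finset.ext_iff.mp hrest v
    have := hWX v
    simp only [mem_sdiff, mem_union, notMem_empty] at *
    tauto
  refine ⟨?_, ?_, ?_, ?_⟩
  · have : X \ U = W := by ext v; exact hXU v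
    have h8 := card_sdiff_of_subset hU
    rw [this] at h8
    have := card_le_card hU
    omega
  · intro e he
    have h8 := hE e (hRl e he)
    simp only [he, if_true] at h8
    rw [hXU, hXU]
    grind
  · intro e he heR
    rw [mem_ins] at he
    have h8 := hE e he.2.2
    have h9 := hXU (G.a e)
    have h10 := hXU (G.b e)
    have h11 : e ∉ G.cut X := by rw [mem_cut]; tauto
    simp only [heR, h11, if_false] at h8
    simp only [mem_sdiff] at h9 h10
    grind
  · intro e he
    have hl := link_of_mem_cut he
    have h8 := hE e hl
    have ua := @hU (G.a e)
    have ub := @hU (G.b e)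
    have wa := hWX (G.a e)
    have wb := hWX (G.b e)
    simp only [he, if_true] at h8
    rw [mem_cut] at he
    grind

variable (G) in
/-- The end in `A` of an edge of the cut around `A`. -/
def inn (A : Finset V) (e : E) : V := if G.a e ∈ A then G.a e else G.b e

lemma inn_mem {A : Finset V} {e : E} (h : e ∈ G.cut A) : G.inn A e ∈ A := by
  rw [mem_cut] at h; unfold inn; split_ifs <;> tauto

lemma mem_star_inn {A : Finset V} {e : E} (h : e ∈ G.cut A) : e ∈ G.cut {G.inn A e} := by
  rw [mem_cut] at h; rw [mem_star]; unfold inn; split_ifs with h1 <;> grind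

lemma inn_eq_of_mem {A : Finset V} {e : E} {v : V} (h : e ∈ G.cut A) (hv : v ∈ A)
    (he : e ∈ G.cut {v}) : G.inn A e = v := by
  rw [mem_cut] at h; rw [mem_star] at he; unfold inn; split_ifs with h1 <;> grind

/-- Removing from `A` the inner ends of the cut edges in `Z`. -/
def peel (G : Gr V E) (A : Finset V) (Z : Finset E) : Finset V := A \ Z.image (G.inn A)

lemma cut_peel_subset {A : Finset V} {Z : Finset E} (hZ : Z ⊆ G.cut A) :
    G.cut (G.peel A Z) ⊆ (G.cut A \ Z) ∪ Z.biUnion fun e => (G.cut {G.inn A e}).erase e := by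
  intro e he
  have hl := link_of_mem_cut he
  by_cases h1 : ∃ z ∈ Z, e ∈ G.cut {G.inn A z}
  · obtain ⟨z, hz, hez⟩ := h1
    by_cases h2 : e = z
    · subst h2
      exfalso
      have h3 : G.inn A e ∉ G.peel A Z := by
        simp only [peel, mem_sdiff, mem_image, not_and, not_not]
        exact fun _ => ⟨e, hz, rfl⟩
      have h4 : ∀ x ∈ G.peel A Z, x ∈ A := fun x hx => (mem_sdiff.mp hx).1
      have ha := h4 (G.a e); have hb := h4 (G.b e)
      have hzc := hZ hz
      rw [mem_cut] at he hzc
      rw [mem_star] at hez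
      unfold inn at *
      split_ifs at * <;> grind
    · exact mem_union_right _ (mem_biUnion.mpr ⟨z, hz, mem_erase.mpr ⟨h2, hez⟩⟩)
  · push Not at h1
    refine mem_union_left _ (mem_sdiff.mpr ⟨?_, ?_⟩)
    · have key : ∀ x, e ∈ G.cut {x} → (x ∈ G.peel A Z ↔ x ∈ A) := by
        intro x hx
        simp only [peel, mem_sdiff, mem_image, and_iff_left_iff_imp]
        rintro - ⟨z, hz, rfl⟩
        exact h1 z hz hx
      rw [mem_cut] at he ⊢
      rwa [key, key] at he
      · rw [mem_star]; simpa using hl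
      · rw [mem_star]; simpa using fun h => hl h.symm
    · intro hz
      exact h1 e hz (mem_star_inn (hZ hz))

lemma d_peel_le (hG : G.Cubic) {A : Finset V} {Z : Finset E} (hZ : Z ⊆ G.cut A) :
    G.d (G.peel A Z) ≤ G.d A + Z.card := by
  have h1 := card_le_card (cut_peel_subset hZ)
  have h2 : (Z.biUnion fun e => (G.cut {G.inn A e}).erase e).card ≤ Z.card * 2 := by
    refine card_biUnion_le_card_mul _ _ _ fun e he => ?_
    rw [card_erase_of_mem (mem_star_inn (hZ he))]
    have := hG (G.inn A e); rw [d] at this; omega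
  have h3 := card_union_le (G.cut A \ Z) (Z.biUnion fun e => (G.cut {G.inn A e}).erase e)
  have h4 := card_sdiff_of_subset hZ
  have h5 := card_le_card hZ
  simp only [d] at *
  omega

lemma card_peel {A : Finset V} {Z : Finset E} (hZ : Z ⊆ G.cut A)
    (hinj : Set.InjOn (G.inn A) Z) : (G.peel A Z).card + Z.card = A.card := by
  have h1 : Z.image (G.inn A) ⊆ A := by
    intro x hx; obtain ⟨e, he, rfl⟩ := mem_image.mp hx; exact inn_mem (hZ he)
  have h2 := card_sdiff_of_subset h1
  have h3 := card_le_card h1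
  rw [card_image_of_injOn hinj] at h2 h3
  rw [peel]; omega

lemma isPart_of_peel {A : Finset V} {Z F : Finset E} (hZ : Z ⊆ G.cut A)
    (hinj : Set.InjOn (G.inn A) Z) (hF : G.IsPart (G.peel A Z) ∅ ∅ F) :
    G.IsPart A ∅ Z (F ∪ Z) := by
  obtain ⟨h1, h2, h3⟩ := hF
  have hp : ∀ x ∈ G.peel A Z, x ∈ A := fun x hx => (mem_sdiff.mp hx).1
  have hFi : ∀ e ∈ F, e ∈ G.ins (G.peel A Z) := by
    intro e he
    have := h1 he
    rcases mem_union.mp this with h | h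
    · have : e ∈ F ∩ G.cut (G.peel A Z) := mem_inter.mpr ⟨he, h⟩
      rw [h2] at this; simp at this
    · exact h
  have hFA : ∀ e ∈ F, e ∈ G.ins A ∧ e ∉ G.cut A := by
    intro e he
    have := mem_ins.mp (hFi e he)
    have ha := hp _ this.1; have hb := hp _ this.2.1
    rw [mem_ins, mem_cut]; tauto
  refine ⟨?_, ?_, ?_⟩
  · intro e he
    rcases mem_union.mp he with h | h
    · exact mem_union_right _ (hFA e h).1
    · exact mem_union_left _ (hZ h)
  · ext e
    have := hFA e
    have := @hZ e
    simp only [mem_inter, mem_union]; tauto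
  · intro v hv
    left
    by_cases hvp : v ∈ G.peel A Z
    · have h4 : (F ∪ Z) ∩ G.cut {v} = F ∩ G.cut {v} := by
        ext e
        simp only [mem_inter, mem_union]
        constructor
        · rintro ⟨h | h, h'⟩
          · exact ⟨h, h'⟩
          · exfalso
            have := inn_eq_of_mem (hZ h) hv h'
            simp only [peel, mem_sdiff, mem_image, not_exists, not_and] at hvp
            exact hvp.2 e h this
        · rintro ⟨h, h'⟩; exact ⟨Or.inl h, h'⟩
      rw [h4]
      rcases h3 v hvp with h | h
      · exact h
      · simp at h
    · have h4 : v ∈ Z.image (G.inn A) := by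
        simp only [peel, mem_sdiff] at hvp; tauto
      obtain ⟨z, hz, hzv⟩ := mem_image.mp h4
      rw [card_eq_one]
      refine ⟨z, ?_⟩
      ext e
      simp only [mem_inter, mem_union, mem_singleton]
      constructor
      · rintro ⟨h | h, h'⟩
        · exfalso
          have := mem_ins.mp (hFi e h)
          rw [mem_star] at h'
          grind
        · exact hinj h hz ((inn_eq_of_mem (hZ h) hv h').trans hzv.symm)
      · rintro rfl
        exact ⟨Or.inr hz, hzv ▸ mem_star_inn (hZ hz)⟩

lemma peel_part_disj {A : Finset V} {Z F : Finset E} (hZ : Z ⊆ G.cut A)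
    (hF : G.IsPart (G.peel A Z) ∅ ∅ F) : Disjoint F Z := by
  rw [disjoint_left]
  intro e he hz
  have h1 : e ∉ G.cut (G.peel A Z) := by
    intro h
    have : e ∈ F ∩ G.cut (G.peel A Z) := mem_inter.mpr ⟨he, h⟩
    rw [hF.2.1] at this; simp at this
  have h2 : e ∈ G.ins (G.peel A Z) := (mem_union.mp (hF.1 he)).resolve_left h1
  have := hZ hz
  have hp : ∀ x ∈ G.peel A Z, x ∈ A := fun x hx => (mem_sdiff.mp hx).1
  rw [mem_cut] at this
  rw [mem_ins] at h2
  have ha := hp _ h2.1; have hb := hp _ h2.2.1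
  tauto

/-- Each cut edge of a 3-edge cut extends to a matching of the side. -/
lemma one_le_N_three (hG : G.Cubic) (h3 : G.EC3) {A : Finset V} (hd : G.d A = 3) {g : E}
    (hg : g ∈ G.cut A) : 1 ≤ G.N A ∅ {g} := by
  have hZ : {g} ⊆ G.cut A := by simpa using hg
  have hinj : Set.InjOn (G.inn A) (({g} : Finset E) : Set E) := by simp
  have h1 := card_peel hZ hinj
  have h2 := hG.parity A
  have h4 := d_peel_le hG hZ
  rw [card_singleton] at *
  obtain ⟨F, hF, -⟩ := exists_pm_of_lt hG h3 (G.peel A {g}) ∅ (by omega) (by simp; omega)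
  exact N_pos (isPart_of_peel hZ hinj hF)

/-- Two perfect matchings on a side of a 4-edge cut. -/
lemma two_pm (hG : G.Cubic) (h3 : G.EC3) {X : Finset V} (hd : G.d X = 4) (hX : 4 ≤ X.card)
    (hin : ∀ C ⊆ X, G.d C = 3 → C.card % 2 = 1 → C.card = 1) :
    ∃ F F', G.IsPart X ∅ ∅ F ∧ G.IsPart X ∅ ∅ F' ∧ F ≠ F' := by
  have hpar := hG.parity X
  obtain ⟨M, hM, -⟩ := exists_pm_of_lt hG h3 X ∅ (by omega) (by simp; omega)
  by_contra hcon
  have huni : ∀ F, G.IsPart X ∅ ∅ F → F = M := by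
    intro F hF
    by_contra h
    exact hcon ⟨F, M, hF, hM, h⟩
  have htight : ∀ e ∈ M, ∃ U ⊆ X, X.card = 2 * U.card + 2 ∧
      (G.a e ∈ X \ U ∧ G.b e ∈ X \ U) ∧
      (∀ f ∈ G.ins X, f ≠ e → ¬ (G.a f ∈ U ↔ G.b f ∈ U)) ∧
      ∀ f ∈ G.cut X, G.a f ∉ U ∧ G.b f ∉ U := by
    intro e he
    rcases tutte_bip hG h3 X {e} (by omega) (by simp; omega) hin with ⟨F, hF, hdis⟩ | ⟨-, U, h⟩
    · exfalso
      rw [huni F hF] at hdis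
      simp at hdis; exact hdis he
    · refine ⟨U, h.1, h.2.1, h.2.2.1 e (by simp), fun f hf hfe => h.2.2.2.1 f hf (by simpa using hfe),
        h.2.2.2.2⟩
  have hMi : ∀ e ∈ M, e ∈ G.ins X := by
    intro e he
    refine (mem_union.mp (hM.1 he)).resolve_left fun h => ?_
    have : e ∈ M ∩ G.cut X := mem_inter.mpr ⟨he, h⟩
    rw [hM.2.1] at this; simp at this
  have hMe : ∀ v ∈ X, ∃ e ∈ M, e ∈ G.cut {v} := by
    intro v hv
    have h1 := (hM.2.2 v hv).resolve_right (by simp)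
    obtain ⟨e, he⟩ := card_pos.mp (by omega : 0 < (M ∩ G.cut {v}).card)
    exact ⟨e, (mem_inter.mp he).1, (mem_inter.mp he).2⟩
  obtain ⟨x, hx⟩ : X.Nonempty := by rw [← card_pos]; omega
  obtain ⟨e, heM, -⟩ := hMe x hx
  obtain ⟨U, hUX, hUc, heU, hUe, hUl⟩ := htight e heM
  obtain ⟨u, hu⟩ : U.Nonempty := by rw [← card_pos]; omega
  obtain ⟨e', heM', heu⟩ := hMe u (hUX hu)
  obtain ⟨U', hUX', hUc', heU', hUe', hUl'⟩ := htight e' heM'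
  have hne : e ≠ e' := by
    rintro rfl
    rw [mem_star] at heu
    simp only [mem_sdiff] at heU
    grind
  set Y := X.filter fun x => ¬ (x ∈ U ↔ x ∈ U') with hY
  have hYm : ∀ x, x ∈ Y ↔ x ∈ X ∧ ¬ (x ∈ U ↔ x ∈ U') := by intro x; simp [hY]
  have hsub : G.cut Y ⊆ {e, e'} := by
    intro f hf
    have hl := link_of_mem_cut hf
    simp only [mem_insert, mem_singleton]
    by_contra hfe
    push Not at hfe
    rw [mem_cut, hYm, hYm] at hf
    by_cases hi : f ∈ G.ins X
    · have h1 := hUe f hi hfe.1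
      have h2 := hUe' f hi hfe.2
      rw [mem_ins] at hi
      clear hUe hUe' hUl hUl' heU heU' hYm
      grind
    · by_cases hc : f ∈ G.cut X
      · have h1 := hUl f hc
        have h2 := hUl' f hc
        clear hUe hUe' hUl hUl' heU heU' hYm
        grind
      · rw [mem_ins] at hi
        rw [mem_cut] at hc
        clear hUe hUe' hUl hUl' heU heU' hYm
        grind
  have hd2 : G.d Y ≤ 2 := (card_le_card hsub).trans card_le_two
  have hflip := hUe' e (hMi e heM) hne
  have hflip' : ¬ (G.a e ∈ Y ↔ G.b e ∈ Y) := by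
    rw [hYm, hYm]
    simp only [mem_sdiff] at heU
    tauto
  have := h3 Y (by
    by_contra h
    rw [not_nonempty_iff_eq_empty] at h
    rw [h] at hflip'; simp at hflip') (by
    intro h
    rw [h] at hflip'; simp at hflip')
  omega

/-- The two cut edges of a 4-cut have different ends. -/
lemma inn_inj (h4 : G.C4) (hG : G.Cubic) {A : Finset V} (hA : 4 ≤ A.card) (hAc : 1 ≤ Aᶜ.card)
    (hd : G.d A ≤ 4) : Set.InjOn (G.inn A) (G.cut A) := by
  intro e he f hf hef
  by_contra hne
  have he : e ∈ G.cut A := he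
  have hf : f ∈ G.cut A := hf
  set v := G.inn A e with hv
  have hvA : v ∈ A := inn_mem he
  have hsub : G.cut (A \ {v}) ⊆ (G.cut A ∪ G.cut {v}) \ {e, f} := by
    intro g hg
    have e1 := mem_star_inn he
    have e2 := mem_star_inn hf
    rw [← hv] at e1
    rw [← hef] at e2
    simp only [mem_sdiff, mem_union, mem_insert, mem_singleton, mem_cut] at *
    constructor
    · grind
    · rintro (rfl | rfl) <;> grind
  have h1 := card_le_card hsub
  have h2 : ({e, f} : Finset E) ⊆ G.cut A ∪ G.cut {v} := by
    intro g; simp only [mem_insert, mem_singleton, mem_union]; rintro (rfl | rfl) <;> tauto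
  rw [card_sdiff_of_subset h2, card_pair hne] at h1
  have h3 : ({e, f} : Finset E) ⊆ G.cut A ∩ G.cut {v} := by
    intro g; simp only [mem_insert, mem_singleton, mem_inter]
    have e1 := mem_star_inn he
    have e2 := mem_star_inn hf
    rw [← hv] at e1
    rw [← hef] at e2
    rintro (rfl | rfl)
    exacts [⟨he, e1⟩, ⟨hf, e2⟩]
  have h5 := card_le_card h3
  rw [card_pair hne] at h5
  have h6 := card_union_add_card_inter (G.cut A) (G.cut {v})
  have h7 := hG v
  have h8 : (A \ {v}).card = A.card - 1 := by
    rw [card_sdiff_of_subset (by simpa using hvA)]; simp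
  have h9 : (A \ {v})ᶜ.card = Aᶜ.card + 1 := by
    rw [card_compl, card_compl, h8]
    have := card_le_univ A
    omega
  simp only [d] at hd h7
  have h10 := h4 (A \ {v}) (by rw [← card_pos]; omega) (by
    intro h; rw [h] at h9; simp at h9)
  have h11 : G.d (A \ {v}) ≤ 3 := by rw [d]; omega
  rcases h10.2 (by omega) with h | h <;> omega

lemma C4.inner (h4 : G.C4) (hG : G.Cubic) {X : Finset V} (hX : 2 ≤ Xᶜ.card) :
    ∀ C ⊆ X, G.d C = 3 → C.card % 2 = 1 → C.card = 1 := by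
  intro C hC hd hodd
  have h1 : Xᶜ ⊆ Cᶜ := compl_subset_compl.mpr hC
  have h2 := card_le_card h1
  rcases (h4 C (by rw [← card_pos]; omega) (by
    rintro rfl; rw [card_univ] at hodd; have := hG.even; omega)).2 hd with h | h
  · exact h
  · omega

/-- Cut edges not extending to a matching of the side force a bipartition in which
their ends have the same colour. -/
lemma bip_of_not_part (hG : G.Cubic) (h4 : G.C4) {A : Finset V} {Z : Finset E}
    (hZ : Z ⊆ G.cut A) (hinjZ : Set.InjOn (G.inn A) Z) (hd : G.d A + Z.card = 6)
    (hpar : A.card % 2 = Z.card % 2) (hAc : 2 ≤ Aᶜ.card + Z.card) :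
    1 ≤ G.N A ∅ Z ∨ ∃ P, G.BipOn A P ∧ ∀ z ∈ Z, G.inn A z ∈ P := by
  have h1 := card_peel hZ hinjZ
  have h5 := d_peel_le hG hZ
  have hpc : 2 ≤ (G.peel A Z)ᶜ.card := by
    rw [card_compl] at hAc ⊢
    have := card_le_univ A
    omega
  rcases tutte_bip hG (EC3.of_C4 h4) (G.peel A Z) ∅ (by omega) (by simp; omega)
    (h4.inner hG hpc) with ⟨F, hF, -⟩ | ⟨h6, U, hU, -, -, hU2, hU3⟩
  · exact Or.inl (N_pos (isPart_of_peel hZ hinjZ hF))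
  right
  simp only [card_empty, mul_zero, add_zero] at h6
  refine ⟨U ∪ Z.image (G.inn A), ?_, fun z hz => mem_union_right _ (mem_image_of_mem _ hz)⟩
  have hadj : ∀ e, ∀ z ∈ Z, ∀ z' ∈ Z, e ∈ G.cut {G.inn A z} → e ∈ G.cut {G.inn A z'} →
      z = z' := by
    intro e z hz z' hz' he1 he2
    by_contra hne
    have hvne : G.inn A z ≠ G.inn A z' := fun h => hne (hinjZ hz hz' h)
    have hk : e ∉ G.cut A := by
      intro hc
      exact hvne ((inn_eq_of_mem hc (inn_mem (hZ hz)) he1).symm.trans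
        (inn_eq_of_mem hc (inn_mem (hZ hz')) he2))
    have he3 : e ∉ G.cut (G.peel A Z) := by
      intro hc
      have q1 : G.inn A z ∉ G.peel A Z := by
        simp only [peel, mem_sdiff, not_and, not_not]; exact fun _ => mem_image_of_mem _ hz
      have q2 : G.inn A z' ∉ G.peel A Z := by
        simp only [peel, mem_sdiff, not_and, not_not]; exact fun _ => mem_image_of_mem _ hz'
      rw [mem_star] at he1 he2
      rw [mem_cut] at hc
      grind
    have h7 : G.cut (G.peel A Z) ⊆ (G.cut A \ Z) ∪
        ((Z.biUnion fun f => (G.cut {G.inn A f}).erase f).erase e) := by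
      intro f hf
      have hfe : f ≠ e := by rintro rfl; exact he3 hf
      rcases mem_union.mp (cut_peel_subset hZ hf) with h | h
      · exact mem_union_left _ h
      · exact mem_union_right _ (mem_erase.mpr ⟨hfe, h⟩)
    have h8 := card_le_card h7
    have h9 := card_union_le (G.cut A \ Z)
      ((Z.biUnion fun f => (G.cut {G.inn A f}).erase f).erase e)
    have hez : ∀ y ∈ Z, e ≠ y := by rintro y hy rfl; exact hk (hZ hy)
    have h10 : (Z.biUnion fun f => (G.cut {G.inn A f}).erase f).card ≤ Z.card * 2 := by
      refine card_biUnion_le_card_mul _ _ _ fun e he => ?_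
      rw [card_erase_of_mem (mem_star_inn (hZ he))]
      have := hG (G.inn A e); rw [d] at this; omega
    have hmem : e ∈ Z.biUnion fun f => (G.cut {G.inn A f}).erase f :=
      mem_biUnion.mpr ⟨z, hz, mem_erase.mpr ⟨hez z hz, he1⟩⟩
    have hers := card_erase_of_mem hmem
    have hsd := card_sdiff_of_subset hZ
    have h11 := card_le_card hZ
    have h12 : 1 ≤ Z.card := card_pos.mpr ⟨z, hz⟩
    simp only [d] at *
    omega
  intro e ha hb hl
  have hi : e ∈ G.ins (G.peel A Z) → ¬(G.a e ∈ U ↔ G.b e ∈ U) := fun h => hU2 e h (by simp)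
  have hc := hU3 e
  have hpm : ∀ x, x ∈ G.peel A Z ↔ x ∈ A ∧ x ∉ Z.image (G.inn A) := by
    intro x; rw [peel, mem_sdiff]
  have hNN : ¬ (G.a e ∈ Z.image (G.inn A) ∧ G.b e ∈ Z.image (G.inn A)) := by
    rintro ⟨h, h'⟩
    obtain ⟨z, hz, hza⟩ := mem_image.mp h
    obtain ⟨z', hz', hzb⟩ := mem_image.mp h'
    have := hadj e z hz z' hz' (by rw [mem_star, hza]; simpa using fun h => hl h.symm)
      (by rw [mem_star, hzb]; simpa using hl)
    subst this
    exact hl (hza.symm.trans hzb)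
  have ua : G.a e ∈ U → G.a e ∈ G.peel A Z := @hU (G.a e)
  have ub : G.b e ∈ U → G.b e ∈ G.peel A Z := @hU (G.b e)
  rw [hpm] at ua ub
  rw [mem_ins, hpm, hpm] at hi
  rw [mem_cut, hpm, hpm] at hc
  rw [mem_union, mem_union]
  by_cases a1 : G.a e ∈ U <;> by_cases a2 : G.b e ∈ U <;>
    by_cases a3 : G.a e ∈ Z.image (G.inn A) <;> by_cases a4 : G.b e ∈ Z.image (G.inn A) <;>
    simp_all

/-- A pair of cut edges not extending to a matching of the side forces a bipartition in which
their ends have the same colour. -/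
lemma bip_of_pair (hG : G.Cubic) (h4 : G.C4) {A : Finset V} (hd : G.d A = 4) (hA : 4 ≤ A.card)
    (hAc : 1 ≤ Aᶜ.card) {g g' : E} (hg : g ∈ G.cut A) (hg' : g' ∈ G.cut A) (hne : g ≠ g') :
    1 ≤ G.N A ∅ {g, g'} ∨ ∃ P, G.BipOn A P ∧ (G.inn A g ∈ P) ∧ G.inn A g' ∈ P := by
  have hZ : {g, g'} ⊆ G.cut A := by
    intro z; simp only [mem_insert, mem_singleton]; rintro (rfl | rfl) <;> assumption
  have hinjZ : Set.InjOn (G.inn A) (({g, g'} : Finset E) : Set E) :=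
    (inn_inj h4 hG hA hAc hd.le).mono (by exact_mod_cast hZ)
  have hpar := hG.parity A
  have hc := card_pair hne
  rcases bip_of_not_part hG h4 hZ hinjZ (by omega) (by omega) (by omega) with h | ⟨P, h1, h2⟩
  · exact Or.inl h
  · exact Or.inr ⟨P, h1, h2 g (by simp), h2 g' (by simp)⟩

/-- The edges leaving the complement of a vertex have different ends. -/
lemma inn_inj_three (h3 : G.EC3) (hG : G.Cubic) {A : Finset V} (hA : 2 ≤ A.card)
    (hd : G.d A ≤ 3) : Set.InjOn (G.inn A) (G.cut A) := by
  intro e he f hf hef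
  by_contra hne
  have he : e ∈ G.cut A := he
  have hf : f ∈ G.cut A := hf
  have hZ : {e} ⊆ G.cut A := by simpa using he
  have h1 := cut_peel_subset hZ
  have h2 : G.cut (G.peel A {e}) ⊆ ((G.cut A \ {e}).erase f) ∪ (((G.cut {G.inn A e}).erase e).erase f) := by
    intro g hg
    have h3 := h1 hg
    have hgf : g ≠ f := by
      rintro rfl
      have q1 : G.inn A e ∉ G.peel A {e} := by simp [peel]
      have q2 : ∀ x ∈ G.peel A {e}, x ∈ A := fun x hx => (mem_sdiff.mp hx).1
      have q3 := q2 (G.a g)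
      have q4 := q2 (G.b g)
      have q5 := mem_star_inn hf
      have q6 := inn_mem hf
      rw [hef] at q1
      rw [mem_cut] at hg hf
      rw [mem_star] at q5
      generalize G.inn A g = p at *
      clear h1 h3 hef he hd hA hne
      grind
    simpa [hgf] using h3
  have h5 := card_le_card h2
  have h6 := card_union_le ((G.cut A \ {e}).erase f) (((G.cut {G.inn A e}).erase e).erase f)
  have h7 : f ∈ G.cut {G.inn A e} := hef ▸ mem_star_inn hf
  rw [card_erase_of_mem (by simp [hf, Ne.symm hne]), card_erase_of_mem (by simp [h7, Ne.symm hne]),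
    card_erase_of_mem (mem_star_inn he), card_sdiff_of_subset hZ, card_singleton] at h6
  have h8 := hG (G.inn A e)
  have h9 := card_peel hZ (by simp)
  rw [card_singleton] at h9
  have h10 := h3 (G.peel A {e}) (by rw [← card_pos]; omega) (by
    intro h
    have : G.inn A e ∈ G.peel A {e} := by rw [h]; simp
    simp [peel] at this)
  simp only [d] at *
  omega

/-- Bipartitions of a vertex set with at most five leaving edges are unique up to swapping. -/
lemma bip_unique (h3 : G.EC3) {A P Q : Finset V} (hd : G.d A < 6) (hA : A ≠ univ)
    (hP : G.BipOn A P) (hQ : G.BipOn A Q) :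
    (∀ x ∈ A, x ∈ P ↔ x ∈ Q) ∨ (∀ x ∈ A, ¬ (x ∈ P ↔ x ∈ Q)) := by
  by_contra hcon
  push Not at hcon
  obtain ⟨⟨x, hx, hx'⟩, y, hy, hy'⟩ := hcon
  set Y := A.filter fun x => (x ∈ P ↔ x ∈ Q) with hY
  set Z := A.filter fun x => ¬ (x ∈ P ↔ x ∈ Q) with hZ
  have h1 : G.d Y + G.d Z ≤ G.d A := by
    simp only [d_eq_sum, ← sum_add_distrib]
    refine sum_le_sum fun e _ => ?_
    have p := hP e; have q := hQ e
    simp only [hY, hZ, mem_filter]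
    by_cases hl : G.a e = G.b e
    · simp [hl]
    by_cases a1 : G.a e ∈ A <;> by_cases a2 : G.b e ∈ A <;> by_cases a3 : G.a e ∈ P <;>
      by_cases a4 : G.b e ∈ P <;> by_cases a5 : G.a e ∈ Q <;> by_cases a6 : G.b e ∈ Q <;>
      simp_all
  have hYu : Y ≠ univ := fun h => hA (eq_univ_iff_forall.mpr fun v => by
    have := mem_univ v; rw [← h, hY, mem_filter] at this; exact this.1)
  have hZu : Z ≠ univ := fun h => hA (eq_univ_iff_forall.mpr fun v => by
    have := mem_univ v; rw [← h, hZ, mem_filter] at this; exact this.1)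
  have h4 := h3 Y ⟨y, by simp [hY, hy, hy']⟩ hYu
  have h5 := h3 Z ⟨x, by simp only [hZ, mem_filter]; exact ⟨hx, by tauto⟩⟩ hZu
  omega

lemma BipOn.compl {X P : Finset V} (h : G.BipOn X P) : G.BipOn X Pᶜ := by
  intro e h1 h2 h3
  have := h e h1 h2 h3
  simp only [mem_compl]; tauto

/-- A factor of degree three at a prescribed vertex. -/
lemma exists_three_factor (hG : G.Cubic) (h4 : G.C4) (hn : 4 ≤ Fintype.card V)
    (hb : ¬ G.Bip univ) (v : V) : ∃ F, G.IsPart univ {v} ∅ F ∧ (F ∩ G.cut {v}).card = 3 := by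
  have hc : ({v}ᶜ : Finset V).card + 1 = Fintype.card V := by
    rw [card_compl, card_singleton]; omega
  have hd : G.d ({v}ᶜ : Finset V) = 3 := by rw [d_compl]; exact hG v
  have hinj := inn_inj_three (EC3.of_C4 h4) hG (A := {v}ᶜ) (by omega) hd.le
  have hpar := hG.parity ({v}ᶜ : Finset V)
  have hd' : (G.cut ({v}ᶜ : Finset V)).card = 3 := hd
  rcases bip_of_not_part hG h4 (A := {v}ᶜ) (subset_refl _) hinj (by omega) (by omega) (by omega)
    with h | ⟨P, hP, hPZ⟩
  · obtain ⟨F, hF⟩ := card_pos.mp h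
    obtain ⟨h1, h2, h3⟩ := mem_part.mp hF
    rw [cut_compl] at h2
    have h5 : (F ∩ G.cut {v}).card = 3 := by rw [h2]; exact hG v
    refine ⟨F, isPart_univ.mpr ⟨fun e he => ?_, fun u => ?_⟩, h5⟩
    · rcases mem_union.mp (h1 he) with h | h
      · exact link_of_mem_cut h
      · exact (mem_ins.mp h).2.2
    · by_cases hu : u = v
      · subst hu; right; exact ⟨by simp, h5⟩
      · rcases h3 u (by simpa using hu) with h | h
        · exact Or.inl h
        · simp at h
  · exfalso
    refine hb ⟨P \ {v}, fun e _ _ hl => ?_⟩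
    have hp := hP e
    by_cases ha : G.a e = v
    · have he : e ∈ G.cut ({v}ᶜ : Finset V) := by
        rw [cut_compl, mem_star]; grind
      have h6 := hPZ e he
      have : G.inn {v}ᶜ e = G.b e := by unfold inn; simp [ha]
      rw [this] at h6
      simp only [mem_sdiff, mem_singleton]
      grind
    by_cases hb' : G.b e = v
    · have he : e ∈ G.cut ({v}ᶜ : Finset V) := by
        rw [cut_compl, mem_star]; grind
      have h6 := hPZ e he
      have : G.inn {v}ᶜ e = G.a e := by unfold inn; simp [ha]
      rw [this] at h6
      simp only [mem_sdiff, mem_singleton]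
      grind
    · have := hp (by simpa using ha) (by simpa using hb') hl
      simp only [mem_sdiff, mem_singleton]; tauto

lemma count_add_card_le (hG : G.Cubic) (h4 : G.C4) (hn : 4 ≤ Fintype.card V)
    (hb : ¬ G.Bip univ) {S T : Finset V} (hST : Disjoint S T) :
    G.count S + T.card ≤ G.count (S ∪ T) := by
  choose f hf hf3 using exists_three_factor hG h4 hn hb
  have h1 : ∀ v u, (f v ∩ G.cut {u}).card = 3 → u = v := by
    intro v u h
    rcases (isPart_univ.mp (hf v)).2 u with h' | h'
    · omega
    · simpa using h'.1
  have hinj : Set.InjOn f T := by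
    intro v _ u _ h
    refine (h1 v u ?_).symm
    rw [h]; exact hf3 u
  have hdisj : Disjoint (G.part univ S ∅) (T.image f) := by
    rw [disjoint_left]
    intro F hF hF'
    obtain ⟨v, hv, rfl⟩ := mem_image.mp hF'
    rcases (mem_part.mp hF).2.2 v (mem_univ v) with h | h
    · have := hf3 v; omega
    · exact disjoint_left.mp hST h.1 hv
  rw [count, N, ← card_image_of_injOn hinj, ← card_union_of_disjoint hdisj, count, N]
  refine card_le_card (union_subset (part_mono subset_union_left) ?_)
  intro F hF
  obtain ⟨v, hv, rfl⟩ := mem_image.mp hF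
  exact part_mono (by simp [hv]) (mem_part.mpr (hf v))

variable (G) in
/-- The end of `e` other than `v`. -/
def oth (v : V) (e : E) : V := if G.a e = v then G.b e else G.a e

/-- A matching assembled from a choice of one edge at every vertex of one colour class. -/
lemma isPart_of_choice {X P : Finset V} (hPX : P ⊆ X) (c : V → E)
    (h1 : ∀ v ∈ P, c v ∈ G.cut {v} ∧ G.oth v (c v) ∈ X \ P)
    (hinj : Set.InjOn (fun v => G.oth v (c v)) P) (hcard : 2 * P.card = X.card) :
    G.IsPart X ∅ ∅ (P.image c) := by
  have hends : ∀ v ∈ P, ∀ x, c v ∈ G.cut {x} ↔ x = v ∨ x = G.oth v (c v) := by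
    intro v hv x
    have := (h1 v hv).1
    rw [mem_star] at *
    unfold oth; split_ifs <;> grind
  have hins : ∀ v ∈ P, c v ∈ G.ins X := by
    intro v hv
    have h2 := h1 v hv
    have h3 := hPX hv
    have h4 := (mem_sdiff.mp h2.2).1
    rw [mem_ins]
    have h5 := link_of_mem_cut h2.1
    have h6 := mem_star.mp h2.1
    unfold oth at h4; split_ifs at h4 <;> grind
  have hsurj : ∀ x ∈ X \ P, ∃ v ∈ P, G.oth v (c v) = x := by
    have h2 : P.image (fun v => G.oth v (c v)) = X \ P := by
      refine eq_of_subset_of_card_le ?_ ?_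
      · intro x hx; obtain ⟨v, hv, rfl⟩ := mem_image.mp hx; exact (h1 v hv).2
      · rw [card_image_of_injOn hinj, card_sdiff_of_subset hPX]; omega
    intro x hx
    rw [← h2] at hx
    exact mem_image.mp hx
  refine ⟨?_, ?_, ?_⟩
  · intro e he
    obtain ⟨v, hv, rfl⟩ := mem_image.mp he
    exact mem_union_right _ (hins v hv)
  · rw [eq_empty_iff_forall_notMem]
    intro e he
    obtain ⟨h2, h3⟩ := mem_inter.mp he
    obtain ⟨v, hv, rfl⟩ := mem_image.mp h2
    have := mem_ins.mp (hins v hv)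
    rw [mem_cut] at h3; tauto
  · intro x hx
    left
    rw [card_eq_one]
    by_cases hxP : x ∈ P
    · refine ⟨c x, ?_⟩
      ext e
      simp only [mem_inter, mem_image, mem_singleton]
      constructor
      · rintro ⟨⟨v, hv, rfl⟩, h⟩
        rcases (hends v hv x).mp h with rfl | h
        · rfl
        · have := (h1 v hv).2
          rw [← h] at this; simp [hxP] at this
      · rintro rfl; exact ⟨⟨x, hxP, rfl⟩, (h1 x hxP).1⟩
    · obtain ⟨u, hu, hux⟩ := hsurj x (by simp [hx, hxP])
      refine ⟨c u, ?_⟩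
      ext e
      simp only [mem_inter, mem_image, mem_singleton]
      constructor
      · rintro ⟨⟨v, hv, rfl⟩, h⟩
        rcases (hends v hv x).mp h with rfl | h
        · exact absurd hv hxP
        · rw [hinj hu hv (hux.trans h)]
      · rintro rfl; exact ⟨⟨u, hu, rfl⟩, (hends u hu x).mpr (Or.inr hux.symm)⟩

/-- Degree count for one colour class. -/
lemma BipOn.class_card (hG : G.Cubic) {A P : Finset V} (hP : G.BipOn A P) :
    3 * (A ∩ P).card = (G.ins A).card + ((G.cut A).filter fun e => G.inn A e ∈ P).card := by
  have h1 := hG.sum (A ∩ P)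
  have h2 : G.ins (A ∩ P) = ∅ := by
    rw [eq_empty_iff_forall_notMem]
    intro e he
    rw [mem_ins] at he
    simp only [mem_inter] at he
    have := hP e he.1.1 he.2.1.1 he.2.2
    tauto
  have h3 : G.cut (A ∩ P) = G.ins A ∪ (G.cut A).filter fun e => G.inn A e ∈ P := by
    ext e
    have := hP e
    rw [mem_union, mem_filter, mem_ins, mem_cut, mem_cut, mem_inter, mem_inter, inn]
    by_cases a1 : G.a e ∈ A <;> by_cases a2 : G.b e ∈ A <;> simp [a1, a2] at this ⊢ <;> grind
  have h4 : Disjoint (G.ins A) ((G.cut A).filter fun e => G.inn A e ∈ P) := by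
    rw [disjoint_left]
    intro e he he'
    have := (mem_filter.mp he').1
    rw [mem_ins] at he; rw [mem_cut] at this; tauto
  rw [d, h3, card_union_of_disjoint h4, h2] at h1
  simpa using h1

lemma BipOn.balanced (hG : G.Cubic) {A P : Finset V} (hP : G.BipOn A P) (hd : G.d A = 4) :
    ((G.cut A).filter fun e => G.inn A e ∈ P).card = 2 ∧
      ((G.cut A).filter fun e => G.inn A e ∉ P).card = 2 ∧
      2 * (A ∩ P).card = A.card := by
  have h1 := hP.class_card hG
  have h2 := hP.compl.class_card hG
  have h3 := card_filter_add_card_filter_not (s := G.cut A) fun e => G.inn A e ∈ P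
  simp only [mem_compl] at h2
  have h4 : (A ∩ P).card + (A ∩ Pᶜ).card = A.card := by
    rw [← sdiff_eq_inter_compl]; exact card_inter_add_card_sdiff A P
  simp only [d] at hd
  omega

/-- In a bipartite side of a 4-edge cut, the whole cut extends to a matching of the side. -/
lemma one_le_N_cut (hG : G.Cubic) (h4 : G.C4) {A P : Finset V} (hd : G.d A = 4)
    (hA : 4 ≤ A.card) (hAc : 1 ≤ Aᶜ.card) (hP : G.BipOn A P) : 1 ≤ G.N A ∅ (G.cut A) := by
  have hinj := inn_inj h4 hG hA hAc hd.le
  obtain ⟨hb1, hb2, hb3⟩ := hP.balanced hG hd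
  set X := G.peel A (G.cut A) with hX
  have hXc := card_peel (subset_refl (G.cut A)) hinj
  rw [← hX] at hXc
  have hXm : ∀ x, x ∈ X ↔ x ∈ A ∧ ∀ z ∈ G.cut A, G.inn A z ≠ x := by
    intro x; rw [hX, peel, mem_sdiff, mem_image]; push Not; rfl
  set RP := ((G.cut A).filter fun e => G.inn A e ∈ P).image (G.inn A) with hRP
  set RQ := ((G.cut A).filter fun e => G.inn A e ∉ P).image (G.inn A) with hRQ
  have hRPc : RP.card = 2 := by
    rw [hRP, card_image_of_injOn (hinj.mono (by exact_mod_cast filter_subset _ _)), hb1]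
  have hRQc : RQ.card = 2 := by
    rw [hRQ, card_image_of_injOn (hinj.mono (by exact_mod_cast filter_subset _ _)), hb2]
  have hRPm : ∀ x ∈ RP, x ∈ A ∧ x ∈ P ∧ x ∉ X := by
    intro x hx
    obtain ⟨e, he, rfl⟩ := mem_image.mp hx
    rw [mem_filter] at he
    exact ⟨inn_mem he.1, he.2, fun h => ((hXm _).mp h).2 e he.1 rfl⟩
  have hRQm : ∀ x ∈ RQ, x ∈ A ∧ x ∉ P ∧ x ∉ X := by
    intro x hx
    obtain ⟨e, he, rfl⟩ := mem_image.mp hx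
    rw [mem_filter] at he
    exact ⟨inn_mem he.1, he.2, fun h => ((hXm _).mp h).2 e he.1 rfl⟩
  have hXR : ∀ x ∈ A, x ∉ X → x ∉ P → x ∈ RQ := by
    intro x hx hxX hxP
    rw [hXm] at hxX; push Not at hxX
    obtain ⟨z, hz, rfl⟩ := hxX hx
    exact mem_image_of_mem _ (mem_filter.mpr ⟨hz, hxP⟩)
  have hXP : (X ∩ P).card + 2 = (A ∩ P).card := by
    have : A ∩ P = (X ∩ P) ∪ RP := by
      ext x
      simp only [mem_inter, mem_union]
      constructor
      · rintro ⟨h, h'⟩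
        by_cases hxX : x ∈ X
        · exact Or.inl ⟨hxX, h'⟩
        · rw [hXm] at hxX; push Not at hxX
          obtain ⟨z, hz, rfl⟩ := hxX h
          exact Or.inr (mem_image_of_mem _ (mem_filter.mpr ⟨hz, h'⟩))
      · rintro (h | h)
        · exact ⟨((hXm x).mp h.1).1, h.2⟩
        · exact ⟨(hRPm x h).1, (hRPm x h).2.1⟩
    rw [this, card_union_of_disjoint, hRPc]
    rw [disjoint_left]; intro x hx hx'
    exact (hRPm x hx').2.2 (mem_inter.mp hx).1
  set t : (X ∩ P : Finset V) → Finset V := fun v =>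
    (X \ P).filter fun y => ∃ e ∈ G.cut {v.1}, G.oth v.1 e = y with ht
  have hother : ∀ v ∈ X ∩ P, ∀ e ∈ G.cut {v}, G.oth v e ∈ A ∧ G.oth v e ∉ P := by
    intro v hv e he
    obtain ⟨hvX, hvP⟩ := mem_inter.mp hv
    have hvA := ((hXm v).mp hvX).1
    have hl := link_of_mem_cut he
    have hc : e ∉ G.cut A := fun hc => ((hXm v).mp hvX).2 e hc (inn_eq_of_mem hc hvA he)
    have hp := hP e
    rw [mem_cut] at hc; rw [mem_star] at he
    unfold oth; split_ifs <;> grind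
  by_cases hall : ∀ s : Finset (X ∩ P : Finset V), s.card ≤ (s.biUnion t).card
  · obtain ⟨f, hf, hft⟩ := (all_card_le_biUnion_card_iff_exists_injective t).mp hall
    have hft' : ∀ v, f v ∈ X \ P ∧ ∃ e ∈ G.cut {v.1}, G.oth v.1 e = f v := fun v =>
      mem_filter.mp (hft v)
    choose hf1 c hc1 hc2 using hft'
    obtain ⟨e0, -⟩ : (G.cut A).Nonempty := by rw [← card_pos]; rw [d] at hd; omega
    set c' : V → E := fun v => if h : v ∈ X ∩ P then c ⟨v, h⟩ else e0 with hc'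
    have hcc : ∀ v (h : v ∈ X ∩ P), c' v = c ⟨v, h⟩ := fun v h => by simp only [hc', h, dif_pos]
    have hpart := isPart_of_choice (G := G) (X := X) (P := X ∩ P) inter_subset_left c' (by
      intro v hv
      rw [hcc v hv]
      refine ⟨hc1 _, ?_⟩
      have := hf1 ⟨v, hv⟩
      rw [← hc2 ⟨v, hv⟩] at this
      simp only [mem_sdiff, mem_inter] at *; tauto) (by
      intro v hv u hu h
      have hv : v ∈ X ∩ P := hv
      have hu : u ∈ X ∩ P := hu
      simp only [hcc v hv, hcc u hu] at h
      have h5 := hc2 ⟨v, hv⟩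
      have h6 := hc2 ⟨u, hu⟩
      have := hf (h5.symm.trans (h.trans h6))
      simpa using this) (by rw [d] at hd; omega)
    exact N_pos (isPart_of_peel (subset_refl _) hinj hpart)
  · exfalso
    push Not at hall
    obtain ⟨s, hs⟩ := hall
    set I := s.map ⟨Subtype.val, Subtype.val_injective⟩ with hI
    have hIc : I.card = s.card := card_map _
    have hIm : ∀ x ∈ I, ∃ h : x ∈ X ∩ P, (⟨x, h⟩ : (X ∩ P : Finset V)) ∈ s := by
      intro x hx
      obtain ⟨y, hy, rfl⟩ := mem_map.mp hx
      exact ⟨y.2, hy⟩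
    set Y := s.biUnion t with hY
    have hYm : ∀ y ∈ Y, y ∈ X ∧ y ∉ P := by
      intro y hy
      obtain ⟨v, -, hv⟩ := mem_biUnion.mp hy
      exact mem_sdiff.mp (mem_filter.mp hv).1
    set W := I ∪ Y ∪ RQ with hW
    have hWc : W.card ≤ I.card + Y.card + 2 := by
      have h1 := card_union_le (I ∪ Y) RQ
      have h2 := card_union_le I Y
      rw [← hW] at h1
      omega
    have hWge : I.card + 2 ≤ W.card := by
      rw [← hRQc, ← card_union_of_disjoint]
      · exact card_le_card (union_subset_union_left subset_union_left)
      · rw [disjoint_left]; intro x hx hx'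
        obtain ⟨h, -⟩ := hIm x hx
        exact (hRQm x hx').2.1 (mem_inter.mp h).2
    have hWu : RP ⊆ Wᶜ := by
      intro x hx
      have h1 := hRPm x hx
      simp only [mem_compl, hW, mem_union, not_or]
      refine ⟨⟨fun h => ?_, fun h => (hYm x h).2 h1.2.1⟩, fun h => (hRQm x h).2.1 h1.2.1⟩
      obtain ⟨h, -⟩ := hIm x h
      exact h1.2.2 (mem_inter.mp h).1
    have hWu' := card_le_card hWu
    have hIP : ∀ x ∈ I, x ∈ A ∧ x ∈ P := by
      intro x hx
      obtain ⟨h, -⟩ := hIm x hx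
      exact ⟨((hXm x).mp (mem_inter.mp h).1).1, (mem_inter.mp h).2⟩
    have hI0 : G.ins I = ∅ := by
      rw [eq_empty_iff_forall_notMem]
      intro e he
      rw [mem_ins] at he
      have h1 := hIP _ he.1; have h2 := hIP _ he.2.1
      have := hP e h1.1 h2.1 he.2.2
      tauto
    have hIW : G.cut I ⊆ G.ins W := by
      intro e he
      have hl := link_of_mem_cut he
      have key : ∀ v ∈ I, e ∈ G.cut {v} → G.oth v e ∈ W := by
        intro v hv hev
        obtain ⟨h, h'⟩ := hIm v hv
        have h1 := hother v h e hev
        by_cases hx : G.oth v e ∈ X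
        · refine mem_union_left _ (mem_union_right _ (mem_biUnion.mpr ⟨_, h', ?_⟩))
          exact mem_filter.mpr ⟨mem_sdiff.mpr ⟨hx, h1.2⟩, e, hev, rfl⟩
        · exact mem_union_right _ (hXR _ h1.1 hx h1.2)
      have hIsub : ∀ v ∈ I, v ∈ W := fun v hv => mem_union_left _ (mem_union_left _ hv)
      rw [mem_cut] at he
      rw [mem_ins]
      have k1 := key (G.a e); have k2 := key (G.b e)
      have k3 := hIsub (G.a e); have k4 := hIsub (G.b e)
      simp only [mem_star, oth] at k1 k2
      by_cases h1 : G.a e ∈ I <;> by_cases h2 : G.b e ∈ I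
      · exact absurd (iff_of_true h1 h2) he
      · rw [if_pos trivial] at k1
        exact ⟨k3 h1, k1 h1 (by simpa using hl.symm), hl⟩
      · rw [if_neg hl] at k2
        exact ⟨k2 h2 (by simpa using hl), k4 h2, hl⟩
      · exact absurd (iff_of_false h1 h2) he
    have h1 := hG.sum I
    have h2 := hG.sum W
    rw [hI0, card_empty] at h1
    have h3 := card_le_card hIW
    have h5 := h4 W (by rw [← card_pos]; omega) (by
      intro h; rw [h, compl_univ, card_empty] at hWu'; omega)
    obtain ⟨h5, h6⟩ := h5
    have h7 : G.d I = (G.cut I).card := rfl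
    rcases h6 (by omega) with h | h
    · omega
    · rw [h, hRPc] at hWu'
      omega

/-- The vertices of `A` together with one point for its complement. -/
inductive Con (A : Finset V) : Type
  | inn (x : V) (h : x ∈ A)
  | pt

/-- The contraction map. -/
def prj (A : Finset V) (x : V) : Con A := if h : x ∈ A then .inn x h else .pt

def Con.equiv (A : Finset V) : Option A ≃ Con A where
  toFun := fun o => match o with
    | some x => .inn x.1 x.2
    | none => .pt
  invFun := fun c => match c with
    | .inn x h => some ⟨x, h⟩
    | .pt => none
  left_inv := by rintro (_ | ⟨x, h⟩) <;> rfl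
  right_inv := by rintro (⟨x, h⟩ | _) <;> rfl

instance (A : Finset V) : Fintype (Con A) := Fintype.ofEquiv _ (Con.equiv A)

lemma card_con (A : Finset V) : Fintype.card (Con A) = A.card + 1 := by
  rw [← Fintype.card_congr (Con.equiv A), Fintype.card_option, Fintype.card_coe]

lemma prj_eq_pt {A : Finset V} {x : V} : prj A x = .pt ↔ x ∉ A := by
  unfold prj; split_ifs with h <;> simp [h]

lemma prj_eq_inn {A : Finset V} {x y : V} {h : y ∈ A} : prj A x = .inn y h ↔ x = y := by
  unfold prj; split_ifs with h'
  · simp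
  · simp only [false_iff]; rintro rfl; exact h' h

lemma prj_mem {A : Finset V} {x : V} (h : x ∈ A) : prj A x = .inn x h := prj_eq_inn.mpr rfl

lemma prj_inj {A : Finset V} {x y : V} : prj A x = prj A y ↔ x = y ∨ (x ∉ A ∧ y ∉ A) := by
  unfold prj; split_ifs with h h' <;> simp <;> grind

variable (G) in
/-- The graph in which the complement of `A` is contracted to a point. -/
def con (A : Finset V) : Gr (Con A) E := ⟨fun e => prj A (G.a e), fun e => prj A (G.b e)⟩

/-- Preimage of a vertex set of the contraction. -/
def pre {A : Finset V} (Y : Finset (Con A)) : Finset V := univ.filter fun x => prj A x ∈ Y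

lemma mem_pre {A : Finset V} {Y : Finset (Con A)} {x : V} : x ∈ pre Y ↔ prj A x ∈ Y := by
  simp [pre]

lemma con_cut {A : Finset V} (Y : Finset (Con A)) : (G.con A).cut Y = G.cut (pre Y) := by
  ext e; rw [mem_cut, mem_cut, mem_pre, mem_pre]; rfl

lemma con_d {A : Finset V} (Y : Finset (Con A)) : (G.con A).d Y = G.d (pre Y) := by
  rw [d, con_cut, d]

lemma pre_pt {A : Finset V} : pre ({.pt} : Finset (Con A)) = Aᶜ := by
  ext x; rw [mem_pre, mem_singleton, prj_eq_pt, mem_compl]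

lemma pre_inn {A : Finset V} {x : V} (h : x ∈ A) : pre ({.inn x h} : Finset (Con A)) = {x} := by
  ext y; rw [mem_pre, mem_singleton, prj_eq_inn, mem_singleton]

lemma con_cut_pt {A : Finset V} : (G.con A).cut {.pt} = G.cut A := by
  rw [con_cut, pre_pt, cut_compl]

lemma con_cut_inn {A : Finset V} {x : V} (h : x ∈ A) :
    (G.con A).cut {.inn x h} = G.cut {x} := by
  rw [con_cut, pre_inn]

lemma con_link {A : Finset V} {e : E} :
    (G.con A).a e ≠ (G.con A).b e ↔ e ∈ G.cut A ∪ G.ins A := by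
  change prj A _ ≠ prj A _ ↔ _
  rw [Ne, prj_inj, mem_union, mem_cut, mem_ins]; grind

lemma pre_nonempty {A : Finset V} (hA : (Aᶜ).Nonempty) {Y : Finset (Con A)}
    (hY : Y.Nonempty) : (pre Y).Nonempty := by
  obtain ⟨y, hy⟩ := hY
  obtain ⟨x, hx⟩ := hA
  cases y with
  | inn z h => exact ⟨z, by rw [mem_pre, prj_mem h]; exact hy⟩
  | pt => exact ⟨x, by rw [mem_pre, prj_eq_pt.mpr (by simpa using hx)]; exact hy⟩

lemma pre_compl {A : Finset V} (Y : Finset (Con A)) : pre Yᶜ = (pre Y)ᶜ := by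
  ext x; simp only [mem_pre, mem_compl]

lemma pre_ne_univ {A : Finset V} (hA : (Aᶜ).Nonempty) {Y : Finset (Con A)}
    (hY : Y ≠ univ) : pre Y ≠ univ := by
  have h1 : (Yᶜ).Nonempty := by
    rw [nonempty_iff_ne_empty]; intro h
    rw [compl_eq_empty_iff] at h; exact hY h
  have h2 := pre_nonempty hA h1
  rw [pre_compl] at h2
  intro h; rw [h] at h2; simp at h2

/-- A set of vertices of the contraction avoiding the contracted point. -/
lemma card_pre_of_notMem {A : Finset V} {Y : Finset (Con A)} (h : Con.pt ∉ Y) :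
    (pre Y).card = Y.card ∧ pre Y ⊆ A := by
  have hsub : pre Y ⊆ A := by
    intro x hx
    rw [mem_pre] at hx
    by_contra hxA
    rw [prj_eq_pt.mpr hxA] at hx; exact h hx
  refine ⟨?_, hsub⟩
  refine card_bij (fun x _ => prj A x) (fun x hx => mem_pre.mp hx) ?_ ?_
  · intro x hx y hy hxy
    rcases prj_inj.mp hxy with h | h
    · exact h
    · exact absurd (hsub hx) h.1
  · intro y hy
    cases y with
    | inn z hz => exact ⟨z, by rw [mem_pre, prj_mem hz]; exact hy, prj_mem hz⟩
    | pt => exact absurd hy h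

lemma card_pre_of_mem {A : Finset V} {Y : Finset (Con A)} (h : Con.pt ∈ Y) :
    (pre Y).card + 1 = Y.card + Aᶜ.card ∧ Aᶜ ⊆ pre Y := by
  have h1 := card_pre_of_notMem (Y := Yᶜ) (by simpa using h)
  rw [pre_compl, card_compl, card_compl, card_con] at h1
  have h2 := card_le_univ (pre Y)
  have h3 := card_le_univ Y
  have h4 := card_le_univ A
  rw [card_con] at h3
  have h5 := card_compl A
  have h6 := compl_subset_compl.mpr h1.2
  rw [compl_compl] at h6
  refine ⟨by omega, h6⟩

lemma con_EC3 (h : G.EC3) {A : Finset V} (hA : (Aᶜ).Nonempty) : (G.con A).EC3 := by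
  intro Y h1 h2
  rw [con_d]
  exact h _ (pre_nonempty hA h1) (pre_ne_univ hA h2)

lemma con_cubic (hG : G.Cubic) {A : Finset V} (hd : G.d A = 3) : (G.con A).Cubic := by
  intro v
  cases v with
  | inn x h => rw [con_d, pre_inn]; exact hG x
  | pt => rw [con_d, pre_pt, d_compl]; exact hd

/-- The set `S ∩ A` in the contraction, with the contracted point added if `b`. -/
def lft (A S : Finset V) (b : Prop) : Finset (Con A) :=
  univ.filter fun c => match c with
    | .inn x _ => x ∈ S
    | .pt => b

lemma mem_lft_inn {A S : Finset V} {b : Prop} {x : V} {h : x ∈ A} :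
    Con.inn x h ∈ lft A S b ↔ x ∈ S := by simp [lft]

lemma mem_lft_pt {A S : Finset V} {b : Prop} : Con.pt ∈ lft A S b ↔ b := by simp [lft]

lemma card_lft (A S : Finset V) (b : Prop) :
    (lft A S b).card = (A ∩ S).card + if b then 1 else 0 := by
  have h1 : lft A S b = (A ∩ S).image (prj A) ∪ (if b then {.pt} else ∅) := by
    ext c
    rw [mem_union, mem_image]
    cases c with
    | inn x h =>
      rw [mem_lft_inn]
      have : Con.inn x h ∉ (if b then {.pt} else ∅ : Finset (Con A)) := by split_ifs <;> simp
      simp only [this, or_false]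
      constructor
      · intro hx; exact ⟨x, mem_inter.mpr ⟨h, hx⟩, prj_mem h⟩
      · rintro ⟨y, hy, hxy⟩
        rw [prj_eq_inn.mp hxy.symm.symm] at hy; exact (mem_inter.mp hy).2
    | pt =>
      rw [mem_lft_pt]
      have h2 : ¬ ∃ x ∈ A ∩ S, prj A x = Con.pt := by
        rintro ⟨x, hx, h⟩; exact prj_eq_pt.mp h (mem_inter.mp hx).1
      simp only [h2, false_or]
      split_ifs with hb <;> simp [hb]
  rw [h1, card_union_of_disjoint, card_image_of_injOn]
  · split_ifs <;> simp
  · intro x hx y hy hxy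
    have hx : x ∈ A ∩ S := hx
    rcases prj_inj.mp hxy with h | h
    · exact h
    · exact absurd (mem_inter.mp hx).1 h.1
  · rw [disjoint_left]
    intro c hc
    obtain ⟨x, hx, rfl⟩ := mem_image.mp hc
    rw [prj_mem (mem_inter.mp hx).1]
    split_ifs <;> simp

lemma isPart_con {A S : Finset V} {b : Prop} {F : Finset E} :
    (G.con A).IsPart univ (lft A S b) ∅ F ↔
      G.IsPart A S (F ∩ G.cut A) F ∧ ((F ∩ G.cut A).card = 1 ∨ b ∧ (F ∩ G.cut A).card = 3) := by
  rw [isPart_univ]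
  constructor
  · rintro ⟨h1, h2⟩
    refine ⟨⟨fun e he => con_link.mp (h1 e he), rfl, fun v hv => ?_⟩, ?_⟩
    · have := h2 (.inn v hv)
      rwa [con_cut_inn, mem_lft_inn] at this
    · have := h2 .pt
      rwa [con_cut_pt, mem_lft_pt] at this
  · rintro ⟨⟨h1, -, h2⟩, h3⟩
    refine ⟨fun e he => con_link.mpr (h1 he), fun v => ?_⟩
    cases v with
    | inn x h => rw [con_cut_inn, mem_lft_inn]; exact h2 x h
    | pt => rw [con_cut_pt, mem_lft_pt]; exact h3

lemma count_con {A S : Finset V} {b : Prop} (hd : G.d A = 3) :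
    (G.con A).count (lft A S b) =
      ∑ g ∈ G.cut A, G.N A S {g} + if b then G.N A S (G.cut A) else 0 := by
  have h1 : (G.con A).part univ (lft A S b) ∅ =
      ((G.cut A).biUnion fun g => G.part A S {g}) ∪ if b then G.part A S (G.cut A) else ∅ := by
    ext F
    rw [mem_part, isPart_con, mem_union, mem_biUnion]
    constructor
    · rintro ⟨h1, h2 | ⟨hb, h2⟩⟩
      · obtain ⟨g, hg⟩ := card_eq_one.mp h2
        left
        rw [hg] at h1
        refine ⟨g, ?_, mem_part.mpr h1⟩
        have : g ∈ F ∩ G.cut A := by rw [hg]; simp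
        exact (mem_inter.mp this).2
      · right
        rw [if_pos hb, mem_part]
        have : F ∩ G.cut A = G.cut A :=
          eq_of_subset_of_card_le inter_subset_right (by rw [d] at hd; omega)
        rwa [this] at h1
    · rintro (⟨g, hg, h⟩ | h)
      · rw [mem_part] at h
        have h2 := h.2.1
        rw [h2]; exact ⟨h, Or.inl (by simp)⟩
      · split_ifs at h with hb
        · rw [mem_part] at h
          have h2 := h.2.1
          rw [h2]; exact ⟨h, Or.inr ⟨hb, hd⟩⟩
        · simp at h
  rw [count, N, h1, card_union_of_disjoint, card_biUnion]
  · congr 1; split_ifs <;> simp [N]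
  · intro g _ g' _ hne
    refine disjoint_left.mpr ?_
    intro F hF hF'
    rw [mem_part] at hF hF'
    exact hne (singleton_injective (hF.2.1.symm.trans hF'.2.1))
  · rw [disjoint_left]
    intro F hF hF'
    obtain ⟨g, -, hg⟩ := mem_biUnion.mp hF
    split_ifs at hF' with hb
    · rw [mem_part] at hg hF'
      have h2 := hg.2.1.symm.trans hF'.2.1
      have h3 : ({g} : Finset E).card = (G.cut A).card := by rw [h2]
      rw [card_singleton] at h3; rw [d] at hd; omega
    · simp at hF'

variable (G) in
/-- A point of the perfect matching polytope, in Edmonds' description. -/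
structure PMPt (w : E → ℚ) : Prop where
  nonneg : ∀ e, 0 ≤ w e
  inert : ∀ e, G.a e = G.b e → w e = 0
  star : ∀ v, ∑ e ∈ G.cut {v}, w e = 1
  odd : ∀ X : Finset V, X.card % 2 = 1 → 1 ≤ ∑ e ∈ G.cut X, w e

variable (G) in
/-- Every functional vanishing on the perfect matchings inside the support of `w` kills `w`. -/
def Good (w : E → ℚ) : Prop := ∀ φ : E → ℚ,
  (∀ F, G.IsPart univ ∅ ∅ F → (∀ e ∈ F, w e ≠ 0) → ∑ e ∈ F, φ e = 0) → ∑ e, φ e * w e = 0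

/-- The restriction of a weight to the edges of a contraction. -/
def cw (G : Gr V E) (A : Finset V) (w : E → ℚ) (e : E) : ℚ :=
  if e ∈ G.cut A ∪ G.ins A then w e else 0

lemma PMPt.con {w : E → ℚ} (h : G.PMPt w) {A : Finset V} (hA : Aᶜ.card % 2 = 1)
    (ht : ∑ e ∈ G.cut A, w e = 1) : (G.con A).PMPt (G.cw A w) := by
  have hsum : ∀ Y : Finset (Con A),
      ∑ e ∈ (G.con A).cut Y, G.cw A w e = ∑ e ∈ G.cut (pre Y), w e := by
    intro Y
    refine sum_congr (con_cut Y) fun e he => ?_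
    rw [← con_cut] at he
    rw [cw, if_pos (con_link.mp (link_of_mem_cut he))]
  refine ⟨fun e => ?_, fun e he => ?_, fun v => ?_, fun Y hY => ?_⟩
  · rw [cw]; split_ifs
    exacts [h.nonneg e, le_refl _]
  · rw [cw, if_neg]
    intro h'; exact con_link.mpr h' he
  · rw [hsum]
    cases v with
    | inn x hx => rw [pre_inn]; exact h.star x
    | pt => rw [pre_pt, cut_compl]; exact ht
  · rw [hsum]
    refine h.odd _ ?_
    by_cases hp : Con.pt ∈ Y
    · have := card_pre_of_mem hp; omega
    · have := card_pre_of_notMem hp; omega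

lemma lft_empty {A : Finset V} : lft A ∅ False = ∅ := by
  ext c; cases c
  · rw [mem_lft_inn]; simp
  · rw [mem_lft_pt]; simp

lemma isPart_con_pm {A : Finset V} {F : Finset E} :
    (G.con A).IsPart univ ∅ ∅ F ↔ ∃ f ∈ G.cut A, G.IsPart A ∅ {f} F := by
  rw [← lft_empty, isPart_con]
  simp only [false_and, or_false]
  constructor
  · rintro ⟨h1, h2⟩
    obtain ⟨f, hf⟩ := card_eq_one.mp h2
    rw [hf] at h1
    have : f ∈ F ∩ G.cut A := by rw [hf]; simp
    exact ⟨f, (mem_inter.mp this).2, h1⟩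
  · rintro ⟨f, -, h1⟩
    rw [h1.2.1]; exact ⟨h1, by simp⟩

lemma exists_pm_mem {w : E → ℚ} (hg : G.Good w) {f : E} (hf : w f ≠ 0) :
    ∃ F, G.IsPart univ ∅ ∅ F ∧ (∀ e ∈ F, w e ≠ 0) ∧ f ∈ F := by
  by_contra hcon
  push Not at hcon
  have := hg (fun e => if e = f then 1 else 0) (by
    intro F hF hs
    have := hcon F hF hs
    simp [this])
  simp at this
  exact hf this

lemma sum_split {A : Finset V} (ψ w : E → ℚ) :
    ∑ e, ψ e * G.cw A w e = ∑ e, if e ∈ G.cut A ∪ G.ins A then ψ e * w e else 0 := by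
  refine sum_congr rfl fun e _ => ?_
  rw [cw]; split_ifs <;> simp

/-- Decomposition along a tight cut. -/
lemma good_of_tight {w : E → ℚ} (h : G.PMPt w) {X : Finset V}
    (g1 : (G.con X).Good (G.cw X w)) (g2 : (G.con Xᶜ).Good (G.cw Xᶜ w)) : G.Good w := by
  intro φ hφ
  have side : ∀ A : Finset V, (G.con A).Good (G.cw A w) → ∀ f, ∃ F, f ∈ G.cut A → w f ≠ 0 →
      G.IsPart A ∅ {f} F ∧ ∀ e ∈ F, w e ≠ 0 := by
    intro A hg f
    by_cases hf : f ∈ G.cut A ∧ w f ≠ 0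
    · have h1 : G.cw A w f ≠ 0 := by
        rw [cw, if_pos (mem_union_left _ hf.1)]; exact hf.2
      obtain ⟨F, hF, hs, hfF⟩ := exists_pm_mem hg h1
      obtain ⟨g, -, hgF⟩ := isPart_con_pm.mp hF
      have h2 : f ∈ F ∩ G.cut A := mem_inter.mpr ⟨hfF, hf.1⟩
      rw [hgF.2.1, mem_singleton] at h2
      subst h2
      refine ⟨F, fun _ _ => ⟨hgF, fun e he hw => hs e he ?_⟩⟩
      rw [cw, hw]; simp
    · exact ⟨∅, fun h1 h2 => absurd ⟨h1, h2⟩ hf⟩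
  choose M1 hM1 using side X g1
  choose M2 hM2 using side Xᶜ g2
  simp only [cut_compl] at hM2
  have comb : ∀ f F F', G.IsPart X ∅ {f} F → G.IsPart Xᶜ ∅ {f} F' → (∀ e ∈ F, w e ≠ 0) →
      (∀ e ∈ F', w e ≠ 0) → ∑ e ∈ F, φ e + ∑ e ∈ F', φ e = φ f := by
    intro f F F' hF hF' hs hs'
    have h1 := hφ _ (hF.union hF') (by
      intro e he
      rcases mem_union.mp he with he | he
      exacts [hs e he, hs' e he])
    have h2 := sum_union_inter (s₁ := F) (s₂ := F') (f := φ)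
    rw [(hF.union_inter hF').2.2, h1, sum_singleton] at h2
    linarith
  set β : E → ℚ := fun f => ∑ e ∈ M1 f, φ e with hβ
  set α : E → ℚ := fun f => ∑ e ∈ M2 f, φ e with hα
  have hsub : ∀ (A : Finset V) (γ : E → ℚ) (f : E) (F : Finset E), G.IsPart A ∅ {f} F →
      ∑ e ∈ F, (if e ∈ G.cut A then φ e - γ e else φ e) = ∑ e ∈ F, φ e - γ f := by
    intro A γ f F hF
    have h1 : ∑ e ∈ F, (if e ∈ G.cut A then γ e else 0) = γ f := by
      rw [← sum_filter, filter_mem_eq_inter, hF.2.1, sum_singleton]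
    rw [← h1, ← sum_sub_distrib]
    refine sum_congr rfl fun e _ => ?_
    split_ifs <;> ring
  have hcws : ∀ (A : Finset V) (F : Finset E), (∀ e ∈ F, G.cw A w e ≠ 0) →
      ∀ e ∈ F, w e ≠ 0 := by
    intro A F hF e he hw
    refine hF e he ?_
    rw [cw, hw]; simp
  have k1 := g1 (fun e => if e ∈ G.cut X then φ e - β e else φ e) (by
    intro F hF hs
    obtain ⟨f, hf, hfF⟩ := isPart_con_pm.mp hF
    have hs' := hcws X F hs
    have hfw : w f ≠ 0 := by
      have : f ∈ F ∩ G.cut X := by rw [hfF.2.1]; simp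
      exact hs' f (mem_inter.mp this).1
    rw [hsub X β f F hfF]
    have c1 := comb f F (M2 f) hfF (hM2 f hf hfw).1 hs' (hM2 f hf hfw).2
    have c2 := comb f (M1 f) (M2 f) (hM1 f hf hfw).1 (hM2 f hf hfw).1 (hM1 f hf hfw).2
      (hM2 f hf hfw).2
    simp only [hβ]
    linarith)
  have k2 := g2 (fun e => if e ∈ G.cut Xᶜ then φ e - α e else φ e) (by
    intro F hF hs
    obtain ⟨f, hf, hfF⟩ := isPart_con_pm.mp hF
    have hs' := hcws Xᶜ F hs
    rw [cut_compl] at hf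
    have hfw : w f ≠ 0 := by
      have : f ∈ F ∩ G.cut Xᶜ := by rw [hfF.2.1]; simp
      exact hs' f (mem_inter.mp this).1
    rw [hsub Xᶜ α f F hfF]
    have c1 := comb f (M1 f) F (hM1 f hf hfw).1 hfF (hM1 f hf hfw).2 hs'
    have c2 := comb f (M1 f) (M2 f) (hM1 f hf hfw).1 (hM2 f hf hfw).1 (hM1 f hf hfw).2
      (hM2 f hf hfw).2
    simp only [hα]
    linarith)
  rw [sum_split] at k1 k2
  have : ∑ e, φ e * w e = ∑ e, ((if e ∈ G.cut X ∪ G.ins X then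
      (if e ∈ G.cut X then φ e - β e else φ e) * w e else 0) +
      if e ∈ G.cut Xᶜ ∪ G.ins Xᶜ then
      (if e ∈ G.cut Xᶜ then φ e - α e else φ e) * w e else 0) := by
    refine sum_congr rfl fun e _ => ?_
    rw [cut_compl]
    by_cases hc : e ∈ G.cut X
    · simp only [mem_union, hc, true_or, if_true]
      by_cases hw : w e = 0
      · simp [hw]
      · have := comb e (M1 e) (M2 e) (hM1 e hc hw).1 (hM2 e hc hw).1 (hM1 e hc hw).2
          (hM2 e hc hw).2
        have h1 : β e + α e = φ e := this
        rw [← add_mul]; congr 1; linarith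
    · by_cases h1 : e ∈ G.ins X
      · have h2 : e ∉ G.ins Xᶜ := by
          intro h2; exact ins_compl_disj h2 (mem_union_right _ h1)
        simp [hc, h1, h2]
      · by_cases h2 : e ∈ G.ins Xᶜ
        · simp [hc, h1, h2]
        · have h3 : G.a e = G.b e := by
            by_contra h3
            rw [mem_ins] at h1 h2; rw [mem_cut] at hc
            simp only [mem_compl] at h2; tauto
          simp [h.inert e h3]
  rw [this, sum_add_distrib, k1, k2, add_zero]

/-- A perfect matching inside the support. -/
lemma PMPt.exists_pm {w : E → ℚ} (h : G.PMPt w) :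
    ∃ F, G.IsPart univ ∅ ∅ F ∧ ∀ e ∈ F, w e ≠ 0 := by
  have heven : (univ : Finset V).card % 2 = 0 := by
    by_contra hodd
    have := h.odd univ (by omega)
    rw [cut_univ, sum_empty] at this
    linarith
  rcases tutte (G := G) univ (univ.filter fun e => w e = 0) heven with
    ⟨F, hF, hd⟩ | ⟨U, -, 𝒞, hcard, hdis, hC, hadj⟩
  · refine ⟨F, hF, fun e he hw => ?_⟩
    exact disjoint_left.mp hd he (by simp [hw])
  · exfalso
    have key := tutte_edge (G := G) hdis hC hadj
    have h1 : (𝒞.card : ℚ) ≤ ∑ C ∈ 𝒞, ∑ e ∈ G.cut C, w e := by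
      have : ∑ C ∈ 𝒞, (1 : ℚ) ≤ ∑ C ∈ 𝒞, ∑ e ∈ G.cut C, w e :=
        sum_le_sum fun C hC' => h.odd C (hC C hC').1
      simpa using this
    have h2 : ∑ v ∈ U, ∑ e ∈ G.cut {v}, w e = (U.card : ℚ) := by
      rw [sum_congr rfl fun v _ => h.star v]; simp
    have h3 : ∀ {ι : Type} (T : Finset ι) (c : ι → Finset V),
        ∑ C ∈ T, ∑ e ∈ G.cut (c C), w e =
          ∑ e, w e * ((T.filter fun C => e ∈ G.cut (c C)).card : ℚ) := by
      intro ι T c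
      have : ∀ C ∈ T, ∑ e ∈ G.cut (c C), w e = ∑ e, if e ∈ G.cut (c C) then w e else 0 := by
        intro C _; rw [← sum_filter]; congr 1; ext e; simp
      rw [sum_congr rfl this, sum_comm]
      refine sum_congr rfl fun e _ => ?_
      rw [← sum_filter, sum_const, nsmul_eq_mul, mul_comm]
    rw [h3 𝒞 fun C => C] at h1
    rw [h3 U fun v => {v}] at h2
    have h4 : ∑ e, w e * ((𝒞.filter fun C => e ∈ G.cut C).card : ℚ) ≤
        ∑ e, w e * ((U.filter fun v => e ∈ G.cut {v}).card : ℚ) := by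
      refine sum_le_sum fun e _ => ?_
      by_cases hw : w e = 0
      · simp [hw]
      · refine mul_le_mul_of_nonneg_left ?_ (h.nonneg e)
        have := key e
        rw [cut_univ, if_neg (by simp), if_neg (by simp [hw])] at this
        exact_mod_cast this
    rw [h2] at h4
    have h5 : (U.card : ℚ) + 2 ≤ 𝒞.card := by exact_mod_cast hcard
    linarith

/-- The support of a weight. -/
def supp (w : E → ℚ) : Finset E := univ.filter fun e => w e ≠ 0

lemma mem_supp {w : E → ℚ} {e : E} : e ∈ supp w ↔ w e ≠ 0 := by simp [supp]

lemma supp_cw (A : Finset V) (w : E → ℚ) : (supp (G.cw A w)).card ≤ (supp w).card := by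
  refine card_le_card fun e he => ?_
  rw [mem_supp] at he ⊢
  intro h; exact he (by rw [cw, h]; simp)

/-- Removing a multiple of a perfect matching from a point of the polytope. -/
lemma good_of_peel {w : E → ℚ} (h : G.PMPt w) {M : Finset E} (hM : G.IsPart univ ∅ ∅ M)
    (hMs : ∀ e ∈ M, w e ≠ 0)
    (hnt : ∀ X : Finset V, X.card % 2 = 1 → 2 ≤ X.card → 2 ≤ Xᶜ.card →
      ∑ e ∈ G.cut X, w e ≠ 1)
    (ih : ∀ z : E → ℚ, G.PMPt z → (supp z ⊂ supp w ∨ supp z ⊆ supp w ∧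
      ∃ X : Finset V, X.card % 2 = 1 ∧ 2 ≤ X.card ∧ 2 ≤ Xᶜ.card ∧
        ∑ e ∈ G.cut X, z e = 1) → G.Good z) : G.Good w := by
  intro φ hφ
  have hMv : ∀ v, (M ∩ G.cut {v}).card = 1 := by
    intro v
    have := hM.2.2 v (mem_univ _)
    simpa using this
  by_cases hone : ∀ e ∈ M, w e = 1
  · have hz : ∀ f, f ∉ M → w f = 0 := by
      intro f hf
      by_cases hl : G.a f = G.b f
      · exact h.inert f hl
      · obtain ⟨g, hg⟩ := card_eq_one.mp (hMv (G.a f))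
        have hgM : g ∈ M ∩ G.cut {G.a f} := by rw [hg]; simp
        rw [mem_inter] at hgM
        have hfc : f ∈ G.cut {G.a f} := by
          rw [mem_star]; intro h'; exact hl (h'.mp rfl).symm
        have hfg : f ≠ g := by rintro rfl; exact hf hgM.1
        have h1 : ∑ e ∈ ({f, g} : Finset E), w e ≤ ∑ e ∈ G.cut {G.a f}, w e := by
          refine sum_le_sum_of_subset_of_nonneg ?_ fun e _ _ => h.nonneg e
          intro e he; rw [mem_insert, mem_singleton] at he
          rcases he with rfl | rfl
          exacts [hfc, hgM.2]
        rw [sum_pair hfg, h.star, hone g hgM.1] at h1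
        have := h.nonneg f
        linarith
    have h1 := hφ M hM hMs
    rw [← sum_subset (subset_univ M) (fun e _ he => by rw [hz e he, mul_zero]), ← h1]
    exact sum_congr rfl fun e he => by rw [hone e he, mul_one]
  · push Not at hone
    obtain ⟨e1, he1, hw1⟩ := hone
    have hle1 : ∀ e, w e ≤ 1 := by
      intro e
      by_cases hl : G.a e = G.b e
      · rw [h.inert e hl]; norm_num
      · rw [← h.star (G.a e)]
        refine single_le_sum (f := w) (fun e _ => h.nonneg e) ?_
        rw [mem_star]; intro h'; exact hl (h'.mp rfl).symm
    set c : Finset V → ℚ := fun X => ((M ∩ G.cut X).card : ℚ) with hc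
    set r : Finset V → ℚ := fun X => (∑ e ∈ G.cut X, w e - 1) / (c X - 1) with hr
    set 𝒳 : Finset (Finset V) :=
      univ.filter fun X => X.card % 2 = 1 ∧ 2 ≤ (M ∩ G.cut X).card with h𝒳
    have h𝒳2 : ∀ X ∈ 𝒳, X.card % 2 = 1 ∧ 2 ≤ X.card ∧ 2 ≤ Xᶜ.card := by
      intro X hX
      rw [h𝒳, mem_filter] at hX
      obtain ⟨-, h1, h2⟩ := hX
      refine ⟨h1, ?_, ?_⟩
      · by_contra hlt
        have : X.card = 1 := by omega
        obtain ⟨v, rfl⟩ := card_eq_one.mp this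
        rw [hMv] at h2; omega
      · by_contra hlt
        have : Xᶜ.card = 0 ∨ Xᶜ.card = 1 := by omega
        rcases this with h0 | h0
        · rw [card_eq_zero, compl_eq_empty_iff] at h0
          rw [h0, cut_univ] at h2; simp at h2
        · obtain ⟨v, hv⟩ := card_eq_one.mp h0
          rw [← cut_compl, hv, hMv] at h2; omega
    have hc1 : ∀ X ∈ 𝒳, 0 < c X - 1 := by
      intro X hX
      have : (2 : ℚ) ≤ c X := by
        rw [h𝒳, mem_filter] at hX
        simp only [hc]; exact_mod_cast hX.2.2
      linarith
    set T : Finset ℚ := M.image w ∪ 𝒳.image r with hT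
    have hTne : T.Nonempty := ⟨w e1, mem_union_left _ (mem_image_of_mem _ he1)⟩
    set t := T.min' hTne with ht
    have htmem : t ∈ T := min'_mem _ _
    have htle : ∀ x ∈ T, t ≤ x := fun x hx => min'_le _ _ hx
    have htM : ∀ e ∈ M, t ≤ w e := fun e he => htle _ (mem_union_left _ (mem_image_of_mem _ he))
    have htX : ∀ X ∈ 𝒳, t * (c X - 1) ≤ ∑ e ∈ G.cut X, w e - 1 := by
      intro X hX
      have := htle (r X) (mem_union_right _ (mem_image_of_mem _ hX))
      rwa [hr, le_div_iff₀ (hc1 X hX)] at this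
    have ht1 : t < 1 := lt_of_le_of_lt (htM e1 he1) (lt_of_le_of_ne (hle1 e1) hw1)
    have hr0 : ∀ X ∈ 𝒳, 0 < r X := by
      intro X hX
      have h3 := h𝒳2 X hX
      have h1 := h.odd X h3.1
      have h2 := hnt X h3.1 h3.2.1 h3.2.2
      have h4 := lt_of_le_of_ne h1 (Ne.symm h2)
      exact div_pos (by linarith) (hc1 X hX)
    have ht0 : 0 < t := by
      rcases mem_union.mp htmem with hm | hm
      · obtain ⟨e, he, hew⟩ := mem_image.mp hm
        rw [← hew]; exact lt_of_le_of_ne (h.nonneg e) (Ne.symm (hMs e he))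
      · obtain ⟨X, hX, hXr⟩ := mem_image.mp hm
        rw [← hXr]; exact hr0 X hX
    have h1t : 0 < 1 - t := by linarith
    set z : E → ℚ := fun e => (w e - if e ∈ M then t else 0) / (1 - t) with hz
    have hMsum : ∀ (F : Finset E), ∑ e ∈ F, (if e ∈ M then t else 0) = t * (M ∩ F).card := by
      intro F
      rw [← sum_filter, sum_const, filter_mem_eq_inter, inter_comm, nsmul_eq_mul, mul_comm]
    have hzsum : ∀ X, ∑ e ∈ G.cut X, z e = (∑ e ∈ G.cut X, w e - t * c X) / (1 - t) := by
      intro X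
      rw [← sum_div, sum_sub_distrib, hMsum]
    have hzP : G.PMPt z := by
      refine ⟨fun e => ?_, fun e he => ?_, fun v => ?_, fun X hX => ?_⟩
      · refine div_nonneg ?_ h1t.le
        split_ifs with he
        · linarith [htM e he]
        · linarith [h.nonneg e]
      · have h0 := h.inert e he
        have : e ∉ M := fun hm => hMs e hm h0
        simp [hz, h0, this]
      · rw [hzsum, h.star, hc]
        simp only [hMv, Nat.cast_one, mul_one]
        exact div_self h1t.ne'
      · rw [hzsum, le_div_iff₀ h1t]
        by_cases hX2 : 2 ≤ (M ∩ G.cut X).card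
        · have := htX X (by rw [h𝒳, mem_filter]; exact ⟨mem_univ _, hX, hX2⟩)
          linarith
        · have h1 := h.odd X hX
          have : c X ≤ 1 := by
            simp only [hc]; exact_mod_cast (by omega : (M ∩ G.cut X).card ≤ 1)
          nlinarith
    have hzs : supp z ⊆ supp w := by
      intro e he
      rw [mem_supp] at he ⊢
      intro h0
      have : e ∉ M := fun hm => hMs e hm h0
      exact he (by simp [hz, h0, this])
    have hgz : G.Good z := by
      refine ih z hzP ?_
      rcases mem_union.mp htmem with hm | hm
      · obtain ⟨e, he, hew⟩ := mem_image.mp hm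
        left
        refine (ssubset_iff_of_subset hzs).mpr ⟨e, mem_supp.mpr (hMs e he), ?_⟩
        rw [mem_supp]; simp [hz, he, hew]
      · obtain ⟨X, hX, hXr⟩ := mem_image.mp hm
        right
        have h3 := h𝒳2 X hX
        refine ⟨hzs, X, h3.1, h3.2.1, h3.2.2, ?_⟩
        rw [hzsum, div_eq_one_iff_eq h1t.ne']
        have h5 := hc1 X hX
        rw [hr, div_eq_iff h5.ne'] at hXr
        linarith
    have hφz := hgz φ (fun F hF hs => hφ F hF fun e he => mem_supp.mp (hzs (mem_supp.mpr (hs e he))))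
    have hφM := hφ M hM hMs
    have : ∀ e, φ e * w e = (1 - t) * (φ e * z e) + t * (if e ∈ M then φ e else 0) := by
      intro e
      have : (1 - t) * z e = w e - if e ∈ M then t else 0 := by
        rw [hz]; field_simp
      have h2 : (1 - t) * (φ e * z e) = φ e * ((1 - t) * z e) := by ring
      rw [h2, this]
      split_ifs <;> ring
    rw [sum_congr rfl fun e _ => this e, sum_add_distrib, ← mul_sum, ← mul_sum, hφz, ← sum_filter,
      filter_mem_eq_inter, univ_inter, hφM]
    ring

/-- Edmonds' theorem, in dual form. -/
theorem PMPt.good (k : ℕ) : ∀ {V : Type} [Fintype V] {G : Gr V E} {w : E → ℚ},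
    Fintype.card V + (supp w).card ≤ k → G.PMPt w → G.Good w := by
  induction k with
  | zero =>
    intro V _ G w hk h φ _
    have h0 : (supp w).card = 0 := by omega
    rw [card_eq_zero] at h0
    refine sum_eq_zero fun e _ => ?_
    have : e ∉ supp w := by rw [h0]; simp
    rw [mem_supp, not_not] at this
    rw [this, mul_zero]
  | succ k ih =>
    intro V _ G w hk h
    have tight : ∀ z : E → ℚ, G.PMPt z → (supp z).card ≤ (supp w).card →
        (∃ X : Finset V, X.card % 2 = 1 ∧ 2 ≤ X.card ∧ 2 ≤ Xᶜ.card ∧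
          ∑ e ∈ G.cut X, z e = 1) → G.Good z := by
      rintro z hz hzs ⟨X, hX, h2, h2', ht⟩
      obtain ⟨F, hF, -⟩ := hz.exists_pm
      have hev : (univ : Finset V).card % 2 = 0 := by
        by_contra hodd
        have := hz.odd univ (by omega)
        rw [cut_univ, sum_empty] at this
        linarith
      have hcc := card_add_card_compl X
      rw [card_univ] at hev
      have hXc : Xᶜ.card % 2 = 1 := by omega
      refine good_of_tight hz (ih ?_ (hz.con hXc ht)) (ih ?_ (hz.con ?_ ?_))
      · have := supp_cw (G := G) X z
        rw [card_con]; omega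
      · have := supp_cw (G := G) Xᶜ z
        rw [card_con]; omega
      · rwa [compl_compl]
      · rwa [cut_compl]
    by_cases hnt : ∃ X : Finset V, X.card % 2 = 1 ∧ 2 ≤ X.card ∧ 2 ≤ Xᶜ.card ∧
        ∑ e ∈ G.cut X, w e = 1
    · exact tight w h le_rfl hnt
    · obtain ⟨M, hM, hMs⟩ := h.exists_pm
      refine good_of_peel h hM hMs ?_ ?_
      · intro X h1 h2 h3 h4; exact hnt ⟨X, h1, h2, h3, h4⟩
      · intro z hz hcase
        rcases hcase with hlt | ⟨hle, hX⟩
        · have := card_lt_card hlt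
          exact ih (by omega) hz
        · exact tight z hz (card_le_card hle) hX

/-- Small perturbations of the constant weight `1/3` stay in the polytope. -/
lemma pmpt_perturb (hG : G.Cubic) (h4 : G.C4) {z : E → ℚ} (hin : ∀ e, G.a e = G.b e → z e = 0)
    (hst : ∀ v, ∑ e ∈ G.cut {v}, z e = 0) {ε : ℚ} (hε : 0 ≤ ε)
    (hz : ε * ∑ e, |z e| ≤ 1 / 3) :
    G.PMPt fun e => (if G.a e = G.b e then 0 else 1 / 3) + ε * z e := by
  have hle : ∀ T : Finset E, -(1 / 3) ≤ ∑ e ∈ T, ε * z e := by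
    intro T
    rw [← mul_sum]
    have h1 : -∑ e, |z e| ≤ ∑ e ∈ T, z e := by
      have h2 : ∑ e ∈ T, |z e| ≤ ∑ e, |z e| :=
        sum_le_sum_of_subset_of_nonneg (subset_univ T) fun e _ _ => abs_nonneg _
      have h3 : -∑ e ∈ T, |z e| ≤ ∑ e ∈ T, z e := by
        rw [← sum_neg_distrib]; exact sum_le_sum fun e _ => neg_abs_le _
      linarith
    nlinarith
  have hcut : ∀ X, ∑ e ∈ G.cut X, ((if G.a e = G.b e then 0 else 1 / 3) + ε * z e) =
      (G.d X : ℚ) / 3 + ∑ e ∈ G.cut X, ε * z e := by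
    intro X
    rw [sum_add_distrib]; congr 1
    rw [sum_congr rfl fun e he => if_neg (link_of_mem_cut he), sum_const, nsmul_eq_mul, d]
    ring
  have hone : ∀ v, ∑ e ∈ G.cut {v}, ((if G.a e = G.b e then 0 else 1 / 3) + ε * z e) = 1 := by
    intro v
    rw [hcut, hG v, ← mul_sum, hst]; norm_num
  refine ⟨fun e => ?_, fun e he => ?_, hone, fun X hX => ?_⟩
  · split_ifs with h
    · rw [hin e h]; simp
    · have := hle {e}
      rw [sum_singleton] at this; linarith
  · simp [he, hin e he]
  · have hev := hG.even
    have hcc := card_add_card_compl X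
    by_cases h1 : X.card = 1
    · obtain ⟨v, rfl⟩ := card_eq_one.mp h1
      exact (hone v).ge
    by_cases h2 : Xᶜ.card = 1
    · obtain ⟨v, hv⟩ := card_eq_one.mp h2
      rw [← cut_compl, hv]; exact (hone v).ge
    have hX0 : X.Nonempty := by rw [← card_pos]; omega
    have hXu : X ≠ univ := by
      rintro rfl; rw [card_univ] at hX; omega
    obtain ⟨h5, h6⟩ := h4 X hX0 hXu
    have hp := hG.parity X
    have h7 : 5 ≤ G.d X := by
      by_contra hlt
      have : G.d X = 3 := by omega
      rcases h6 this with h | h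
      exacts [h1 h, h2 h]
    rw [hcut]
    have h8 : (5 : ℚ) ≤ G.d X := by exact_mod_cast h7
    have := hle (G.cut X)
    linarith

lemma sum_ins_univ (z : E → ℚ) :
    ∑ e ∈ G.ins univ, z e = ∑ e, if G.a e = G.b e then 0 else z e := by
  have : G.ins univ = univ.filter fun e => ¬ G.a e = G.b e := by
    ext e; simp [mem_ins]
  rw [this, sum_filter]
  exact sum_congr rfl fun e _ => by split_ifs <;> simp_all

/-- A weight with constant star sums and zero sum on each perfect matching vanishes. -/
lemma eq_zero_of_pm_sum (hG : G.Cubic) (h4 : G.C4) {z : E → ℚ}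
    (hin : ∀ e, G.a e = G.b e → z e = 0) {v0 : V}
    (hst : ∀ v, ∑ e ∈ G.cut {v}, z e = ∑ e ∈ G.cut {v0}, z e)
    (hpm : ∀ F, G.IsPart univ ∅ ∅ F → ∑ e ∈ F, z e = 0) : z = 0 := by
  have hgood : ∀ {w : E → ℚ}, G.PMPt w → ∑ e, z e * w e = 0 := fun {w} hw =>
    PMPt.good _ le_rfl hw z fun F hF _ => hpm F hF
  have h1 : ∑ e ∈ G.ins univ, z e = 0 := by
    have h0 := pmpt_perturb hG h4 (z := 0) (fun e _ => rfl) (fun v => by simp) le_rfl (by simp)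
      (ε := 0)
    have := hgood h0
    have h2 : ∀ e, z e * ((if G.a e = G.b e then (0 : ℚ) else 1 / 3) + 0 * (0 : E → ℚ) e) =
        (1 / 3) * if G.a e = G.b e then 0 else z e := by
      intro e; split_ifs <;> simp; ring
    rw [sum_congr rfl fun e _ => h2 e, ← mul_sum, ← sum_ins_univ] at this
    linarith
  have h2 := sum_star (G := G) z univ
  rw [cut_univ, h1, sum_congr rfl fun v _ => hst v] at h2
  simp only [sum_const, sum_empty, nsmul_eq_mul, mul_zero, add_zero] at h2
  have hn : ((univ : Finset V).card : ℚ) ≠ 0 := by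
    have : 0 < (univ : Finset V).card := card_pos.mpr ⟨v0, mem_univ _⟩
    positivity
  have hs : ∑ e ∈ G.cut {v0}, z e = 0 := (mul_eq_zero.mp h2).resolve_left hn
  have hB : 0 ≤ ∑ e, |z e| := sum_nonneg fun e _ => abs_nonneg _
  set ε : ℚ := 1 / (3 * (∑ e, |z e| + 1)) with hε
  have hε0 : 0 < ε := by positivity
  have h3 := hgood (pmpt_perturb hG h4 hin (fun v => (hst v).trans hs) hε0.le (by
    rw [hε, div_mul_eq_mul_div, div_le_div_iff₀ (by positivity) (by norm_num)]; linarith))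
  have h4' : ∀ e, z e * ((if G.a e = G.b e then (0 : ℚ) else 1 / 3) + ε * z e) =
      (1 / 3) * (if G.a e = G.b e then 0 else z e) + ε * (z e * z e) := by
    intro e; split_ifs <;> ring
  rw [sum_congr rfl fun e _ => h4' e, sum_add_distrib, ← mul_sum, ← mul_sum, ← sum_ins_univ, h1,
    mul_zero, zero_add] at h3
  have h5 := (mul_eq_zero.mp h3).resolve_left hε0.ne'
  rw [sum_eq_zero_iff_of_nonneg fun e _ => mul_self_nonneg _] at h5
  funext e
  exact mul_self_eq_zero.mp (h5 e (mem_univ e))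

/-- The linear bound on the number of perfect matchings. -/
theorem count_ge_of_C4 (hG : G.Cubic) (h4 : G.C4) [Nonempty V] :
    Fintype.card V + 2 ≤ 2 * G.count ∅ := by
  obtain ⟨v0⟩ := ‹Nonempty V›
  let L : (E → ℚ) →ₗ[ℚ] ({v : V // v ≠ v0} ⊕ {F // F ∈ G.part univ ∅ ∅}) ⊕
      {e : E // G.a e = G.b e} → ℚ :=
    { toFun := fun z => Sum.elim (Sum.elim
        (fun v => ∑ e ∈ G.cut {v.1}, z e - ∑ e ∈ G.cut {v0}, z e) (fun F => ∑ e ∈ F.1, z e))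
        (fun e => z e.1)
      map_add' := by
        intro x y; ext i
        rcases i with (i | i) | i <;> simp [sum_add_distrib]
        ring
      map_smul' := by
        intro x y; ext i
        rcases i with (i | i) | i <;> simp [mul_sum, mul_sub] }
  have hL : Function.Injective L := by
    rw [← LinearMap.ker_eq_bot, LinearMap.ker_eq_bot']
    intro z hz
    refine eq_zero_of_pm_sum hG h4 (v0 := v0) (fun e he => ?_) (fun v => ?_) fun F hF => ?_
    · exact congrFun hz (Sum.inr ⟨e, he⟩)
    · by_cases hv : v = v0
      · rw [hv]
      · have := congrFun hz (Sum.inl (Sum.inl ⟨v, hv⟩))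
        exact sub_eq_zero.mp this
    · exact congrFun hz (Sum.inl (Sum.inr ⟨F, mem_part.mpr hF⟩))
  have h1 := LinearMap.finrank_le_finrank_of_injective hL
  rw [Module.finrank_fintype_fun_eq_card, Module.finrank_fintype_fun_eq_card, Fintype.card_sum,
    Fintype.card_sum, Fintype.card_coe] at h1
  have h2 : Fintype.card {v : V // v ≠ v0} + 1 = Fintype.card V := by
    rw [Fintype.card_subtype, filter_ne', card_erase_of_mem (mem_univ _), card_univ]
    have : 0 < Fintype.card V := Fintype.card_pos_iff.mpr ⟨v0⟩
    omega
  have h3 : Fintype.card {e : E // G.a e = G.b e} + (G.ins univ).card = Fintype.card E := by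
    rw [Fintype.card_subtype, ← card_univ,
      ← card_filter_add_card_filter_not (s := (univ : Finset E)) (fun e => G.a e = G.b e)]
    congr 2
    ext e; simp [mem_ins]
  have h5 := hG.sum univ
  rw [d, cut_univ, card_empty, card_univ] at h5
  have h6 : G.count ∅ = (G.part univ ∅ ∅).card := rfl
  omega

/-- The linear bound for non-bipartite graphs. -/
theorem count_ge_of_C4_nonbip (hG : G.Cubic) (h4 : G.C4) (hn : 4 ≤ Fintype.card V)
    (hb : ¬ G.Bip univ) (S : Finset V) :
    Fintype.card V + 2 + 2 * S.card ≤ 2 * G.count S := by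
  have : Nonempty V := Fintype.card_pos_iff.mp (by omega)
  have h1 := count_ge_of_C4 hG h4
  have h2 := count_add_card_le hG h4 hn hb (disjoint_empty_left S)
  rw [empty_union] at h2
  omega

end Gr

namespace Bpm

open Finset

variable {ι κ E : Type} {a : E → ι} {b : E → κ} {L : Finset E} {P : Finset ι} {Q : Finset κ}

/-- Perfect matchings of the bipartite graph with edge set `L` and classes `P`, `Q`. -/
def pms (a : E → ι) (b : E → κ) (L : Finset E) (P : Finset ι) (Q : Finset κ) :
    Finset (Finset E) :=
  L.powerset.filter fun F => (∀ p ∈ P, (F.filter (a · = p)).card = 1) ∧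
    ∀ q ∈ Q, (F.filter (b · = q)).card = 1

lemma mem_pms {F : Finset E} : F ∈ pms a b L P Q ↔ F ⊆ L ∧
    (∀ p ∈ P, (F.filter (a · = p)).card = 1) ∧ ∀ q ∈ Q, (F.filter (b · = q)).card = 1 := by
  simp [pms]

lemma pms_swap : pms a b L P Q = pms b a L Q P := by
  ext F; simp only [mem_pms]; tauto

lemma pms_erase (e : E) : pms a b (L.erase e) P Q = (pms a b L P Q).filter (e ∉ ·) := by
  ext F; simp only [mem_pms, mem_filter, subset_erase]; tauto

/-- Averaging over the edges at a vertex. -/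
lemma sum_pms_erase {p : ι} (hp : p ∈ P) :
    ∑ e ∈ L.filter (a · = p), (pms a b (L.erase e) P Q).card + (pms a b L P Q).card =
      (L.filter (a · = p)).card * (pms a b L P Q).card := by
  have h1 : ∑ e ∈ L.filter (a · = p), ((pms a b L P Q).filter (e ∈ ·)).card =
      (pms a b L P Q).card := by
    have := sum_card_bipartiteAbove_eq_sum_card_bipartiteBelow (s := L.filter (a · = p))
      (t := pms a b L P Q) (fun e F => e ∈ F)
    unfold bipartiteAbove bipartiteBelow at this
    rw [this, card_eq_sum_ones]
    refine sum_congr rfl fun F hF => ?_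
    rw [mem_pms] at hF
    rw [← hF.2.1 p hp]; congr 1; ext e
    simp only [mem_filter]
    constructor
    · rintro ⟨⟨_, h⟩, h'⟩; exact ⟨h', h⟩
    · rintro ⟨h, h'⟩; exact ⟨⟨hF.1 h, h'⟩, h⟩
  rw [← h1, ← sum_add_distrib, sum_congr rfl fun e _ => ?_, sum_const, smul_eq_mul, h1]
  rw [pms_erase, add_comm]
  exact card_filter_add_card_filter_not (s := pms a b L P Q) (fun F => e ∈ F)

lemma card_erase_filter {α : Type} {f : E → α} {e : E} (he : e ∈ L) (x : α) :
    ((L.erase e).filter (f · = x)).card + (if f e = x then 1 else 0) =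
      (L.filter (f · = x)).card := by
  rw [filter_erase]
  split_ifs with h
  · rw [card_erase_of_mem (by simp [he, h])]
    have : 0 < (L.filter (f · = x)).card := card_pos.mpr ⟨e, by simp [he, h]⟩
    omega
  · rw [erase_eq_of_notMem (by simp [h])]; simp

/-- All degrees are three. -/
structure Full (a : E → ι) (b : E → κ) (L : Finset E) (P : Finset ι) (Q : Finset κ)
    (n : ℕ) : Prop where
  mem : ∀ e ∈ L, a e ∈ P ∧ b e ∈ Q
  row : ∀ p ∈ P, (L.filter (a · = p)).card = 3
  col : ∀ q ∈ Q, (L.filter (b · = q)).card = 3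
  card_row : P.card = n
  card_col : Q.card = n

/-- All degrees are three except for two vertices of degree two. -/
structure Near (a : E → ι) (b : E → κ) (L : Finset E) (P : Finset ι) (Q : Finset κ)
    (n : ℕ) (p0 : ι) (q0 : κ) : Prop where
  mem : ∀ e ∈ L, a e ∈ P ∧ b e ∈ Q
  mem_row : p0 ∈ P
  mem_col : q0 ∈ Q
  row : ∀ p ∈ P, (L.filter (a · = p)).card = if p = p0 then 2 else 3
  col : ∀ q ∈ Q, (L.filter (b · = q)).card = if q = q0 then 2 else 3
  card_row : P.card = n
  card_col : Q.card = n

/-- The lower bound for nearly cubic bipartite graphs with `n + 1` vertices in each class. -/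
def vg : ℕ → ℕ
  | 0 => 2
  | n + 1 => (4 * vg n + 2) / 3

lemma Full.bound {n k : ℕ} (hn : 0 < n) (h : Full a b L P Q n)
    (ih : ∀ L p0 q0, Near a b L P Q n p0 q0 → k ≤ (pms a b L P Q).card) :
    3 * k ≤ 2 * (pms a b L P Q).card := by
  obtain ⟨p0, hp0⟩ : P.Nonempty := by rw [← card_pos, h.card_row]; exact hn
  have h1 := sum_pms_erase (a := a) (b := b) (L := L) (Q := Q) hp0
  have h2 : (L.filter (a · = p0)).card * k ≤
      ∑ e ∈ L.filter (a · = p0), (pms a b (L.erase e) P Q).card := by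
    rw [← smul_eq_mul]
    refine card_nsmul_le_sum _ _ _ fun e he => ?_
    rw [mem_filter] at he
    refine ih _ p0 (b e) ⟨fun f hf => h.mem f (mem_of_mem_erase hf), hp0, (h.mem e he.1).2,
      fun p hp => ?_, fun q hq => ?_, h.card_row, h.card_col⟩
    · have := card_erase_filter (f := a) he.1 p
      rw [h.row p hp, he.2] at this
      by_cases hpp : p = p0
      · rw [if_pos hpp.symm] at this; rw [if_pos hpp]; omega
      · rw [if_neg (Ne.symm hpp)] at this; rw [if_neg hpp]; omega
    · have := card_erase_filter (f := b) he.1 q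
      rw [h.col q hq] at this
      by_cases hpp : q = b e
      · rw [if_pos hpp.symm] at this; rw [if_pos hpp]; omega
      · rw [if_neg (Ne.symm hpp)] at this; rw [if_neg hpp]; omega
  rw [h.row p0 hp0] at h1 h2
  omega

/-- Contracting a vertex of degree two with two distinct neighbours. -/
lemma pms_merge {p0 : ι} {e1 e2 : E} (hp0 : ∀ e ∈ L, a e = p0 ↔ e = e1 ∨ e = e2)
    (h1 : e1 ∈ L) (h2 : e2 ∈ L) (hne : b e1 ≠ b e2) (hb1 : b e1 ∈ Q) :
    (pms a (fun e => if b e = b e2 then b e1 else b e) ((L.erase e1).erase e2) (P.erase p0)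
      (Q.erase (b e2))).card ≤ (pms a b L P Q).card := by
  set q1 := b e1 with hq1
  set q2 := b e2 with hq2
  have he12 : e1 ≠ e2 := by rintro rfl; exact hne rfl
  have ha1 : a e1 = p0 := (hp0 e1 h1).mpr (Or.inl rfl)
  have ha2 : a e2 = p0 := (hp0 e2 h2).mpr (Or.inr rfl)
  refine card_le_card_of_injOn
    (fun F => if (F.filter (b · = q1)).card = 1 then insert e2 F else insert e1 F) ?_ ?_
  · intro F hF
    rw [mem_coe, mem_pms] at hF
    obtain ⟨hs, hr, hc⟩ := hF
    have hnot : e1 ∉ F ∧ e2 ∉ F :=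
      ⟨fun h => by simpa using hs h, fun h => by simpa using hs h⟩
    have hFL : F ⊆ L := fun e he => mem_of_mem_erase (mem_of_mem_erase (hs he))
    have hFp : F.filter (a · = p0) = ∅ := by
      rw [filter_eq_empty_iff]
      intro e he hae
      rcases (hp0 e (hFL he)).mp hae with rfl | rfl
      exacts [hnot.1 he, hnot.2 he]
    have hsum : (F.filter (b · = q1)).card + (F.filter (b · = q2)).card = 1 := by
      rw [← hc q1 (by simp [hne, hb1]), ← card_union_of_disjoint]
      · congr 1; ext e; simp only [mem_union, mem_filter]
        constructor
        · rintro (⟨h, h'⟩ | ⟨h, h'⟩)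
          · exact ⟨h, by rw [h', if_neg hne]⟩
          · exact ⟨h, by rw [h', if_pos rfl]⟩
        · rintro ⟨h, h'⟩
          by_cases hh : b e = q2
          · exact Or.inr ⟨h, hh⟩
          · rw [if_neg hh] at h'; exact Or.inl ⟨h, h'⟩
      · rw [disjoint_left]; intro e h h'
        rw [mem_filter] at h h'
        exact hne (h.2.symm.trans h'.2)
    have hoth : ∀ q ∈ Q, q ≠ q1 → q ≠ q2 → (F.filter (b · = q)).card = 1 := by
      intro q hq hq1' hq2'
      rw [← hc q (by simp [hq, hq2'])]
      congr 1; ext e; simp only [mem_filter]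
      by_cases hh : b e = q2
      · rw [if_pos hh, hh]; simp only [hq2'.symm, hq1'.symm]
      · rw [if_neg hh]
    have key : ∀ e', e' ∈ L → e' ∉ F → a e' = p0 → (b e' = q1 ∨ b e' = q2) →
        (F.filter (b · = b e')).card = 0 → insert e' F ∈ pms a b L P Q := by
      intro e' heL heF hea heb hec
      rw [mem_pms]
      refine ⟨insert_subset heL hFL, fun p hp => ?_, fun q hq => ?_⟩
      · rw [filter_insert]
        by_cases hpp : p = p0
        · rw [if_pos (hea.trans hpp.symm), hpp, hFp]; simp
        · rw [if_neg (by rw [hea]; exact Ne.symm hpp)]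
          exact hr p (by simp [hpp, hp])
      · rw [filter_insert]
        by_cases hqq : b e' = q
        · rw [if_pos hqq, card_insert_of_notMem (by simp [heF]), ← hqq, hec]
        · rw [if_neg hqq]
          by_cases hqa : q = q1
          · subst hqa
            rcases heb with h | h
            · exact absurd h hqq
            · rw [h] at hec; omega
          by_cases hqb : q = q2
          · subst hqb
            rcases heb with h | h
            · rw [h] at hec; omega
            · exact absurd h hqq
          exact hoth q hq hqa hqb
    simp only
    split_ifs with hif
    · exact key e2 h2 hnot.2 ha2 (Or.inr rfl) (by rw [← hq2]; omega)
    · exact key e1 h1 hnot.1 ha1 (Or.inl rfl) (by rw [← hq1]; omega)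
  · intro F hF F' hF' heq
    rw [mem_coe, mem_pms] at hF hF'
    have recover : ∀ F : Finset E, F ⊆ (L.erase e1).erase e2 →
        ((if (F.filter (b · = q1)).card = 1 then insert e2 F else insert e1 F).erase e1).erase e2 =
          F := by
      intro F hs
      have hnot : e1 ∉ F ∧ e2 ∉ F :=
        ⟨fun h => by simpa using hs h, fun h => by simpa using hs h⟩
      ext e
      split_ifs <;> simp only [mem_erase, mem_insert] <;>
        constructor <;> intro h
      · tauto
      · exact ⟨fun h' => hnot.2 (h' ▸ h), fun h' => hnot.1 (h' ▸ h), Or.inr h⟩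
      · tauto
      · exact ⟨fun h' => hnot.2 (h' ▸ h), fun h' => hnot.1 (h' ▸ h), Or.inr h⟩
    rw [← recover F hF.1, ← recover F' hF'.1]
    simp only at heq
    rw [heq]

/-- Removing a vertex of degree two whose two edges are parallel. -/
lemma pms_double {p0 : ι} {e1 e2 : E} (hp0 : ∀ e ∈ L, a e = p0 ↔ e = e1 ∨ e = e2)
    (h1 : e1 ∈ L) (h2 : e2 ∈ L) (hne : e1 ≠ e2) (heq : b e2 = b e1) :
    2 * (pms a b (L.filter (b · ≠ b e1)) (P.erase p0) (Q.erase (b e1))).card ≤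
      (pms a b L P Q).card := by
  have ha1 : a e1 = p0 := (hp0 e1 h1).mpr (Or.inl rfl)
  have ha2 : a e2 = p0 := (hp0 e2 h2).mpr (Or.inr rfl)
  rw [← card_pair hne, ← card_product]
  refine card_le_card_of_injOn (fun x => insert x.1 x.2) ?_ ?_
  · rintro ⟨e', F⟩ hx
    rw [mem_coe, mem_product, mem_insert, mem_singleton] at hx
    obtain ⟨he', hF⟩ := hx
    simp only at he' hF
    rw [mem_pms] at hF
    have heL : e' ∈ L := by rcases he' with rfl | rfl <;> assumption
    have hea : a e' = p0 := (hp0 e' heL).mpr he'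
    have heb : b e' = b e1 := by rcases he' with rfl | rfl; exacts [rfl, heq]
    have hFb : ∀ e ∈ F, b e ≠ b e1 := fun e he => (mem_filter.mp (hF.1 he)).2
    have hFa : ∀ e ∈ F, a e ≠ p0 := by
      intro e he h
      rcases (hp0 e (mem_filter.mp (hF.1 he)).1).mp h with rfl | rfl
      exacts [hFb _ he rfl, hFb _ he heq]
    simp only [coe_filter, mem_coe]
    rw [mem_pms]
    refine ⟨insert_subset heL fun e he => (mem_filter.mp (hF.1 he)).1, fun p hp => ?_,
      fun q hq => ?_⟩
    · rw [filter_insert]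
      by_cases hpp : p = p0
      · rw [if_pos (hea.trans hpp.symm), filter_eq_empty_iff.mpr]
        · simp
        · intro e he; rw [hpp]; exact hFa e he
      · rw [if_neg (by rw [hea]; exact Ne.symm hpp)]
        exact hF.2.1 p (by simp [hpp, hp])
    · rw [filter_insert]
      by_cases hqq : q = b e1
      · rw [if_pos (heb.trans hqq.symm), filter_eq_empty_iff.mpr]
        · simp
        · intro e he; rw [hqq]; exact hFb e he
      · rw [if_neg (by rw [heb]; exact Ne.symm hqq)]
        exact hF.2.2 q (by simp [hqq, hq])
  · rintro ⟨e, F⟩ hx ⟨e', F'⟩ hx' h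
    rw [mem_coe, mem_product, mem_insert, mem_singleton] at hx hx'
    obtain ⟨he, hF⟩ := hx
    obtain ⟨he', hF'⟩ := hx'
    simp only at he hF he' hF' h
    rw [mem_pms] at hF hF'
    have hbe : b e = b e1 := by rcases he with rfl | rfl; exacts [rfl, heq]
    have hbe' : b e' = b e1 := by rcases he' with rfl | rfl; exacts [rfl, heq]
    have hn : ∀ {f : E}, b f = b e1 → f ∉ F ∧ f ∉ F' := fun {f} hf =>
      ⟨fun h => (mem_filter.mp (hF.1 h)).2 hf, fun h => (mem_filter.mp (hF'.1 h)).2 hf⟩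
    have hee : e = e' := by
      have : e ∈ insert e' F' := by rw [← h]; exact mem_insert_self _ _
      rcases mem_insert.mp this with h' | h'
      exacts [h', absurd h' (hn hbe).2]
    subst hee
    congr 1
    rw [← erase_insert (hn hbe).1, h, erase_insert (hn hbe).2]

theorem Near.bound (n : ℕ) : ∀ {ι κ E : Type} {a : E → ι} {b : E → κ} {L : Finset E}
    {P : Finset ι} {Q : Finset κ} {p0 : ι} {q0 : κ}, Near a b L P Q (n + 1) p0 q0 →
    vg n ≤ (pms a b L P Q).card := by
  induction n with
  | zero =>
    intro ι κ E a b L P Q p0 q0 h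
    obtain ⟨p, hp⟩ := card_eq_one.mp h.card_row
    obtain ⟨q, hq⟩ := card_eq_one.mp h.card_col
    have hp0 := h.mem_row; have hq0 := h.mem_col
    rw [hp, mem_singleton] at hp0; rw [hq, mem_singleton] at hq0
    subst hp0; subst hq0
    have hL : L.card = 2 := by
      have := h.row p0 h.mem_row
      rw [if_pos rfl, filter_true_of_mem] at this
      · exact this
      · intro e he; have := (h.mem e he).1; rwa [hp, mem_singleton] at this
    rw [vg, ← hL]
    refine card_le_card_of_injOn (fun e => {e}) ?_ ?_
    · intro e he
      rw [mem_coe, mem_pms]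
      have := h.mem e he
      rw [hp, hq, mem_singleton, mem_singleton] at this
      refine ⟨by simpa using he, ?_, ?_⟩
      · rw [hp]; intro p hp'; rw [mem_singleton] at hp'; simp [filter_singleton, this.1, hp']
      · rw [hq]; intro p hp'; rw [mem_singleton] at hp'; simp [filter_singleton, this.2, hp']
    · intro e _ e' _ h'; simpa using h'
  | succ n ih =>
    intro ι κ E a b L P Q p0 q0 h
    have hfull : ∀ {b : E → κ} {L : Finset E} {P : Finset ι} {Q : Finset κ},
        Full a b L P Q (n + 1) → 3 * vg n ≤ 2 * (pms a b L P Q).card := fun {b L P Q} hf =>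
      hf.bound (by omega) fun L p0 q0 hN => ih hN
    have hst := h.row p0 h.mem_row
    rw [if_pos rfl] at hst
    obtain ⟨e1, e2, hne, hst⟩ := card_eq_two.mp hst
    have hstm : ∀ e, (e ∈ L ∧ a e = p0) ↔ e = e1 ∨ e = e2 := by
      intro e; rw [← mem_filter (s := L) (p := fun e => a e = p0), hst]; simp
    obtain ⟨h1, ha1⟩ := (hstm e1).mpr (Or.inl rfl)
    obtain ⟨h2, ha2⟩ := (hstm e2).mpr (Or.inr rfl)
    have hp0 : ∀ e ∈ L, a e = p0 ↔ e = e1 ∨ e = e2 := by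
      intro e he; rw [← hstm]; simp [he]
    have hb1 := (h.mem e1 h1).2
    have hb2 := (h.mem e2 h2).2
    rw [vg]
    by_cases hb : b e1 = b e2
    · have hd := pms_double (P := P) (Q := Q) hp0 h1 h2 hne hb.symm
      have hcP : (P.erase p0).card = n + 1 := by
        rw [card_erase_of_mem h.mem_row, h.card_row]; omega
      have hcQ : (Q.erase (b e1)).card = n + 1 := by
        rw [card_erase_of_mem hb1, h.card_col]; omega
      have hmem : ∀ e ∈ L.filter (b · ≠ b e1), a e ∈ P.erase p0 ∧ b e ∈ Q.erase (b e1) := by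
        intro e he
        rw [mem_filter] at he
        obtain ⟨m1, m2⟩ := h.mem e he.1
        refine ⟨mem_erase.mpr ⟨fun hae => ?_, m1⟩, mem_erase.mpr ⟨he.2, m2⟩⟩
        rcases (hp0 e he.1).mp hae with rfl | rfl
        exacts [he.2 rfl, he.2 hb.symm]
      have hcol : ∀ q, q ≠ b e1 → (L.filter (b · ≠ b e1)).filter (b · = q) =
          L.filter (b · = q) := by
        intro q hq; ext e; simp only [mem_filter]
        constructor
        · rintro ⟨⟨x, -⟩, y⟩; exact ⟨x, y⟩
        · rintro ⟨x, y⟩; exact ⟨⟨x, by rw [y]; exact hq⟩, y⟩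
      have hrow : ∀ p, ((L.filter (b · ≠ b e1)).filter (a · = p)).card +
          ((L.filter (b · = b e1)).filter (a · = p)).card = (L.filter (a · = p)).card := by
        intro p
        rw [← card_filter_add_card_filter_not (s := L.filter (a · = p)) (fun e => b e ≠ b e1)]
        congr 1
        · congr 1; ext e; simp only [mem_filter]; tauto
        · congr 1; ext e; simp only [mem_filter, not_not]; tauto
      have hsub : ({e1, e2} : Finset E) ⊆ L.filter (b · = b e1) := by
        intro e he
        rw [mem_insert, mem_singleton] at he
        rw [mem_filter]
        rcases he with rfl | rfl
        exacts [⟨h1, rfl⟩, ⟨h2, hb.symm⟩]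
      have hcb := h.col (b e1) hb1
      by_cases hq : b e1 = q0
      · rw [if_pos hq] at hcb
        have heq : ({e1, e2} : Finset E) = L.filter (b · = b e1) :=
          eq_of_subset_of_card_le hsub (by rw [hcb, card_pair hne])
        have := hfull (b := b) (L := L.filter (b · ≠ b e1)) (P := P.erase p0)
          (Q := Q.erase (b e1)) ⟨hmem, fun p hp => ?_, fun q hq' => ?_, hcP, hcQ⟩
        · omega
        · rw [mem_erase] at hp
          have hr := hrow p
          have h0 : ({e1, e2} : Finset E).filter (a · = p) = ∅ := by
            rw [filter_eq_empty_iff]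
            intro e he
            rw [mem_insert, mem_singleton] at he
            rcases he with rfl | rfl
            · rw [ha1]; exact Ne.symm hp.1
            · rw [ha2]; exact Ne.symm hp.1
          rw [h.row p hp.2, if_neg hp.1, ← heq, h0, card_empty] at hr
          exact hr
        · rw [mem_erase] at hq'
          rw [hcol q hq'.1, h.col q hq'.2, if_neg (by rw [← hq]; exact hq'.1)]
      · rw [if_neg hq] at hcb
        have hsd : ((L.filter (b · = b e1)) \ {e1, e2}).card = 1 := by
          rw [card_sdiff_of_subset hsub, hcb, card_pair hne]
        obtain ⟨e3, he3⟩ := card_eq_one.mp hsd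
        have hm3 : e3 ∈ (L.filter (b · = b e1)) \ {e1, e2} := by rw [he3]; simp
        rw [mem_sdiff, mem_filter] at hm3
        have hcolmem : ∀ e, e ∈ L.filter (b · = b e1) ↔ e = e1 ∨ e = e2 ∨ e = e3 := by
          intro e
          rw [← sdiff_union_of_subset hsub, he3]
          simp only [mem_union, mem_insert, mem_singleton]; tauto
        have ha3 : a e3 ≠ p0 := by
          intro hae
          exact hm3.2 (by simpa using (hp0 e3 hm3.1.1).mp hae)
        have := ih (a := a) (b := b) (L := L.filter (b · ≠ b e1)) (P := P.erase p0)
          (Q := Q.erase (b e1)) (p0 := a e3) (q0 := q0) ⟨hmem,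
            mem_erase.mpr ⟨ha3, (h.mem e3 hm3.1.1).1⟩, mem_erase.mpr ⟨Ne.symm hq, h.mem_col⟩,
            fun p hp => ?_, fun q hq' => ?_, hcP, hcQ⟩
        · omega
        · rw [mem_erase] at hp
          have hr := hrow p
          have hf3 : (L.filter (b · = b e1)).filter (a · = p) =
              if p = a e3 then {e3} else ∅ := by
            ext e
            rw [mem_filter, hcolmem]
            split_ifs with hpe
            · rw [mem_singleton]
              constructor
              · rintro ⟨rfl | rfl | rfl, h'⟩
                · exact absurd (h'.symm.trans ha1) hp.1
                · exact absurd (h'.symm.trans ha2) hp.1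
                · rfl
              · rintro rfl; exact ⟨Or.inr (Or.inr rfl), hpe.symm⟩
            · simp only [notMem_empty, iff_false]
              rintro ⟨rfl | rfl | rfl, h'⟩
              · exact absurd (h'.symm.trans ha1) hp.1
              · exact absurd (h'.symm.trans ha2) hp.1
              · exact hpe h'.symm
          rw [h.row p hp.2, if_neg hp.1, hf3] at hr
          split_ifs at hr ⊢ with hpe
          · rw [card_singleton] at hr; omega
          · rw [card_empty] at hr; exact hr
        · rw [mem_erase] at hq'
          rw [hcol q hq'.1, h.col q hq'.2]
    · have hm := pms_merge (P := P) (Q := Q) hp0 h1 h2 hb hb1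
      set b' : E → κ := fun e => if b e = b e2 then b e1 else b e with hb'
      set L0 := (L.erase e1).erase e2 with hL0
      have he2' : e2 ∈ L.erase e1 := mem_erase.mpr ⟨Ne.symm hne, h2⟩
      have hcP : (P.erase p0).card = n + 1 := by
        rw [card_erase_of_mem h.mem_row, h.card_row]; omega
      have hcQ : (Q.erase (b e2)).card = n + 1 := by
        rw [card_erase_of_mem hb2, h.card_col]; omega
      have hmemL : ∀ e ∈ L0, e ∈ L ∧ a e ≠ p0 := by
        intro e he
        rw [hL0, mem_erase, mem_erase] at he
        refine ⟨he.2.2, fun hae => ?_⟩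
        rcases (hp0 e he.2.2).mp hae with h' | h'
        exacts [he.2.1 h', he.1 h']
      have hmem : ∀ e ∈ L0, a e ∈ P.erase p0 ∧ b' e ∈ Q.erase (b e2) := by
        intro e he
        obtain ⟨m0, m3⟩ := hmemL e he
        obtain ⟨m1, m2⟩ := h.mem e m0
        refine ⟨mem_erase.mpr ⟨m3, m1⟩, ?_⟩
        simp only [hb']
        split_ifs with hh
        · exact mem_erase.mpr ⟨hb, hb1⟩
        · exact mem_erase.mpr ⟨hh, m2⟩
      have hrow : ∀ p ∈ P.erase p0, (L0.filter (a · = p)).card = 3 := by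
        intro p hp
        rw [mem_erase] at hp
        have k1 := card_erase_filter (f := a) h1 p
        have k2 := card_erase_filter (f := a) he2' p
        rw [ha1, if_neg (Ne.symm hp.1)] at k1
        rw [ha2, if_neg (Ne.symm hp.1)] at k2
        rw [h.row p hp.2, if_neg hp.1] at k1
        rw [hL0]; omega
      have hcol0 : ∀ q, (L0.filter (b · = q)).card + ((if b e1 = q then 1 else 0) +
          if b e2 = q then 1 else 0) = (L.filter (b · = q)).card := by
        intro q
        have k1 := card_erase_filter (f := b) h1 q
        have k2 := card_erase_filter (f := b) he2' q
        rw [hL0]; omega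
      have hcolo : ∀ q ∈ Q, q ≠ b e1 → q ≠ b e2 → (L0.filter (b' · = q)).card =
          if q = q0 then 2 else 3 := by
        intro q hq hq1 hq2
        have := hcol0 q
        rw [if_neg (Ne.symm hq1), if_neg (Ne.symm hq2), h.col q hq] at this
        rw [← this, add_zero, add_zero]
        congr 1; ext e; simp only [mem_filter, hb']
        by_cases hh : b e = b e2
        · rw [if_pos hh, hh]; simp only [hq1.symm, hq2.symm]
        · rw [if_neg hh]
      have hcol1 : (L0.filter (b' · = b e1)).card + 2 =
          (L.filter (b · = b e1)).card + (L.filter (b · = b e2)).card := by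
        have k1 := hcol0 (b e1)
        have k2 := hcol0 (b e2)
        rw [if_pos rfl, if_neg (Ne.symm hb)] at k1
        rw [if_neg hb, if_pos rfl] at k2
        rw [← k1, ← k2]
        have : L0.filter (b' · = b e1) = L0.filter (b · = b e1) ∪ L0.filter (b · = b e2) := by
          ext e; simp only [mem_filter, mem_union, hb']
          by_cases hh : b e = b e2
          · rw [if_pos hh]; simp only [hh]; tauto
          · rw [if_neg hh]; simp [hh]
        rw [this, card_union_of_disjoint]
        · omega
        · rw [disjoint_left]; intro e x y
          rw [mem_filter] at x y
          exact hb (x.2.symm.trans y.2)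
      rw [h.col _ hb1, h.col _ hb2] at hcol1
      by_cases hq : b e1 = q0 ∨ b e2 = q0
      · have hc3 : (L0.filter (b' · = b e1)).card = 3 := by
          rcases hq with hq | hq
          · rw [if_pos hq, if_neg (by rw [← hq]; exact Ne.symm hb)] at hcol1; omega
          · rw [if_pos hq, if_neg (by rw [← hq]; exact hb)] at hcol1; omega
        have := hfull (b := b') (L := L0) (P := P.erase p0) (Q := Q.erase (b e2))
          ⟨hmem, hrow, fun q hq' => ?_, hcP, hcQ⟩
        · omega
        · rw [mem_erase] at hq'
          by_cases hqe : q = b e1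
          · rw [hqe, hc3]
          · rw [hcolo q hq'.2 hqe hq'.1, if_neg]
            rintro rfl
            rcases hq with hq | hq
            exacts [hqe hq.symm, hq'.1 hq.symm]
      · push Not at hq
        rw [if_neg hq.1, if_neg hq.2] at hcol1
        have hb1' : b e1 ∈ Q.erase (b e2) := mem_erase.mpr ⟨hb, hb1⟩
        have key := sum_pms_erase (a := b') (b := a) (L := L0) (P := Q.erase (b e2))
          (Q := P.erase p0) hb1'
        have hlow : (L0.filter (b' · = b e1)).card * vg n ≤
            ∑ e ∈ L0.filter (b' · = b e1),
              (pms b' a (L0.erase e) (Q.erase (b e2)) (P.erase p0)).card := by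
          rw [← smul_eq_mul]
          refine card_nsmul_le_sum _ _ _ fun e he => ?_
          rw [mem_filter] at he
          rw [pms_swap]
          refine ih (p0 := a e) (q0 := q0) ⟨fun f hf => hmem f (mem_of_mem_erase hf),
            (hmem e he.1).1, mem_erase.mpr ⟨Ne.symm hq.2, h.mem_col⟩, fun p hp => ?_,
            fun q hq' => ?_, hcP, hcQ⟩
          · have := card_erase_filter (f := a) he.1 p
            rw [hrow p hp] at this
            by_cases hpp : p = a e
            · rw [if_pos hpp.symm] at this; rw [if_pos hpp]; omega
            · rw [if_neg (Ne.symm hpp)] at this; rw [if_neg hpp]; omega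
          · have := card_erase_filter (f := b') he.1 q
            rw [mem_erase] at hq'
            by_cases hqe : q = b e1
            · rw [hqe, if_pos he.2] at this
              rw [hqe, if_neg hq.1]; omega
            · rw [he.2, if_neg (Ne.symm hqe), hcolo q hq'.2 hqe hq'.1] at this
              exact this
        rw [pms_swap, show (L0.filter (b' · = b e1)).card = 4 by omega] at key
        rw [show (L0.filter (b' · = b e1)).card = 4 by omega] at hlow
        have hsw : (pms b' a L0 (Q.erase (b e2)) (P.erase p0)) =
          pms a b' L0 (P.erase p0) (Q.erase (b e2)) := pms_swap
        omega

end Bpm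

namespace Gr

open Finset Bpm

variable {V E : Type} [Fintype V] [Fintype E] {G : Gr V E}

lemma two_mul_le_vg (n : ℕ) : 2 * n ≤ vg n := by
  induction n with
  | zero => simp [vg]
  | succ n ih =>
    rw [vg]
    rcases n with _ | _ | _ | n
    · simp [vg]
    · simp [vg]
    · simp [vg]
    · omega

lemma three_mul_le_vg (n : ℕ) : 3 * n ≤ vg n + 4 := by
  induction n with
  | zero => simp [vg]
  | succ n ih =>
    rw [vg]
    rcases n with _ | _ | _ | _ | _ | n
    · simp [vg]
    · simp [vg]
    · simp [vg]
    · simp [vg]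
    · simp [vg]
    · omega

lemma BipOn.card_univ (hG : G.Cubic) {P : Finset V} (hP : G.BipOn univ P) :
    2 * P.card = Fintype.card V := by
  have h1 := hP.class_card hG
  have h2 := hG.sum univ
  rw [d, cut_univ, card_empty, Finset.card_univ] at h2
  rw [cut_univ, filter_empty, card_empty, univ_inter] at h1
  omega

/-- Voorhoeve's bound. -/
theorem BipOn.count_ge (hG : G.Cubic) {P : Finset V} (hP : G.BipOn univ P) {n : ℕ}
    (hn : Fintype.card V = 2 * (n + 1)) : 3 * vg n ≤ 2 * G.count ∅ := by
  have hc := hP.card_univ hG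
  have hl : ∀ {e}, e ∈ G.ins univ ↔ G.a e ≠ G.b e := by intro e; simp [mem_ins]
  have hPl : ∀ {e}, G.a e ≠ G.b e → ¬ (G.a e ∈ P ↔ G.b e ∈ P) := fun {e} h =>
    hP e (mem_univ _) (mem_univ _) h
  set a' : E → V := fun e => if G.a e ∈ P then G.a e else G.b e with ha'
  set b' : E → V := fun e => if G.a e ∈ P then G.b e else G.a e with hb'
  have hrow : ∀ p ∈ P, ∀ e, (e ∈ G.ins univ ∧ a' e = p) ↔ e ∈ G.cut {p} := by
    intro p hp e
    rw [hl, mem_star]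
    constructor
    · rintro ⟨h1, h2⟩
      have := hPl h1
      simp only [ha'] at h2
      split_ifs at h2 with h3
      · intro h; exact h1 (h2.trans (h.mp h2).symm)
      · intro h; exact h1 ((h.mpr h2).trans h2.symm)
    · intro h
      have h1 : G.a e ≠ G.b e := by intro h'; rw [h'] at h; exact h Iff.rfl
      have := hPl h1
      refine ⟨h1, ?_⟩
      simp only [ha']
      by_cases h3 : G.a e = p
      · rw [if_pos (h3 ▸ hp), h3]
      · have h4 : G.b e = p := by tauto
        rw [if_neg, h4]
        rw [h4] at this; tauto
  have hcol : ∀ q ∈ Pᶜ, ∀ e, (e ∈ G.ins univ ∧ b' e = q) ↔ e ∈ G.cut {q} := by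
    intro p hp e
    rw [mem_compl] at hp
    rw [hl, mem_star]
    constructor
    · rintro ⟨h1, h2⟩
      have := hPl h1
      simp only [hb'] at h2
      split_ifs at h2 with h3
      · intro h; exact h1 ((h.mpr h2).trans h2.symm)
      · intro h; exact h1 (h2.trans (h.mp h2).symm)
    · intro h
      have h1 : G.a e ≠ G.b e := by intro h'; rw [h'] at h; exact h Iff.rfl
      have := hPl h1
      refine ⟨h1, ?_⟩
      simp only [hb']
      by_cases h3 : G.a e = p
      · rw [if_neg (h3 ▸ hp), h3]
      · have h4 : G.b e = p := by tauto
        rw [if_pos, h4]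
        rw [h4] at this; tauto
  have hfull : Full a' b' (G.ins univ) P Pᶜ (n + 1) := by
    refine ⟨fun e he => ?_, fun p hp => ?_, fun q hq => ?_, by omega, ?_⟩
    · have := hPl (hl.mp he)
      simp only [ha', hb', mem_compl]
      split_ifs with h <;> tauto
    · rw [← hG p, d]; congr 1; ext e; rw [mem_filter]; exact hrow p hp e
    · rw [← hG q, d]; congr 1; ext e; rw [mem_filter]; exact hcol q hq e
    · rw [card_compl]; omega
  have h1 := hfull.bound (by omega) fun L p0 q0 h => h.bound
  refine h1.trans (Nat.mul_le_mul_left 2 (card_le_card fun F hF => ?_))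
  rw [mem_pms] at hF
  rw [mem_part]
  refine ⟨fun e he => mem_union_right _ (hF.1 he), by rw [cut_univ, inter_empty], fun v _ => ?_⟩
  left
  by_cases hv : v ∈ P
  · rw [← hF.2.1 v hv]; congr 1; ext e
    rw [mem_inter, mem_filter, ← hrow v hv]
    exact ⟨fun h => ⟨h.1, h.2.2⟩, fun h => ⟨h.1, hF.1 h.1, h.2⟩⟩
  · rw [← hF.2.2 v (mem_compl.mpr hv)]; congr 1; ext e
    rw [mem_inter, mem_filter, ← hcol v (mem_compl.mpr hv)]
    exact ⟨fun h => ⟨h.1, h.2.2⟩, fun h => ⟨h.1, hF.1 h.1, h.2⟩⟩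

lemma count_mono {S T : Finset V} (h : S ⊆ T) : G.count S ≤ G.count T := N_mono h

lemma Bip.exists_count_ge (hG : G.Cubic) [Nonempty V] (hb : G.Bip univ) (S : Finset V) :
    ∃ n, Fintype.card V = 2 * (n + 1) ∧ 3 * vg n ≤ 2 * G.count S := by
  obtain ⟨P, hP⟩ := hb
  have := hP.card_univ hG
  have h0 : 0 < Fintype.card V := Fintype.card_pos
  refine ⟨P.card - 1, by omega, ?_⟩
  have h1 := hP.count_ge hG (n := P.card - 1) (by omega)
  have h2 := count_mono (G := G) (empty_subset S)
  omega

/-- Equality in submodularity when no link joins the two differences. -/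
lemma d_union_inter_ge {X Y : Finset V}
    (h : ∀ e, ¬ (G.a e ∈ X \ Y ∧ G.b e ∈ Y \ X) ∧ ¬ (G.b e ∈ X \ Y ∧ G.a e ∈ Y \ X)) :
    G.d X + G.d Y ≤ G.d (X ∪ Y) + G.d (X ∩ Y) := by
  simp only [d_eq_sum, ← sum_add_distrib]
  refine sum_le_sum fun e _ => ?_
  have := h e
  by_cases h1 : G.a e ∈ X <;> by_cases h2 : G.b e ∈ X <;> by_cases h3 : G.a e ∈ Y <;>
    by_cases h4 : G.b e ∈ Y <;> simp_all

lemma not_bip_four (hG : G.Cubic) (h3 : G.EC3) (hn : Fintype.card V = 4) : ¬ G.Bip univ := by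
  rintro ⟨P, hP⟩
  have hc := hP.card_univ hG
  have hcc := card_compl P
  obtain ⟨p, p', hpp, hPe⟩ := card_eq_two.mp (show P.card = 2 by omega)
  obtain ⟨q, q', hqq, hQe⟩ := card_eq_two.mp (show Pᶜ.card = 2 by omega)
  have hp : p ∈ P := by rw [hPe]; simp
  have hp' : p' ∈ P := by rw [hPe]; simp
  have hq : q ∉ P := by rw [← mem_compl, hQe]; simp
  have hq' : q' ∉ P := by rw [← mem_compl, hQe]; simp
  have hpq : p ≠ q := fun h => hq (h ▸ hp)
  have hpq' : p ≠ q' := fun h => hq' (h ▸ hp)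
  have hp'q : p' ≠ q := fun h => hq (h ▸ hp')
  have hp'q' : p' ≠ q' := fun h => hq' (h ▸ hp')
  have h1 := d_union_inter_ge (G := G) (X := {p, q}) (Y := {p, q'}) (by
    intro e
    simp only [mem_sdiff, mem_insert, mem_singleton, not_or]
    have hb : G.a e ≠ G.b e → ¬ (G.a e ∈ P ↔ G.b e ∈ P) := hP e (mem_univ _) (mem_univ _)
    constructor
    · rintro ⟨⟨h1, h2, -⟩, h3, h4, -⟩
      have e1 : G.a e = q := by tauto
      have e2 : G.b e = q' := by tauto
      rw [e1, e2] at hb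
      have := hb hqq; tauto
    · rintro ⟨⟨h1, h2, -⟩, h3, h4, -⟩
      have e1 : G.b e = q := by tauto
      have e2 : G.a e = q' := by tauto
      rw [e1, e2] at hb
      have := hb hqq.symm; tauto)
  have e1 : ({p, q} ∪ {p, q'} : Finset V) = {p'}ᶜ := by
    ext x
    have : x ∈ P ∨ x ∈ Pᶜ := by rw [mem_compl]; tauto
    rw [hQe, hPe] at this
    simp only [mem_insert, mem_singleton] at this
    simp only [mem_union, mem_insert, mem_singleton, mem_compl]
    constructor
    · rintro ((h | h) | (h | h)) <;> rw [h] <;> first | exact hpp | exact hp'q.symm | exact hp'q'.symm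
    · tauto
  have e2 : ({p, q} ∩ {p, q'} : Finset V) = {p} := by
    ext x
    simp only [mem_inter, mem_insert, mem_singleton]
    constructor
    · rintro ⟨h | h, h' | h'⟩
      · exact h
      · exact h
      · exact h'
      · exact absurd (h.symm.trans h') hqq
    · exact fun h => ⟨Or.inl h, Or.inl h⟩
  rw [e1, e2, d_compl, hG, hG] at h1
  have hle : ∀ z, z ≠ p → 4 ≤ G.d {p, z} := by
    intro z hz
    have hc2 : ({p, z} : Finset V).card = 2 := card_pair hz.symm
    have k1 := h3 {p, z} ⟨p, by simp⟩ (by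
      intro h; rw [h, Finset.card_univ] at hc2; omega)
    have k2 := hG.parity {p, z}
    omega
  have := hle q hpq.symm
  have := hle q' hpq'.symm
  omega

lemma sum_glue_ge {𝒞 : Finset E} (hc : 𝒞.card = 3) {l r : E → ℕ} (hl : ∀ g ∈ 𝒞, 2 ≤ l g)
    (hr : ∀ g ∈ 𝒞, 1 ≤ r g) :
    ∑ g ∈ 𝒞, l g + 2 * ∑ g ∈ 𝒞, r g ≤ ∑ g ∈ 𝒞, l g * r g + 6 := by
  have : ∑ g ∈ 𝒞, (l g + 2 * r g) ≤ ∑ g ∈ 𝒞, (l g * r g + 2) := by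
    refine sum_le_sum fun g hg => ?_
    have h1 := hl g hg; have h2 := hr g hg
    nlinarith
  rw [sum_add_distrib, sum_add_distrib, sum_const, hc, ← mul_sum] at this
  simpa using this

lemma sum_glue_ge' {𝒞 : Finset E} (hc : 𝒞.card = 3) {l r : E → ℕ} (hl : ∀ g ∈ 𝒞, 1 ≤ l g)
    (hr : ∀ g ∈ 𝒞, 1 ≤ r g) :
    ∑ g ∈ 𝒞, l g + ∑ g ∈ 𝒞, r g ≤ ∑ g ∈ 𝒞, l g * r g + 3 := by
  have : ∑ g ∈ 𝒞, (l g + r g) ≤ ∑ g ∈ 𝒞, (l g * r g + 1) := by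
    refine sum_le_sum fun g hg => ?_
    have h1 := hl g hg; have h2 := hr g hg
    nlinarith
  rw [sum_add_distrib, sum_add_distrib, sum_const, hc] at this
  simpa using this

lemma glue_three {A : Finset V} (hA : G.d A = 3)
    (S : Finset V) :
    ∑ g ∈ G.cut A, G.N A S {g} * G.N Aᶜ S {g} + G.N A S (G.cut A) * G.N Aᶜ S (G.cut A) ≤
      G.count S := by
  refine le_trans (le_of_eq ?_) (glue A S (insert (G.cut A) ((G.cut A).image fun g => {g})))
  rw [sum_insert, sum_image, add_comm]
  · intro x _ y _ h; exact singleton_injective h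
  · intro h
    obtain ⟨g, -, h⟩ := mem_image.mp h
    have h1 := congrArg card h
    rw [card_singleton] at h1
    rw [d] at hA; omega

/-- The conclusion of the linear bound for 3-edge-connected cubic graphs. -/
def CLBound (n s c : ℕ) : Prop :=
  n + 2 * s + 2 ≤ 2 * c + 12 ∧ n + 2 * s + 4 ≤ 4 * c ∧ (4 ≤ c ∨ (n = 4 ∧ s = 0)) ∧ 3 ≤ c

lemma clBound_of_C4 (hG : G.Cubic) (h4 : G.C4) (hn : 4 ≤ Fintype.card V) (S : Finset V) :
    CLBound (Fintype.card V) S.card (G.count S) := by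
  have hev := hG.even
  have hs := card_le_univ S
  by_cases hb : G.Bip univ
  · have : Nonempty V := Fintype.card_pos_iff.mp (by omega)
    obtain ⟨m, hm, hc⟩ := hb.exists_count_ge hG S
    have h2 := two_mul_le_vg m
    have h3 : m = 1 → vg m = 3 := by rintro rfl; simp [vg]
    refine ⟨?_, ?_, ?_, ?_⟩ <;> by_cases m = 1 <;> omega
  · have := count_ge_of_C4_nonbip hG h4 hn hb S
    refine ⟨?_, ?_, ?_, ?_⟩ <;> omega

/-- The linear bound for all 3-edge-connected cubic graphs. -/
theorem clBound (k : ℕ) : ∀ {V : Type} [Fintype V] {G : Gr V E}, G.Cubic → G.EC3 →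
    4 ≤ Fintype.card V → Fintype.card V ≤ k → ∀ S : Finset V,
    CLBound (Fintype.card V) S.card (G.count S) := by
  induction k with
  | zero => intro V _ G _ _ h1 h2; omega
  | succ k ih =>
    intro V _ G hG h3 hn hk S
    have hev := hG.even
    by_cases h4 : G.C4
    · exact clBound_of_C4 hG h4 hn S
    have hex : ∃ m, ∃ D : Finset V, D.card = m ∧ G.d D = 3 ∧ 2 ≤ D.card ∧ 2 ≤ Dᶜ.card := by
      by_contra hcon
      push Not at hcon
      refine h4 fun X h1 h2 => ⟨h3 X h1 h2, fun hd => ?_⟩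
      by_contra hX
      have k1 := card_pos.mpr h1
      have k2 : 0 < Xᶜ.card := by
        rw [card_pos, nonempty_iff_ne_empty]; intro h
        rw [compl_eq_empty_iff] at h; exact h2 h
      have := hcon _ X rfl hd (by omega)
      omega
    obtain ⟨D, hDm, hd, hD2, hDc2⟩ := Nat.find_spec hex
    have hmin : ∀ C : Finset V, G.d C = 3 → 2 ≤ C.card → 2 ≤ Cᶜ.card → D.card ≤ C.card := by
      intro C h1 h2 h3
      rw [hDm]; exact Nat.find_min' hex ⟨C, rfl, h1, h2, h3⟩
    have hpar := hG.parity D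
    have hcc := card_add_card_compl D
    have hdc : G.d Dᶜ = 3 := by rw [d_compl, hd]
    have hDne : D.Nonempty := card_pos.mp (by omega)
    have hDcne : Dᶜ.Nonempty := card_pos.mp (by omega)
    have hLG := con_cubic hG hd
    have hRG := con_cubic hG hdc
    have hL3 := con_EC3 h3 hDcne
    have hR3 := con_EC3 h3 (A := Dᶜ) (by rwa [compl_compl])
    have hL4 : (G.con D).C4 := by
      have main : ∀ Y : Finset (Con D), Con.pt ∉ Y → Y.Nonempty → (G.con D).d Y = 3 →
          Y.card = 1 ∨ Yᶜ.card = 1 := by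
        intro Y hp hY hYd
        rw [con_d] at hYd
        obtain ⟨k1, k2⟩ := card_pre_of_notMem hp
        have k3 := card_pos.mpr hY
        by_contra hcon
        have k4 := card_le_card (compl_subset_compl.mpr k2)
        have k5 := hmin _ hYd (by omega) (by omega)
        have k6 := card_compl Y
        rw [card_con] at k6
        have k7 := card_le_card k2
        omega
      intro Y h1 h2
      refine ⟨hL3 Y h1 h2, fun hY => ?_⟩
      by_cases hp : Con.pt ∈ Y
      · have := main Yᶜ (by simpa using hp) (by
          rw [nonempty_iff_ne_empty]; intro h
          rw [compl_eq_empty_iff] at h; exact h2 h) (by rw [d_compl, hY])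
        rw [compl_compl] at this; tauto
      · exact main Y hp h1 hY
    have hlge : ∀ g ∈ G.cut D, 1 ≤ G.N D S {g} := fun g hg =>
      (one_le_N_three hG h3 hd hg).trans (N_mono (empty_subset S))
    have hrge : ∀ g ∈ G.cut D, 1 ≤ G.N Dᶜ S {g} := fun g hg =>
      (one_le_N_three hG h3 hdc (by rwa [cut_compl])).trans (N_mono (empty_subset S))
    have hglue := glue_three hd S
    have hcL := count_con (S := S) (b := False) hd
    have hcR := count_con (S := S) (b := False) hdc
    have hcR' := count_con (S := S) (b := True) hdc
    have hsL := card_lft D S False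
    have hsR := card_lft Dᶜ S False
    have hsR' := card_lft Dᶜ S True
    rw [if_neg id, add_zero] at hcL hcR hsL hsR
    rw [if_pos trivial] at hcR' hsR'
    rw [cut_compl] at hcR hcR'
    have hSS : (D ∩ S).card + (Dᶜ ∩ S).card = S.card := by
      rw [← card_union_of_disjoint, ← union_inter_distrib_right, union_compl, univ_inter]
      exact disjoint_of_subset_left inter_subset_left
        (disjoint_of_subset_right inter_subset_left disjoint_compl_right)
    have hSD := card_le_card (inter_subset_left (s₁ := D) (s₂ := S))
    have hnL := card_con D
    have hnR := card_con Dᶜ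
    by_cases h5 : D.card = 3
    · have hLb := not_bip_four hLG hL3 (by omega)
      have k1 := count_ge_of_C4_nonbip hLG hL4 (by omega) hLb (lft D S False)
      have k2 : 1 ≤ G.N D S (G.cut D) := by
        have hinj := inn_inj_three h3 hG hD2 hd.le
        have hp := card_peel (Subset.refl (G.cut D)) hinj
        have hpe : G.peel D (G.cut D) = ∅ := by
          rw [← card_eq_zero]; rw [d] at hd; omega
        have hF := isPart_of_peel (F := ∅) (Subset.refl (G.cut D)) hinj (by
          rw [hpe]; refine ⟨by simp, by simp, by simp⟩)
        exact (N_pos hF).trans (N_mono (empty_subset S))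
      have k3 := sum_glue_ge' hd hlge hrge
      obtain ⟨i1, i2, i3, i4⟩ := ih hRG hR3 (by omega) (by omega) (lft Dᶜ S True)
      have k4 : G.N Dᶜ S (G.cut D) ≤ G.N D S (G.cut D) * G.N Dᶜ S (G.cut D) :=
        Nat.le_mul_of_pos_left _ k2
      refine ⟨?_, ?_, ?_, ?_⟩ <;> omega
    · have hl2 : ∀ g ∈ G.cut D, 2 ≤ G.N D S {g} := by
        intro g hg
        have hZ : {g} ⊆ G.cut D := by simpa using hg
        have hinj : Set.InjOn (G.inn D) (({g} : Finset E) : Set E) := by simp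
        have hp1 := card_peel hZ hinj
        have hp2 := d_peel_le hG hZ
        rw [card_singleton] at hp1 hp2
        have hsub : G.peel D {g} ⊆ D := sdiff_subset
        have hp3 := h3 (G.peel D {g}) (card_pos.mp (by omega)) (by
          intro h; have := card_le_card hsub; rw [h, Finset.card_univ] at this; omega)
        have hp4 := hG.parity (G.peel D {g})
        obtain ⟨F, F', hF, hF', hne⟩ := two_pm hG h3 (X := G.peel D {g}) (by omega) (by omega) (by
          intro C hC hCd hCo
          by_contra hC1
          have m1 := card_le_card hC
          have m2 := card_le_card (compl_subset_compl.mpr (hC.trans hsub))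
          have := hmin C hCd (by omega) (by omega)
          omega)
        refine le_trans (two_le_N (isPart_of_peel hZ hinj hF) (isPart_of_peel hZ hinj hF') ?_)
          (N_mono (empty_subset S))
        intro h
        have d1 := peel_part_disj hZ hF
        have d2 := peel_part_disj hZ hF'
        apply hne
        rw [← union_sdiff_cancel_right d1, h, union_sdiff_cancel_right d2]
      have k3 := sum_glue_ge hd hl2 hrge
      obtain ⟨i1, i2, i3, i4⟩ := ih hRG hR3 (by omega) (by omega) (lft Dᶜ S False)
      by_cases hLb : (G.con D).Bip univ
      · have : Nonempty (Con D) := ⟨Con.pt⟩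
        obtain ⟨m, hm, hc⟩ := hLb.exists_count_ge hLG (lft D S False)
        have h2 := two_mul_le_vg m
        refine ⟨?_, ?_, ?_, ?_⟩ <;> omega
      · have k1 := count_ge_of_C4_nonbip hLG hL4 (by omega) hLb (lft D S False)
        refine ⟨?_, ?_, ?_, ?_⟩ <;> omega

/-- The edges of the cut of `A` which also leave `D`. -/
lemma d_split {A D : Finset V} : G.d D = (G.cut D \ G.cut A).card + (G.cut A ∩ G.cut D).card := by
  rw [inter_comm, add_comm, card_inter_add_card_sdiff, d]

lemma mem_cut_iff_inn {A D : Finset V} (hD : D ⊆ A) {e : E} (he : e ∈ G.cut A) :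
    e ∈ G.cut D ↔ G.inn A e ∈ D := by
  rw [mem_cut] at he ⊢
  unfold inn
  have h1 := @hD (G.a e); have h2 := @hD (G.b e)
  split_ifs with h <;> tauto

lemma cut_sdiff_of_subset {A D : Finset V} (hD : D ⊆ A) :
    G.cut (A \ D) \ G.cut A = G.cut D \ G.cut A := by
  ext e
  have h1 := @hD (G.a e); have h2 := @hD (G.b e)
  simp only [mem_sdiff, mem_cut]; tauto

lemma cut_inter_sdiff {A D : Finset V} (hD : D ⊆ A) :
    G.cut A ∩ G.cut (A \ D) = G.cut A \ G.cut D := by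
  ext e
  have h1 := @hD (G.a e); have h2 := @hD (G.b e)
  simp only [mem_sdiff, mem_inter, mem_cut]; tauto

/-- Inside a large set with a cut of size four, a proper part is joined to the rest twice. -/
lemma two_le_inner (hG : G.Cubic) (h4 : G.C4) {A D : Finset V} (hA : 4 ≤ A.card)
    (hAc : 2 ≤ Aᶜ.card) (hd : G.d A = 4) (hD : D ⊆ A) (h0 : D.Nonempty) (h1 : D ≠ A) :
    2 ≤ (G.cut D \ G.cut A).card := by
  have hne : ∀ X ⊆ A, X ≠ univ := by
    rintro X hX rfl
    have h2 := card_le_card (compl_subset_compl.mpr hX)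
    rw [compl_univ, card_empty] at h2; omega
  have hD' : A \ D ⊆ A := sdiff_subset
  have h0' : (A \ D).Nonempty := by
    rw [sdiff_nonempty]; intro h; exact h1 (subset_antisymm hD h)
  have e1 := d_split (G := G) (A := A) (D := D)
  have e2 := d_split (G := G) (A := A) (D := A \ D)
  rw [cut_sdiff_of_subset hD, cut_inter_sdiff hD] at e2
  have e3 := card_inter_add_card_sdiff (G.cut A) (G.cut D)
  have e4 : (G.cut A).card = 4 := hd
  have e5 := card_sdiff_add_card_eq_card hD
  have c1 := h4 D h0 (hne _ hD)
  have c2 := h4 _ h0' (hne _ hD')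
  have k1 := card_le_card (compl_subset_compl.mpr hD)
  have k2 := card_le_card (compl_subset_compl.mpr hD')
  have p1 := hG.parity D
  have p2 := hG.parity (A \ D)
  have p3 := hG.parity A
  omega

variable (G) in
/-- `A` splits into two parts joined by two edges, one part containing the inner ends of `I`. -/
def Split (A : Finset V) (I : Finset E) : Prop :=
  ∃ D ⊆ A, G.d D = 4 ∧ G.cut A ∩ G.cut D = I

lemma Split.compl {A : Finset V} {I : Finset E} (hd : G.d A = 4) (h : G.Split A I)
    (hI : I.card = 2) : G.Split A (G.cut A \ I) := by
  obtain ⟨D, hD, hdD, rfl⟩ := h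
  have e1 := d_split (G := G) (A := A) (D := D)
  have e2 := d_split (G := G) (A := A) (D := A \ D)
  rw [cut_sdiff_of_subset hD, cut_inter_sdiff hD] at e2
  have e3 := card_inter_add_card_sdiff (G.cut A) (G.cut D)
  have e4 : (G.cut A).card = 4 := hd
  refine ⟨A \ D, sdiff_subset, by omega, ?_⟩
  rw [cut_inter_sdiff hD, sdiff_inter_self_left]

/-- The vertices of `A` together with two further points. -/
inductive Cap (A : Finset V) : Type
  | inn (x : V) (h : x ∈ A)
  | lo
  | hi

def Cap.equiv (A : Finset V) : Option (Option A) ≃ Cap A where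
  toFun := fun o => match o with
    | some (some x) => .inn x.1 x.2
    | some none => .lo
    | none => .hi
  invFun := fun c => match c with
    | .inn x h => some (some ⟨x, h⟩)
    | .lo => some none
    | .hi => none
  left_inv := by rintro (_ | _ | ⟨x, h⟩) <;> rfl
  right_inv := by rintro (⟨x, h⟩ | _ | _) <;> rfl

instance (A : Finset V) : Fintype (Cap A) := Fintype.ofEquiv _ (Cap.equiv A)

lemma card_cap (A : Finset V) : Fintype.card (Cap A) = A.card + 2 := by
  rw [← Fintype.card_congr (Cap.equiv A), Fintype.card_option, Fintype.card_option,
    Fintype.card_coe]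

/-- Vertices outside `A` are sent to one of the two further points, according to `c`. -/
def toCap (A : Finset V) (c : Prop) (x : V) : Cap A :=
  if h : x ∈ A then .inn x h else if c then .lo else .hi

variable (G) in
/-- The complement of `A` is replaced by two vertices joined by the edge `o`, the first being
incident with the cut edges in `I`, the second with the remaining ones. -/
def cap (A : Finset V) (I : Finset E) (o : E) : Gr (Cap A) E :=
  ⟨fun e => toCap A (e ∈ I ∨ e = o) (G.a e), fun e => toCap A (e ∈ I) (G.b e)⟩

/-- The vertices of `A` in a vertex set of the capped graph. -/
def core {A : Finset V} (Y : Finset (Cap A)) : Finset V :=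
  univ.filter fun x => ∃ h : x ∈ A, Cap.inn x h ∈ Y

lemma mem_core {A : Finset V} {Y : Finset (Cap A)} {x : V} :
    x ∈ core Y ↔ ∃ h : x ∈ A, Cap.inn x h ∈ Y := by simp [core]

lemma core_subset {A : Finset V} (Y : Finset (Cap A)) : core Y ⊆ A := by
  intro x hx; exact (mem_core.mp hx).1

lemma toCap_mem {A : Finset V} {c : Prop} {x : V} {Y : Finset (Cap A)} :
    toCap A c x ∈ Y ↔ x ∈ core Y ∨ x ∉ A ∧ (if c then Cap.lo else Cap.hi) ∈ Y := by
  unfold toCap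
  rw [mem_core]
  by_cases h : x ∈ A <;> simp [h]

lemma mem_cap_cut {A : Finset V} {I : Finset E} {o : E} (hI : I ⊆ G.cut A)
    (ho : G.a o ∉ A ∧ G.b o ∉ A) {Y : Finset (Cap A)} {e : E} :
    e ∈ (G.cap A I o).cut Y ↔
      (e ∈ G.cut (core Y) ∧ e ∉ G.cut A) ∨ (e = o ∧ ¬ (Cap.lo ∈ Y ↔ Cap.hi ∈ Y)) ∨
      (e ∈ G.cut A ∧ ¬ (e ∈ G.cut (core Y) ↔ if e ∈ I then Cap.lo ∈ Y else Cap.hi ∈ Y)) := by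
  have hs1 : G.a e ∈ core Y → G.a e ∈ A := fun h => core_subset Y h
  have hs2 : G.b e ∈ core Y → G.b e ∈ A := fun h => core_subset Y h
  have hI' := @hI e
  rw [mem_cut] at hI' ⊢
  simp only [cap, toCap_mem, mem_cut]
  by_cases heo : e = o
  · subst heo
    have : e ∉ I := fun h => by have := hI' h; tauto
    simp only [this, false_or, if_true, if_false]; grind
  · by_cases heI : e ∈ I
    · simp only [heI, heo, or_false, if_true]; grind
    · simp only [heI, heo, or_false, if_false]; grind

lemma cap_cut_of_notMem {A : Finset V} {I : Finset E} {o : E} (hI : I ⊆ G.cut A)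
    (ho : G.a o ∉ A ∧ G.b o ∉ A) {Y : Finset (Cap A)} (h1 : Cap.lo ∉ Y) (h2 : Cap.hi ∉ Y) :
    (G.cap A I o).cut Y = G.cut (core Y) := by
  ext e
  rw [mem_cap_cut hI ho]
  simp only [h1, h2, ite_self]; tauto

lemma cap_d_mixed {A : Finset V} {I : Finset E} {o : E} (hI : I ⊆ G.cut A)
    (ho : G.a o ∉ A ∧ G.b o ∉ A) {Y : Finset (Cap A)} (h1 : Cap.lo ∈ Y) (h2 : Cap.hi ∉ Y) :
    (G.cap A I o).d Y = 1 + (G.cut (core Y) \ G.cut A).card +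
      (I \ (G.cut A ∩ G.cut (core Y))).card + ((G.cut A ∩ G.cut (core Y)) \ I).card := by
  have hoc : o ∉ G.cut A := by rw [mem_cut]; tauto
  have hoc' : o ∉ G.cut (core Y) := by
    have hs1 : G.a o ∈ core Y → G.a o ∈ A := fun h => core_subset Y h
    have hs2 : G.b o ∈ core Y → G.b o ∈ A := fun h => core_subset Y h
    rw [mem_cut]; tauto
  have : (G.cap A I o).cut Y = {o} ∪ (G.cut (core Y) \ G.cut A) ∪
      (I \ (G.cut A ∩ G.cut (core Y))) ∪ ((G.cut A ∩ G.cut (core Y)) \ I) := by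
    ext e
    have := @hI e
    rw [mem_cap_cut hI ho]
    simp only [h1, h2, mem_union, mem_singleton, mem_sdiff, mem_inter]
    by_cases he : e ∈ I <;> simp only [he, if_true, if_false] <;> tauto
  rw [d, this, card_union_of_disjoint, card_union_of_disjoint, card_union_of_disjoint,
    card_singleton]
  · rw [disjoint_singleton_left]; simp [hoc']
  · rw [disjoint_left]; intro e he
    have := @hI e
    simp only [mem_union, mem_singleton, mem_sdiff, mem_inter] at *
    rcases he with rfl | he <;> tauto
  · rw [disjoint_left]; intro e he
    have := @hI e
    simp only [mem_union, mem_singleton, mem_sdiff, mem_inter] at *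
    rcases he with (rfl | he) | he <;> tauto

lemma card_core {A : Finset V} {Y : Finset (Cap A)} (h1 : Cap.lo ∉ Y) (h2 : Cap.hi ∉ Y) :
    (core Y).card = Y.card := by
  refine card_bij (fun x hx => Cap.inn x (mem_core.mp hx).1) (fun x hx => (mem_core.mp hx).2) ?_ ?_
  · intro x hx y hy hxy; simpa using hxy
  · intro y hy
    cases y with
    | inn z hz => exact ⟨z, mem_core.mpr ⟨hz, hy⟩, rfl⟩
    | lo => exact absurd hy h1
    | hi => exact absurd hy h2

/-- The cuts of the capped graph. -/
lemma cap_cuts (hG : G.Cubic) (h4 : G.C4) {A : Finset V} (hA : 4 ≤ A.card)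
    (hAc : 2 ≤ Aᶜ.card) (hd : G.d A = 4) {I : Finset E} (hI : I ⊆ G.cut A) (hI2 : I.card = 2)
    {o : E} (ho : G.a o ∉ A ∧ G.b o ∉ A) {Y : Finset (Cap A)} (hY : Y.Nonempty)
    (hYu : Y ≠ univ) :
    3 ≤ (G.cap A I o).d Y ∧
      ((G.cap A I o).d Y = 3 → Y.card = 1 ∨ Yᶜ.card = 1 ∨ G.Split A I) := by
  have e4 : (G.cut A).card = 4 := hd
  have noth : ∀ Y : Finset (Cap A), Y.Nonempty → Cap.lo ∉ Y → Cap.hi ∉ Y →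
      3 ≤ (G.cap A I o).d Y ∧ ((G.cap A I o).d Y = 3 → Y.card = 1) := by
    intro Y hY h1 h2
    have k1 := card_core h1 h2
    have k2 := hY.card_pos
    have hs := core_subset Y
    have k3 := card_le_card (compl_subset_compl.mpr hs)
    have hu : core Y ≠ univ := by intro h; rw [h, compl_univ, card_empty] at k3; omega
    have := h4 (core Y) (card_pos.mp (by omega)) hu
    rw [d, cap_cut_of_notMem hI ho h1 h2, ← k1]
    refine ⟨this.1, fun h => ?_⟩
    rcases this.2 h with h | h <;> omega
  have mixed : ∀ Y : Finset (Cap A), Cap.lo ∈ Y → Cap.hi ∉ Y →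
      3 ≤ (G.cap A I o).d Y ∧
        ((G.cap A I o).d Y = 3 → Y.card = 1 ∨ Yᶜ.card = 1 ∨ G.Split A I) := by
    intro Y h1 h2
    rw [cap_d_mixed hI ho h1 h2]
    by_cases hc0 : core Y = ∅
    · rw [hc0]
      simp only [cut_empty, empty_sdiff, inter_empty, sdiff_empty, hI2, card_empty]
      refine ⟨by omega, fun _ => Or.inl ?_⟩
      rw [card_eq_one]
      refine ⟨.lo, ?_⟩
      ext y
      cases y with
      | inn z hz =>
        have : z ∉ core Y := by rw [hc0]; simp
        rw [mem_core] at this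
        simp only [mem_singleton, reduceCtorEq, iff_false]
        exact fun h => this ⟨hz, h⟩
      | lo => simp [h1]
      | hi => simp [h2]
    · by_cases hcA : core Y = A
      · rw [hcA]
        have : (G.cut A \ I).card = 2 := by rw [card_sdiff_of_subset hI]; omega
        simp only [sdiff_self, inter_self, this, sdiff_eq_empty_iff_subset.mpr hI, card_empty]
        refine ⟨by omega, fun _ => Or.inr (Or.inl ?_)⟩
        rw [card_eq_one]
        refine ⟨.hi, ?_⟩
        ext y
        cases y with
        | inn z hz =>
          have : z ∈ core Y := by rw [hcA]; exact hz
          simp [(mem_core.mp this).2]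
        | lo => simp [h1]
        | hi => simp [h2]
      · have h2 := two_le_inner hG h4 hA hAc hd (core_subset Y) (nonempty_iff_ne_empty.mpr hc0) hcA
        refine ⟨by omega, fun h => Or.inr (Or.inr ⟨core Y, core_subset Y, ?_⟩)⟩
        have z1 : I \ (G.cut A ∩ G.cut (core Y)) = ∅ := card_eq_zero.mp (by omega)
        have z2 : (G.cut A ∩ G.cut (core Y)) \ I = ∅ := card_eq_zero.mp (by omega)
        have z3 : G.cut A ∩ G.cut (core Y) = I :=
          subset_antisymm (sdiff_eq_empty_iff_subset.mp z2) (sdiff_eq_empty_iff_subset.mp z1)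
        refine ⟨?_, z3⟩
        rw [d_split (A := A), z3, hI2]; omega
  have hYc : (Yᶜ).Nonempty := by
    rw [nonempty_iff_ne_empty]; intro h; exact hYu (compl_eq_empty_iff _ |>.mp h)
  by_cases h1 : Cap.lo ∈ Y <;> by_cases h2 : Cap.hi ∈ Y
  · have := noth Yᶜ hYc (by simpa using h1) (by simpa using h2)
    rw [d_compl] at this
    exact ⟨this.1, fun h => Or.inr (Or.inl (this.2 h))⟩
  · exact mixed Y h1 h2
  · -- the complement is mixed with the two points exchanged
    have key : (G.cap A I o).d Y = 1 + (G.cut (core Yᶜ) \ G.cut A).card +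
      (I \ (G.cut A ∩ G.cut (core Yᶜ))).card + ((G.cut A ∩ G.cut (core Yᶜ)) \ I).card := by
      rw [← d_compl, cap_d_mixed hI ho (by simpa using h1) (by simpa using h2)]
    have := mixed Yᶜ (by simpa using h1) (by simpa using h2)
    rw [d_compl, compl_compl] at this
    exact ⟨this.1, fun h => by have := this.2 h; tauto⟩
  · have := noth Y hY h1 h2
    exact ⟨this.1, fun h => Or.inl (this.2 h)⟩

lemma cap_EC3 (hG : G.Cubic) (h4 : G.C4) {A : Finset V} (hA : 4 ≤ A.card)
    (hAc : 2 ≤ Aᶜ.card) (hd : G.d A = 4) {I : Finset E} (hI : I ⊆ G.cut A) (hI2 : I.card = 2)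
    {o : E} (ho : G.a o ∉ A ∧ G.b o ∉ A) : (G.cap A I o).EC3 :=
  fun _ h1 h2 => (cap_cuts hG h4 hA hAc hd hI hI2 ho h1 h2).1

lemma cap_C4 (hG : G.Cubic) (h4 : G.C4) {A : Finset V} (hA : 4 ≤ A.card)
    (hAc : 2 ≤ Aᶜ.card) (hd : G.d A = 4) {I : Finset E} (hI : I ⊆ G.cut A) (hI2 : I.card = 2)
    {o : E} (ho : G.a o ∉ A ∧ G.b o ∉ A) (hs : ¬ G.Split A I) : (G.cap A I o).C4 := by
  intro Y h1 h2
  have := cap_cuts hG h4 hA hAc hd hI hI2 ho h1 h2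
  exact ⟨this.1, fun h => by have := this.2 h; tauto⟩

lemma core_inn {A : Finset V} {x : V} (h : x ∈ A) : core ({.inn x h} : Finset (Cap A)) = {x} := by
  ext y; rw [mem_core]; simp only [mem_singleton, Cap.inn.injEq]
  exact ⟨fun ⟨_, h⟩ => h, fun e => ⟨e ▸ h, e⟩⟩

lemma cap_cut_inn {A : Finset V} {I : Finset E} {o : E} (hI : I ⊆ G.cut A)
    (ho : G.a o ∉ A ∧ G.b o ∉ A) {x : V} (h : x ∈ A) :
    (G.cap A I o).cut {.inn x h} = G.cut {x} := by
  rw [cap_cut_of_notMem hI ho (by simp) (by simp), core_inn]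

lemma cap_cut_lo {A : Finset V} {I : Finset E} {o : E} (hI : I ⊆ G.cut A)
    (ho : G.a o ∉ A ∧ G.b o ∉ A) : (G.cap A I o).cut {.lo} = insert o I := by
  have hc : core ({.lo} : Finset (Cap A)) = ∅ := by ext x; simp [mem_core]
  ext e
  have := @hI e
  rw [mem_cap_cut hI ho, hc, cut_empty]
  simp only [mem_insert, mem_singleton, notMem_empty]
  by_cases he : e ∈ I
  · simp [he, this he]
  · simp [he]

lemma cap_cut_hi {A : Finset V} {I : Finset E} {o : E} (hI : I ⊆ G.cut A)
    (ho : G.a o ∉ A ∧ G.b o ∉ A) : (G.cap A I o).cut {.hi} = insert o (G.cut A \ I) := by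
  have hc : core ({.hi} : Finset (Cap A)) = ∅ := by ext x; simp [mem_core]
  ext e
  rw [mem_cap_cut hI ho, hc, cut_empty]
  simp only [mem_insert, mem_sdiff, notMem_empty]
  by_cases he : e ∈ I <;> simp [he]

lemma cap_cubic (hG : G.Cubic) {A : Finset V} (hd : G.d A = 4) {I : Finset E}
    (hI : I ⊆ G.cut A) (hI2 : I.card = 2) {o : E} (ho : G.a o ∉ A ∧ G.b o ∉ A) :
    (G.cap A I o).Cubic := by
  have hoc : o ∉ G.cut A := by rw [mem_cut]; tauto
  intro v
  cases v with
  | inn x h => rw [d, cap_cut_inn hI ho]; exact hG x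
  | lo => rw [d, cap_cut_lo hI ho, card_insert_of_notMem (fun h => hoc (hI h)), hI2]
  | hi =>
    rw [d, cap_cut_hi hI ho, card_insert_of_notMem (fun h => hoc (mem_sdiff.mp h).1),
      card_sdiff_of_subset hI, hI2]
    rw [d] at hd; omega

lemma cap_link {A : Finset V} {I : Finset E} {o : E} (hI : I ⊆ G.cut A)
    (ho : G.a o ∉ A ∧ G.b o ∉ A) {e : E} (h : (G.cap A I o).a e ≠ (G.cap A I o).b e) :
    e = o ∨ e ∈ G.cut A ∪ G.ins A := by
  by_contra hc
  push Not at hc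
  rw [mem_union, mem_cut, mem_ins] at hc
  have hI' := @hI e
  rw [mem_cut] at hI'
  apply h
  simp only [cap, hc.1, or_false]
  by_cases h1 : G.a e ∈ A
  · have h2 : G.b e ∈ A := by tauto
    have : G.a e = G.b e := by tauto
    rw [this]
  · have h2 : G.b e ∉ A := by tauto
    unfold toCap; rw [dif_neg h1, dif_neg h2]

/-- The set `S ∩ A` in the capped graph. -/
def lfc (A S : Finset V) : Finset (Cap A) :=
  univ.filter fun c => match c with
    | .inn x _ => x ∈ S
    | .lo => False
    | .hi => False

lemma mem_lfc_inn {A S : Finset V} {x : V} {h : x ∈ A} :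
    Cap.inn x h ∈ lfc A S ↔ x ∈ S := by simp [lfc]

lemma lo_notMem_lfc {A S : Finset V} : Cap.lo ∉ lfc A S := by simp [lfc]

lemma hi_notMem_lfc {A S : Finset V} : Cap.hi ∉ lfc A S := by simp [lfc]

lemma card_lfc (A S : Finset V) : (lfc A S).card = (A ∩ S).card := by
  rw [← card_core lo_notMem_lfc hi_notMem_lfc]
  congr 1; ext x; rw [mem_core, mem_inter]; simp only [mem_lfc_inn, exists_prop]

/-- The cut of `A` consists of the four given edges. -/
structure Four (G : Gr V E) (A : Finset V) (i j k l : E) : Prop where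
  cut_eq : G.cut A = {i, j, k, l}
  card_eq : G.d A = 4

lemma Four.ne {A : Finset V} {i j k l : E} (h : Four G A i j k l) :
    i ≠ j ∧ i ≠ k ∧ i ≠ l ∧ j ≠ k ∧ j ≠ l ∧ k ≠ l := by
  have h1 : ({i, j, k, l} : Finset E).card = 4 := by rw [← h.cut_eq]; exact h.card_eq
  have key : ∀ x y z, ({i, j, k, l} : Finset E) ⊆ {x, y, z} → False := by
    intro x y z hs
    have h2 := card_le_card hs
    have h3 := card_le_three (a := x) (b := y) (c := z)
    omega
  refine ⟨fun e => key j k l ?_, fun e => key j k l ?_, fun e => key j k l ?_,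
    fun e => key i k l ?_, fun e => key i k l ?_, fun e => key i j l ?_⟩ <;>
  · intro x; simp only [mem_insert, mem_singleton]; grind

lemma count_cap_le {A S : Finset V} {i j k l o : E} (h : Four G A i j k l)
    (ho : G.a o ∉ A ∧ G.b o ∉ A) :
    (G.cap A {i, j} o).count (lfc A S) ≤
      G.N A S ∅ + G.N A S {i, k} + G.N A S {i, l} + G.N A S {j, k} + G.N A S {j, l} := by
  obtain ⟨hij, hik, hil, hjk, hjl, hkl⟩ := h.ne
  have hc := h.cut_eq
  have hI : ({i, j} : Finset E) ⊆ G.cut A := by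
    rw [hc]; intro e; simp only [mem_insert, mem_singleton]; tauto
  have hoc : o ∉ G.cut A := by rw [mem_cut]; tauto
  have hoi : o ∉ G.ins A := by rw [mem_ins]; tauto
  have hoc' := hoc
  rw [hc] at hoc'
  simp only [mem_insert, mem_singleton, not_or] at hoc'
  obtain ⟨o1, o2, o3, o4⟩ := hoc'
  have hsd : G.cut A \ {i, j} = {k, l} := by
    rw [hc]; ext e; simp only [mem_sdiff, mem_insert, mem_singleton]; grind
  have hsub : ((G.cap A {i, j} o).part univ (lfc A S) ∅).image (fun F => F.erase o) ⊆
      G.part A S ∅ ∪ G.part A S {i, k} ∪ G.part A S {i, l} ∪ G.part A S {j, k} ∪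
        G.part A S {j, l} := by
    intro F' hF'
    obtain ⟨F, hF, rfl⟩ := mem_image.mp hF'
    rw [mem_part, isPart_univ] at hF
    have hlo := hF.2 .lo
    have hhi := hF.2 .hi
    rw [cap_cut_lo hI ho] at hlo
    rw [cap_cut_hi hI ho, hsd] at hhi
    simp only [lo_notMem_lfc, hi_notMem_lfc, false_and, or_false] at hlo hhi
    have hpart : ∀ X, F.erase o ∩ G.cut A = X → G.IsPart A S X (F.erase o) := by
      intro X hX
      refine ⟨fun e he => ?_, hX, fun v hv => ?_⟩
      · have := cap_link hI ho (hF.1 e (mem_of_mem_erase he))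
        exact this.resolve_left (ne_of_mem_erase he)
      · have := hF.2 (.inn v hv)
        rw [cap_cut_inn hI ho, mem_lfc_inn] at this
        have e1 : F.erase o ∩ G.cut {v} = F ∩ G.cut {v} := by
          ext e; simp only [mem_inter, mem_erase]
          constructor
          · tauto
          · rintro ⟨h1, h2⟩
            refine ⟨⟨?_, h1⟩, h2⟩
            rintro rfl
            have := star_subset hv h2
            rw [mem_union] at this; tauto
        rwa [e1]
    obtain ⟨p, hp⟩ := card_eq_one.mp hlo
    obtain ⟨q, hq⟩ := card_eq_one.mp hhi
    have hp' : ∀ e, (e ∈ F ∧ (e = o ∨ e = i ∨ e = j)) ↔ e = p := by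
      intro e; have := Finset.ext_iff.mp hp e; simpa using this
    have hq' : ∀ e, (e ∈ F ∧ (e = o ∨ e = k ∨ e = l)) ↔ e = q := by
      intro e; have := Finset.ext_iff.mp hq e; simpa using this
    simp only [mem_union, mem_part]
    by_cases hoF : o ∈ F
    · left; left; left; left
      refine hpart _ ?_
      ext e; rw [hc]; simp only [mem_inter, mem_erase, mem_insert, mem_singleton, notMem_empty]
      have a1 := hp' o; have a2 := hq' o; have a3 := hp' e; have a4 := hq' e
      grind
    · have hty : ∀ x y, (x = i ∨ x = j) → (y = k ∨ y = l) → x = p → y = q →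
          F.erase o ∩ G.cut A = {x, y} := by
        intro x y hx hy hxp hyq
        ext e; rw [hc]; simp only [mem_inter, mem_erase, mem_insert, mem_singleton]
        have a1 := hp' x; have a2 := hq' y; have a3 := hp' e; have a4 := hq' e
        grind
      have a1 := hp' p; have a2 := hq' q
      have b1 : p = i ∨ p = j := by grind
      have b2 : q = k ∨ q = l := by grind
      rcases b1 with b1 | b1 <;> rcases b2 with b2 | b2
      · left; left; left; right; exact hpart _ (hty _ _ (by simp) (by simp) b1.symm b2.symm)
      · left; left; right; exact hpart _ (hty _ _ (by simp) (by simp) b1.symm b2.symm)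
      · left; right; exact hpart _ (hty _ _ (by simp) (by simp) b1.symm b2.symm)
      · right; exact hpart _ (hty _ _ (by simp) (by simp) b1.symm b2.symm)
  have hinj : Set.InjOn (fun F : Finset E => F.erase o)
      ((G.cap A {i, j} o).part univ (lfc A S) ∅) := by
    intro F hF F' hF' he
    have hF := hF; have hF' := hF'
    rw [mem_coe, mem_part, isPart_univ] at hF hF'
    have h1 := hF.2 .lo
    have h2 := hF'.2 .lo
    rw [cap_cut_lo hI ho] at h1 h2
    simp only [lo_notMem_lfc, false_and, or_false] at h1 h2
    have he' : ∀ e, e ≠ o → (e ∈ F ↔ e ∈ F') := by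
      intro e heo
      have := Finset.ext_iff.mp he e
      simpa [heo] using this
    have hoF : o ∈ F ↔ o ∈ F' := by
      obtain ⟨p, hp⟩ := card_eq_one.mp h1
      obtain ⟨q, hq⟩ := card_eq_one.mp h2
      have hp' : ∀ e, (e ∈ F ∧ (e = o ∨ e = i ∨ e = j)) ↔ e = p := by
        intro e; have := Finset.ext_iff.mp hp e; simpa using this
      have hq' : ∀ e, (e ∈ F' ∧ (e = o ∨ e = i ∨ e = j)) ↔ e = q := by
        intro e; have := Finset.ext_iff.mp hq e; simpa using this
      have a1 := hp' p; have a2 := hq' q; have a3 := hp' q; have a4 := hq' p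
      have a5 := hp' o; have a6 := hq' o
      have a7 := he' p; have a8 := he' q
      grind
    ext e
    by_cases heo : e = o
    · rw [heo]; exact hoF
    · exact he' e heo
  rw [count, N, ← card_image_of_injOn hinj]
  refine (card_le_card hsub).trans ?_
  refine (card_union_le _ _).trans (Nat.add_le_add_right ?_ _)
  refine (card_union_le _ _).trans (Nat.add_le_add_right ?_ _)
  refine (card_union_le _ _).trans (Nat.add_le_add_right ?_ _)
  exact card_union_le _ _

lemma bip_of_cap {A : Finset V} {I : Finset E} {o : E} (h : (G.cap A I o).Bip univ) : G.Bip A := by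
  obtain ⟨P, hP⟩ := h
  refine ⟨core P, fun e ha hb hne => ?_⟩
  have := hP e (mem_univ _) (mem_univ _)
  simp only [cap, toCap, dif_pos ha, dif_pos hb] at this
  rw [mem_core, mem_core]
  simp only [ha, hb, exists_true_left]
  exact this (by simpa using hne)

lemma exists_outer (hG : G.Cubic) {A : Finset V} (hd : G.d A = 4) (hAc : 2 ≤ Aᶜ.card) :
    ∃ o, G.a o ∉ A ∧ G.b o ∉ A := by
  have h1 := hG.sum Aᶜ
  rw [d_compl] at h1
  have h2 : 0 < (G.ins Aᶜ).card := by omega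
  obtain ⟨o, ho⟩ := card_pos.mp h2
  rw [mem_ins, mem_compl, mem_compl] at ho
  exact ⟨o, ho.1, ho.2.1⟩

/-- The vertices of `A`, as a type. -/
inductive Sub (A : Finset V) : Type
  | mk (x : V) (h : x ∈ A)

def Sub.equiv (A : Finset V) : A ≃ Sub A where
  toFun := fun x => .mk x.1 x.2
  invFun := fun c => match c with
    | .mk x h => ⟨x, h⟩
  left_inv := by rintro ⟨x, h⟩; rfl
  right_inv := by rintro ⟨x, h⟩; rfl

instance (A : Finset V) : Fintype (Sub A) := Fintype.ofEquiv _ (Sub.equiv A)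

lemma card_sub (A : Finset V) : Fintype.card (Sub A) = A.card := by
  rw [← Fintype.card_congr (Sub.equiv A), Fintype.card_coe]

/-- Retraction onto `A`. -/
def toSub {A : Finset V} (v : Sub A) (x : V) : Sub A := if h : x ∈ A then .mk x h else v

variable (G) in
/-- The complement of `A` is removed; the cut edge `i` is joined to the inner end of `j`, and
the cut edge `k` to the inner end of `l`. -/
def lnk {A : Finset V} (v : Sub A) (i j k l : E) : Gr (Sub A) E :=
  ⟨fun e => if e ∈ G.ins A then toSub v (G.a e) else if e = i then toSub v (G.inn A i)
      else if e = k then toSub v (G.inn A k) else v,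
    fun e => if e ∈ G.ins A then toSub v (G.b e) else if e = i then toSub v (G.inn A j)
      else if e = k then toSub v (G.inn A l) else v⟩

/-- The underlying set of vertices. -/
def bse {A : Finset V} (Y : Finset (Sub A)) : Finset V :=
  univ.filter fun x => ∃ h : x ∈ A, Sub.mk x h ∈ Y

lemma mem_bse {A : Finset V} {Y : Finset (Sub A)} {x : V} :
    x ∈ bse Y ↔ ∃ h : x ∈ A, Sub.mk x h ∈ Y := by simp [bse]

lemma bse_subset {A : Finset V} (Y : Finset (Sub A)) : bse Y ⊆ A := by
  intro x hx; exact (mem_bse.mp hx).1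

lemma toSub_mem {A : Finset V} {v : Sub A} {x : V} (h : x ∈ A) {Y : Finset (Sub A)} :
    toSub v x ∈ Y ↔ x ∈ bse Y := by
  unfold toSub; rw [mem_bse, dif_pos h]; simp [h]

lemma card_bse {A : Finset V} (Y : Finset (Sub A)) : (bse Y).card = Y.card := by
  refine card_bij (fun x hx => Sub.mk x (mem_bse.mp hx).1) (fun x hx => (mem_bse.mp hx).2) ?_ ?_
  · intro x hx y hy hxy; simpa using hxy
  · rintro ⟨z, hz⟩ hy
    exact ⟨z, mem_bse.mpr ⟨hz, hy⟩, rfl⟩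

lemma bse_mk {A : Finset V} {x : V} (h : x ∈ A) : bse ({.mk x h} : Finset (Sub A)) = {x} := by
  ext y; rw [mem_bse]; simp only [mem_singleton, Sub.mk.injEq]
  exact ⟨fun ⟨_, h⟩ => h, fun e => ⟨e ▸ h, e⟩⟩

lemma Four.mem {A : Finset V} {i j k l : E} (h : Four G A i j k l) :
    i ∈ G.cut A ∧ j ∈ G.cut A ∧ k ∈ G.cut A ∧ l ∈ G.cut A := by
  rw [h.cut_eq]; simp

lemma notMem_ins_of_cut {A : Finset V} {e : E} (h : e ∈ G.cut A) : e ∉ G.ins A := by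
  rw [mem_cut] at h; rw [mem_ins]; tauto

lemma mem_lnk_cut {A : Finset V} {v : Sub A} {i j k l : E} (h : Four G A i j k l)
    {Y : Finset (Sub A)} {e : E} :
    e ∈ (G.lnk v i j k l).cut Y ↔ (e ∈ G.cut (bse Y) ∧ e ∉ G.cut A) ∨
      (e = i ∧ ¬ (i ∈ G.cut (bse Y) ↔ j ∈ G.cut (bse Y))) ∨
      (e = k ∧ ¬ (k ∈ G.cut (bse Y) ↔ l ∈ G.cut (bse Y))) := by
  obtain ⟨hi, hj, hk, hl⟩ := h.mem
  have hik := h.ne.2.1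
  have hs := bse_subset Y
  have i1 := inn_mem hi; have i2 := inn_mem hj; have i3 := inn_mem hk; have i4 := inn_mem hl
  rw [mem_cut_iff_inn hs hi, mem_cut_iff_inn hs hj, mem_cut_iff_inn hs hk, mem_cut_iff_inn hs hl,
    mem_cut]
  simp only [lnk]
  by_cases he : e ∈ G.ins A
  · have e1 : e ≠ i := by rintro rfl; exact notMem_ins_of_cut hi he
    have e2 : e ≠ k := by rintro rfl; exact notMem_ins_of_cut hk he
    simp only [if_pos he, e1, e2, false_and, or_false]
    rw [mem_ins] at he
    rw [toSub_mem he.1, toSub_mem he.2.1, mem_cut, mem_cut]; tauto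
  · have e0 : ¬ (e ∈ G.cut (bse Y) ∧ e ∉ G.cut A) := by
      rintro ⟨h1, h2⟩
      have h3 := link_of_mem_cut h1
      rw [mem_ins] at he
      rw [mem_cut] at h1 h2
      have := @hs (G.a e); have := @hs (G.b e); tauto
    simp only [if_neg he, e0, false_or]
    by_cases e1 : e = i
    · subst e1
      simp only [if_true, hik, false_and, or_false, true_and]
      rw [toSub_mem i1, toSub_mem i2]
    · by_cases e2 : e = k
      · subst e2
        simp only [if_true, e1, if_false, false_and, false_or, true_and]
        rw [toSub_mem i3, toSub_mem i4]
      · simp [e1, e2]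

lemma lnk_d {A : Finset V} {v : Sub A} {i j k l : E} (h : Four G A i j k l)
    (Y : Finset (Sub A)) :
    (G.lnk v i j k l).d Y = (G.cut (bse Y) \ G.cut A).card +
      (if (i ∈ G.cut (bse Y) ↔ j ∈ G.cut (bse Y)) then 0 else 1) +
      (if (k ∈ G.cut (bse Y) ↔ l ∈ G.cut (bse Y)) then 0 else 1) := by
  obtain ⟨hi, hj, hk, hl⟩ := h.mem
  have hik := h.ne.2.1
  have : (G.lnk v i j k l).cut Y = (G.cut (bse Y) \ G.cut A) ∪
      (if (i ∈ G.cut (bse Y) ↔ j ∈ G.cut (bse Y)) then ∅ else {i}) ∪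
      (if (k ∈ G.cut (bse Y) ↔ l ∈ G.cut (bse Y)) then ∅ else {k}) := by
    ext e
    rw [mem_lnk_cut h, mem_union, mem_union, mem_sdiff]
    split_ifs with h1 h2 <;> simp [*]
    tauto
  rw [d, this, card_union_of_disjoint, card_union_of_disjoint]
  · congr 1
    · congr 1; split_ifs <;> simp
    · split_ifs <;> simp
  · split_ifs
    · simp
    · rw [disjoint_singleton_right, mem_sdiff]; tauto
  · rw [disjoint_left]; intro e he he'
    split_ifs at he he' <;>
      simp only [mem_union, mem_sdiff, mem_singleton, notMem_empty, or_false] at he he' <;> grind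

lemma lnk_EC3 (hG : G.Cubic) (h4 : G.C4) {A : Finset V} (hA : 4 ≤ A.card)
    (hAc : 2 ≤ Aᶜ.card) {v : Sub A} {i j k l : E} (h : Four G A i j k l)
    (hs : ¬ G.Split A {i, j}) : (G.lnk v i j k l).EC3 := by
  intro Y hY hYu
  rw [lnk_d h]
  obtain ⟨hij, hik, hil, hjk, hjl, hkl⟩ := h.ne
  have hc := card_bse Y
  have hsub := bse_subset Y
  have hY0 := hY.card_pos
  have hYA : bse Y ≠ A := by
    intro e; apply hYu
    rw [eq_univ_iff_forall]
    rintro ⟨x, hx⟩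
    have : x ∈ bse Y := by rw [e]; exact hx
    exact (mem_bse.mp this).2
  have h2 := two_le_inner hG h4 hA hAc h.card_eq hsub (card_pos.mp (by omega)) hYA
  by_contra hlt
  have c1 : (i ∈ G.cut (bse Y) ↔ j ∈ G.cut (bse Y)) := by
    by_contra hh; rw [if_neg hh] at hlt; omega
  have c2 : (k ∈ G.cut (bse Y) ↔ l ∈ G.cut (bse Y)) := by
    by_contra hh; rw [if_neg hh] at hlt; omega
  rw [if_pos c1, if_pos c2] at hlt
  have hu : ∀ X ⊆ A, X ≠ univ := by
    rintro X hX rfl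
    have h2 := card_le_card (compl_subset_compl.mpr hX)
    rw [compl_univ, card_empty] at h2; omega
  have ht : (G.cut (bse Y) \ G.cut A).card = 2 := by omega
  have d1 := d_split (G := G) (A := A) (D := bse Y)
  have d2 := d_split (G := G) (A := A) (D := A \ bse Y)
  rw [cut_sdiff_of_subset hsub, cut_inter_sdiff hsub] at d2
  have n1 := (h4 (bse Y) (card_pos.mp (by omega)) (hu _ hsub)).1
  have n2 := (h4 (A \ bse Y) (by
    rw [sdiff_nonempty]; intro h; exact hYA (subset_antisymm hsub h)) (hu _ sdiff_subset)).1
  rw [h.cut_eq] at d1 d2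
  by_cases b1 : i ∈ G.cut (bse Y) <;> by_cases b2 : k ∈ G.cut (bse Y)
  · have : ({i, j, k, l} : Finset E) \ G.cut (bse Y) = ∅ := by
      rw [sdiff_eq_empty_iff_subset]; intro e
      simp only [mem_insert, mem_singleton]
      rintro (rfl | rfl | rfl | rfl) <;> tauto
    rw [this, card_empty, h.cut_eq.symm] at d2; omega
  · have hI : G.cut A ∩ G.cut (bse Y) = {i, j} := by
      rw [h.cut_eq]; ext e
      simp only [mem_inter, mem_insert, mem_singleton]
      constructor
      · rintro ⟨rfl | rfl | rfl | rfl, h⟩ <;> tauto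
      · rintro (rfl | rfl) <;> tauto
    refine hs ⟨bse Y, hsub, ?_, hI⟩
    rw [d_split (A := A), hI, ht, card_pair hij]
  · have hI : G.cut A ∩ G.cut (A \ bse Y) = {i, j} := by
      rw [cut_inter_sdiff hsub, h.cut_eq]; ext e
      simp only [mem_sdiff, mem_insert, mem_singleton]
      constructor
      · rintro ⟨rfl | rfl | rfl | rfl, h⟩ <;> tauto
      · rintro (rfl | rfl) <;> tauto
    refine hs ⟨A \ bse Y, sdiff_subset, ?_, hI⟩
    rw [d_split (A := A), hI, cut_sdiff_of_subset hsub, ht, card_pair hij]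
  · have : ({i, j, k, l} : Finset E) ∩ G.cut (bse Y) = ∅ := by
      rw [← disjoint_iff_inter_eq_empty, disjoint_left]; intro e
      simp only [mem_insert, mem_singleton]
      rintro (rfl | rfl | rfl | rfl) <;> tauto
    rw [this, card_empty, h.cut_eq.symm] at d1; omega

lemma Four.inn_ne (hG : G.Cubic) (h4 : G.C4) {A : Finset V} {i j k l : E}
    (h : Four G A i j k l) (hA : 4 ≤ A.card) (hAc : 2 ≤ Aᶜ.card) {p q : E} (hp : p ∈ G.cut A)
    (hq : q ∈ G.cut A) (hpq : p ≠ q) : G.inn A p ≠ G.inn A q := by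
  intro e
  have := inn_inj h4 hG hA (by omega) h.card_eq.le
  exact hpq (this hp hq e)

lemma lnk_cubic (hG : G.Cubic) (h4 : G.C4) {A : Finset V} (hA : 4 ≤ A.card)
    (hAc : 2 ≤ Aᶜ.card) {v : Sub A} {i j k l : E} (h : Four G A i j k l) :
    (G.lnk v i j k l).Cubic := by
  rintro ⟨x, hx⟩
  rw [lnk_d h, bse_mk]
  obtain ⟨hij, hik, hil, hjk, hjl, hkl⟩ := h.ne
  obtain ⟨hi, hj, hk, hl⟩ := h.mem
  have hs : ({x} : Finset V) ⊆ A := singleton_subset_iff.mpr hx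
  have d1 := d_split (G := G) (A := A) (D := {x})
  rw [hG x] at d1
  have ne := fun {p q} => h.inn_ne hG h4 hA hAc (p := p) (q := q)
  have n1 := ne hi hj hij; have n2 := ne hi hk hik; have n3 := ne hi hl hil
  have n4 := ne hj hk hjk; have n5 := ne hj hl hjl; have n6 := ne hk hl hkl
  have c : (G.cut A ∩ G.cut {x}).card =
      (if i ∈ G.cut {x} then 1 else 0) + (if j ∈ G.cut {x} then 1 else 0) +
      (if k ∈ G.cut {x} then 1 else 0) + (if l ∈ G.cut {x} then 1 else 0) := by
    rw [h.cut_eq, ← filter_mem_eq_inter, card_filter, sum_insert, sum_insert, sum_insert,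
      sum_singleton]
    · ring
    · simp [hkl]
    · simp [hjk, hjl]
    · simp [hij, hik, hil]
  simp only [mem_cut_iff_inn hs hi, mem_cut_iff_inn hs hj, mem_cut_iff_inn hs hk,
    mem_cut_iff_inn hs hl, mem_singleton] at c ⊢
  by_cases b1 : G.inn A i = x <;> by_cases b2 : G.inn A j = x <;>
    by_cases b3 : G.inn A k = x <;> by_cases b4 : G.inn A l = x <;>
    simp only [b1, b2, b3, b4, if_true, if_false, iff_self, iff_true, iff_false,
      not_true] at c ⊢ <;>
    first
    | omega
    | exact absurd (b1.trans b2.symm) n1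
    | exact absurd (b1.trans b3.symm) n2
    | exact absurd (b1.trans b4.symm) n3
    | exact absurd (b2.trans b3.symm) n4
    | exact absurd (b2.trans b4.symm) n5
    | exact absurd (b3.trans b4.symm) n6

/-- The set `S ∩ A` in the linked graph. -/
def lfs (A S : Finset V) : Finset (Sub A) :=
  univ.filter fun c => match c with
    | .mk x _ => x ∈ S

lemma mem_lfs {A S : Finset V} {x : V} {h : x ∈ A} : Sub.mk x h ∈ lfs A S ↔ x ∈ S := by
  simp [lfs]

lemma card_lfs (A S : Finset V) : (lfs A S).card = (A ∩ S).card := by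
  rw [← card_bse]
  congr 1; ext x; rw [mem_bse, mem_inter]; simp only [mem_lfs, exists_prop]

lemma lnk_link {A : Finset V} {v : Sub A} {i j k l : E} {e : E}
    (h : (G.lnk v i j k l).a e ≠ (G.lnk v i j k l).b e) : e ∈ G.ins A ∨ e = i ∨ e = k := by
  by_contra hc
  push Not at hc
  exact h (by simp [lnk, hc.1, hc.2.1, hc.2.2])

set_option maxHeartbeats 1000000 in
lemma count_lnk_le (hG : G.Cubic) (h4 : G.C4) {A S : Finset V} (hA : 4 ≤ A.card)
    (hAc : 2 ≤ Aᶜ.card) {v : Sub A} {i j k l : E} (h : Four G A i j k l) :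
    (G.lnk v i j k l).count (lfs A S) ≤
      G.N A S ∅ + G.N A S {i, j} + G.N A S {k, l} + G.N A S (G.cut A) := by
  obtain ⟨hij, hik, hil, hjk, hjl, hkl⟩ := h.ne
  obtain ⟨hi, hj, hk, hl⟩ := h.mem
  have hc := h.cut_eq
  let φ : Finset E → Finset E := fun F =>
    F ∪ ((if i ∈ F then {j} else ∅) ∪ (if k ∈ F then {l} else ∅))
  have hφ : ∀ F e, e ∈ φ F ↔ e ∈ F ∨ (e = j ∧ i ∈ F) ∨ (e = l ∧ k ∈ F) := by
    intro F e
    simp only [φ, mem_union]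
    by_cases h1 : i ∈ F <;> by_cases h2 : k ∈ F <;> simp [h1, h2]
  have hjl' : ∀ F ∈ (G.lnk v i j k l).part univ (lfs A S) ∅, j ∉ F ∧ l ∉ F := by
    intro F hF
    rw [mem_part, isPart_univ] at hF
    constructor <;> intro hh <;> have := lnk_link (hF.1 _ hh)
    · have := notMem_ins_of_cut hj; grind
    · have := notMem_ins_of_cut hl; grind
  have hsub : ((G.lnk v i j k l).part univ (lfs A S) ∅).image φ ⊆
      G.part A S ∅ ∪ G.part A S {i, j} ∪ G.part A S {k, l} ∪ G.part A S (G.cut A) := by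
    intro F' hF'
    obtain ⟨F, hF, rfl⟩ := mem_image.mp hF'
    obtain ⟨hjF, hlF⟩ := hjl' F hF
    rw [mem_part, isPart_univ] at hF
    have hpart : ∀ X, φ F ∩ G.cut A = X → G.IsPart A S X (φ F) := by
      intro X hX
      refine ⟨fun e he => ?_, hX, fun w hw => ?_⟩
      · rw [hφ] at he
        rcases he with he | ⟨rfl, -⟩ | ⟨rfl, -⟩
        · rcases lnk_link (hF.1 e he) with h1 | rfl | rfl
          · exact mem_union_right _ h1
          · exact mem_union_left _ hi
          · exact mem_union_left _ hk
        · exact mem_union_left _ hj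
        · exact mem_union_left _ hl
      · have := hF.2 (.mk w hw)
        rw [mem_lfs] at this
        have hs : ({w} : Finset V) ⊆ A := singleton_subset_iff.mpr hw
        have hcd : (φ F ∩ G.cut {w}).card = (F ∩ (G.lnk v i j k l).cut {.mk w hw}).card := by
          have ne := fun {p q} => h.inn_ne hG h4 hA hAc (p := p) (q := q)
          have n1 := ne hi hj hij; have n2 := ne hi hk hik; have n3 := ne hi hl hil
          have n4 := ne hj hk hjk; have n5 := ne hj hl hjl; have n6 := ne hk hl hkl
          symm
          have key : ∀ e, e ∈ F ∩ (G.lnk v i j k l).cut {.mk w hw} ↔ e ∈ F ∧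
              ((e ∈ G.cut {w} ∧ e ∉ G.cut A) ∨
              (e = i ∧ ¬ (G.inn A i = w ↔ G.inn A j = w)) ∨
              (e = k ∧ ¬ (G.inn A k = w ↔ G.inn A l = w))) := by
            intro e
            rw [mem_inter, mem_lnk_cut h, bse_mk, mem_cut_iff_inn hs hi, mem_cut_iff_inn hs hj,
              mem_cut_iff_inn hs hk, mem_cut_iff_inn hs hl]
            simp only [mem_singleton]
          have c1 := mem_cut_iff_inn hs hi; have c2 := mem_cut_iff_inn hs hj
          have c3 := mem_cut_iff_inn hs hk; have c4 := mem_cut_iff_inn hs hl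
          simp only [mem_singleton] at c1 c2 c3 c4
          have hlk : ∀ e ∈ F, e = i ∨ e = k ∨ e ∉ G.cut A := by
            intro e he
            rcases lnk_link (hF.1 e he) with h1 | rfl | rfl
            · right; right; intro h2; exact notMem_ins_of_cut h2 h1
            · simp
            · simp
          refine card_bij (fun e _ => if e = i ∧ G.inn A j = w then j else
            if e = k ∧ G.inn A l = w then l else e) ?_ ?_ ?_
          · intro e he
            rw [key] at he
            rw [mem_inter, hφ]
            split_ifs with h1 h2
            · refine ⟨Or.inr (Or.inl ⟨rfl, h1.1 ▸ he.1⟩), c2.mpr h1.2⟩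
            · refine ⟨Or.inr (Or.inr ⟨rfl, h2.1 ▸ he.1⟩), c4.mpr h2.2⟩
            · refine ⟨Or.inl he.1, ?_⟩
              rcases he.2 with h3 | ⟨rfl, h3⟩ | ⟨rfl, h3⟩
              · exact h3.1
              · rw [c1]; by_contra hh
                exact h3 ⟨fun h => absurd h hh, fun h => absurd ⟨rfl, h⟩ h1⟩
              · rw [c3]; by_contra hh
                exact h3 ⟨fun h => absurd h hh, fun h => absurd ⟨rfl, h⟩ h2⟩
          · intro e he e' he' heq
            rw [key] at he he'
            have m1 : e ≠ j := fun h => hjF (h ▸ he.1)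
            have m2 : e ≠ l := fun h => hlF (h ▸ he.1)
            have m3 : e' ≠ j := fun h => hjF (h ▸ he'.1)
            have m4 : e' ≠ l := fun h => hlF (h ▸ he'.1)
            split_ifs at heq with p1 p2 p3 p4 p5 p6 p7 <;>
            first
            | exact heq
            | exact absurd heq hjl
            | exact absurd heq.symm hjl
            | exact absurd heq.symm m3
            | exact absurd heq.symm m4
            | exact absurd heq m1
            | exact absurd heq m2
            | exact (‹e = i ∧ _›).1.trans (‹e' = i ∧ _›).1.symm
            | exact (‹e = k ∧ _›).1.trans (‹e' = k ∧ _›).1.symm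
          · intro e he
            rw [mem_inter, hφ] at he
            rcases he with ⟨he | ⟨rfl, h1⟩ | ⟨rfl, h1⟩, hw⟩
            · rcases hlk e he with rfl | rfl | h1
              · rw [c1] at hw
                refine ⟨e, (key e).mpr ⟨he, Or.inr (Or.inl ⟨rfl, ?_⟩)⟩, ?_⟩
                · intro h; exact n1 (hw.trans (h.mp hw).symm)
                · rw [if_neg, if_neg]
                  · exact fun h => hik h.1
                  · exact fun h => n1 (hw.trans h.2.symm)
              · rw [c3] at hw
                refine ⟨e, (key e).mpr ⟨he, Or.inr (Or.inr ⟨rfl, ?_⟩)⟩, ?_⟩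
                · intro h; exact n6 (hw.trans (h.mp hw).symm)
                · rw [if_neg, if_neg]
                  · exact fun h => n6 (hw.trans h.2.symm)
                  · exact fun h => hik h.1.symm
              · refine ⟨e, (key e).mpr ⟨he, Or.inl ⟨hw, h1⟩⟩, ?_⟩
                have a1 : e ≠ i := fun hh => h1 (hh ▸ hi)
                have a2 : e ≠ k := fun hh => h1 (hh ▸ hk)
                rw [if_neg (fun hh => a1 hh.1), if_neg (fun hh => a2 hh.1)]
            · rw [c2] at hw
              refine ⟨i, (key i).mpr ⟨h1, Or.inr (Or.inl ⟨rfl, ?_⟩)⟩, ?_⟩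
              · intro h; exact n1 ((h.mpr hw).trans hw.symm)
              · rw [if_pos ⟨rfl, hw⟩]
            · rw [c4] at hw
              refine ⟨k, (key k).mpr ⟨h1, Or.inr (Or.inr ⟨rfl, ?_⟩)⟩, ?_⟩
              · intro h; exact n6 ((h.mpr hw).trans hw.symm)
              · rw [if_neg (fun h => hik h.1.symm), if_pos ⟨rfl, hw⟩]
        rwa [hcd]
    simp only [mem_union, mem_part]
    by_cases h1 : i ∈ F <;> by_cases h2 : k ∈ F
    · right; refine hpart _ ?_
      rw [hc]; ext e; rw [mem_inter, hφ]; simp only [mem_insert, mem_singleton]; grind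
    · left; left; right; refine hpart _ ?_
      rw [hc]; ext e; rw [mem_inter, hφ]; simp only [mem_insert, mem_singleton]; grind
    · left; right; refine hpart _ ?_
      rw [hc]; ext e; rw [mem_inter, hφ]; simp only [mem_insert, mem_singleton]; grind
    · left; left; left; refine hpart _ ?_
      rw [hc]; ext e; rw [mem_inter, hφ]; simp only [mem_insert, mem_singleton, notMem_empty]
      grind
  have hinj : Set.InjOn φ ((G.lnk v i j k l).part univ (lfs A S) ∅) := by
    intro F hF F' hF' he
    have h1 := hjl' F hF; have h2 := hjl' F' hF'
    ext e
    have := Finset.ext_iff.mp he e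
    rw [hφ, hφ] at this
    grind
  rw [count, N, ← card_image_of_injOn hinj]
  refine (card_le_card hsub).trans ?_
  refine (card_union_le _ _).trans (Nat.add_le_add_right ?_ _)
  refine (card_union_le _ _).trans (Nat.add_le_add_right ?_ _)
  exact card_union_le _ _

/-- A linked graph is bipartite if each link joins the two classes of `A`. -/
lemma bip_lnk {A P : Finset V} {v : Sub A} {i j k l : E} (h : Four G A i j k l)
    (hP : G.BipOn A P) (hij : ¬ (G.inn A i ∈ P ↔ G.inn A j ∈ P))
    (hkl : ¬ (G.inn A k ∈ P ↔ G.inn A l ∈ P)) : (G.lnk v i j k l).Bip univ := by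
  obtain ⟨hi, hj, hk, hl⟩ := h.mem
  refine ⟨lfs A P, fun e _ _ hne => ?_⟩
  have hb : ∀ x, x ∈ bse (lfs A P) ↔ x ∈ A ∧ x ∈ P := by
    intro x; rw [mem_bse]; simp only [mem_lfs, exists_prop]
  simp only [lnk]
  by_cases he : e ∈ G.ins A
  · simp only [if_pos he]
    rw [mem_ins] at he
    rw [toSub_mem he.1, toSub_mem he.2.1, hb, hb]
    have := hP e he.1 he.2.1 he.2.2
    tauto
  · rcases lnk_link hne with h1 | h1
    · exact absurd h1 he
    · simp only [if_neg he]
      have i1 := inn_mem hi; have i2 := inn_mem hj; have i3 := inn_mem hk; have i4 := inn_mem hl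
      by_cases e1 : e = i
      · rw [if_pos e1, if_pos e1, toSub_mem i1, toSub_mem i2, hb, hb]; tauto
      · have e2 : e = k := by tauto
        rw [if_neg e1, if_neg e1, if_pos e2, if_pos e2, toSub_mem i3, toSub_mem i4, hb, hb]; tauto

/-- A cyclic cut of size four. -/
structure Cyc (G : Gr V E) (A : Finset V) : Prop where
  d : G.d A = 4
  card : 4 ≤ A.card
  card' : 4 ≤ Aᶜ.card

lemma Cyc.compl {A : Finset V} (h : Cyc G A) : Cyc G Aᶜ :=
  ⟨by rw [d_compl, h.d], h.card', by rw [compl_compl]; exact h.card⟩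

lemma Cyc.ne_univ {A : Finset V} (h : Cyc G A) : A ≠ univ := by
  rintro rfl; have := h.card'; simp at this

lemma Four.perm {A : Finset V} {i j k l i' j' k' l' : E} (h : Four G A i j k l)
    (he : ({i', j', k', l'} : Finset E) = {i, j, k, l}) : Four G A i' j' k' l' :=
  ⟨h.cut_eq.trans he.symm, h.card_eq⟩

lemma Four.swap {A : Finset V} {i j k l : E} (h : Four G A i j k l) : Four G A i k j l :=
  h.perm (by ext; simp only [mem_insert, mem_singleton]; tauto)

lemma Four.compl {A : Finset V} {i j k l : E} (h : Four G A i j k l) : Four G Aᶜ i j k l :=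
  ⟨by rw [cut_compl, h.cut_eq], by rw [d_compl, h.card_eq]⟩

lemma exists_four {A : Finset V} (hd : G.d A = 4) {i j : E} (hi : i ∈ G.cut A)
    (hj : j ∈ G.cut A) (hij : i ≠ j) : ∃ k l, Four G A i j k l := by
  have h1 : ((G.cut A \ {i, j}) : Finset E).card = 2 := by
    rw [card_sdiff_of_subset, card_pair hij]
    · rw [d] at hd; omega
    · intro e; simp only [mem_insert, mem_singleton]; rintro (rfl | rfl) <;> assumption
  obtain ⟨k, l, -, hkl⟩ := card_eq_two.mp h1
  refine ⟨k, l, ?_, hd⟩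
  ext e
  have := Finset.ext_iff.mp hkl e
  simp only [mem_sdiff, mem_insert, mem_singleton] at this ⊢
  constructor
  · tauto
  · rintro (rfl | rfl | h | h)
    · exact hi
    · exact hj
    · tauto
    · tauto

lemma exists_four' {A : Finset V} (hd : G.d A = 4) : ∃ i j k l, Four G A i j k l := by
  obtain ⟨i, j, k, l, -, -, -, -, -, -, h⟩ := card_eq_four.mp hd
  exact ⟨i, j, k, l, h, hd⟩

lemma glue_four {A : Finset V} {i j k l : E} (h : Four G A i j k l) (S : Finset V) :
    G.N A S ∅ * G.N Aᶜ S ∅ + G.N A S {i, j} * G.N Aᶜ S {i, j}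
      + G.N A S {i, k} * G.N Aᶜ S {i, k} + G.N A S {i, l} * G.N Aᶜ S {i, l}
      + G.N A S {j, k} * G.N Aᶜ S {j, k} + G.N A S {j, l} * G.N Aᶜ S {j, l}
      + G.N A S {k, l} * G.N Aᶜ S {k, l} + G.N A S (G.cut A) * G.N Aᶜ S (G.cut A)
      ≤ G.count S := by
  obtain ⟨hij, hik, hil, hjk, hjl, hkl⟩ := h.ne
  have h2 := fun {p q : E} (hpq : p ≠ q) => card_pair hpq
  have hc : (G.cut A).card = 4 := h.card_eq
  have hpp : ∀ {p q r : E}, r ≠ p → r ≠ q → ∀ {s : E}, ({p, q} : Finset E) ≠ {r, s} := by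
    intro p q r h1 h2 s he
    have : r ∈ ({p, q} : Finset E) := by rw [he]; simp
    simp only [mem_insert, mem_singleton] at this; tauto
  have hpp' : ∀ {p q r : E}, r ≠ p → r ≠ q → ∀ {s : E}, ({p, q} : Finset E) ≠ {s, r} := by
    intro p q r h1 h2 s; rw [pair_comm s r]; exact hpp h1 h2
  have hp0 : ∀ {p q : E}, (∅ : Finset E) ≠ {p, q} := by
    intro p q he; have : p ∈ (∅ : Finset E) := by rw [he]; simp
    simp at this
  have hpc : ∀ {p q : E}, p ≠ q → ({p, q} : Finset E) ≠ G.cut A := by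
    intro p q hpq he; rw [← he, h2 hpq] at hc; omega
  have h0c : (∅ : Finset E) ≠ G.cut A := by intro he; rw [← he] at hc; simp at hc
  have := G.glue A S {∅, {i, j}, {i, k}, {i, l}, {j, k}, {j, l}, {k, l}, G.cut A}
  refine le_trans (le_of_eq ?_) this
  rw [sum_insert, sum_insert, sum_insert, sum_insert, sum_insert, sum_insert, sum_insert,
    sum_singleton]
  · ring
  · simp only [mem_singleton]; exact hpc hkl
  · simp only [mem_insert, mem_singleton, not_or]
    exact ⟨hpp hjk.symm hkl, hpc hjl⟩
  · simp only [mem_insert, mem_singleton, not_or]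
    exact ⟨hpp' hjl.symm hkl.symm, hpp' hjl.symm hkl.symm, hpc hjk⟩
  · simp only [mem_insert, mem_singleton, not_or]
    exact ⟨hpp hij.symm hjl, hpp hij.symm hjl, hpp hik.symm hkl, hpc hil⟩
  · simp only [mem_insert, mem_singleton, not_or]
    exact ⟨hpp' hil.symm hkl.symm, hpp hij.symm hjk, hpp hij.symm hjk, hpp' hil.symm hkl.symm,
      hpc hik⟩
  · simp only [mem_insert, mem_singleton, not_or]
    exact ⟨hpp' hik.symm hjk.symm, hpp' hil.symm hjl.symm, hpp' hik.symm hjk.symm,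
      hpp' hil.symm hjl.symm, hpp hik.symm hjk.symm, hpc hij⟩
  · simp only [mem_insert, mem_singleton, not_or]
    exact ⟨hp0, hp0, hp0, hp0, hp0, hp0, h0c⟩

lemma Cyc.two_le_N_empty (hG : G.Cubic) (h4 : G.C4) {A S : Finset V} (hA : Cyc G A) :
    2 ≤ G.N A S ∅ := by
  obtain ⟨F, F', h1, h2, h3⟩ := two_pm hG (EC3.of_C4 h4) hA.d hA.card
    (h4.inner hG (by have := hA.card'; omega))
  exact (two_le_N h1 h2 h3).trans (N_mono (empty_subset _))

lemma Cyc.one_le_N_pair_of_not_bip (hG : G.Cubic) (h4 : G.C4) {A S : Finset V} (hA : Cyc G A)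
    (hb : ¬ G.Bip A) {g g' : E} (hg : g ∈ G.cut A) (hg' : g' ∈ G.cut A) (hne : g ≠ g') :
    1 ≤ G.N A S {g, g'} := by
  rcases bip_of_pair hG h4 hA.d hA.card (by have := hA.card'; omega) hg hg' hne with h | ⟨P, h, -⟩
  · exact h.trans (N_mono (empty_subset _))
  · exact absurd ⟨P, h⟩ hb

lemma Cyc.one_le_N_pair (hG : G.Cubic) (h4 : G.C4) {A S P : Finset V} (hA : Cyc G A)
    (hP : G.BipOn A P) {g g' : E} (hg : g ∈ G.cut A) (hg' : g' ∈ G.cut A)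
    (hc : ¬ (G.inn A g ∈ P ↔ G.inn A g' ∈ P)) : 1 ≤ G.N A S {g, g'} := by
  have hne : g ≠ g' := by rintro rfl; tauto
  rcases bip_of_pair hG h4 hA.d hA.card (by have := hA.card'; omega) hg hg' hne with
    h | ⟨P', h, h1, h2⟩
  · exact h.trans (N_mono (empty_subset _))
  · have i1 := inn_mem hg
    have i2 := inn_mem hg'
    rcases bip_unique (EC3.of_C4 h4) (by rw [hA.d]; omega) hA.ne_univ hP h with hu | hu
    · have := hu _ i1; have := hu _ i2; tauto
    · have := hu _ i1; have := hu _ i2; tauto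

lemma Cyc.one_le_N_cut (hG : G.Cubic) (h4 : G.C4) {A S : Finset V} (hA : Cyc G A)
    (hb : G.Bip A) : 1 ≤ G.N A S (G.cut A) := by
  obtain ⟨P, hP⟩ := hb
  exact (Gr.one_le_N_cut hG h4 hA.d hA.card (by have := hA.card'; omega) hP).trans
    (N_mono (empty_subset _))

lemma Cyc.four_le_card {A : Finset V} (hA : Cyc G A) : 4 ≤ Fintype.card V :=
  hA.card.trans (card_le_univ A)

lemma bip_union {X Y P Q : Finset V} (hXY : Disjoint X Y) (hP : G.BipOn X P) (hQ : G.BipOn Y Q)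
    (h : ∀ e ∈ G.cut X, e ∈ G.cut Y → ¬ (G.inn X e ∈ P ↔ G.inn Y e ∈ Q)) :
    G.BipOn (X ∪ Y) ((X ∩ P) ∪ (Y ∩ Q)) := by
  have hd : ∀ {x}, x ∈ X → x ∉ Y := fun {x} hx hy => disjoint_left.mp hXY hx hy
  have hmX : ∀ {x}, x ∈ X → (x ∈ (X ∩ P) ∪ (Y ∩ Q) ↔ x ∈ P) := by
    intro x hx; have := hd hx; simp only [mem_union, mem_inter]; tauto
  have hmY : ∀ {x}, x ∈ Y → (x ∈ (X ∩ P) ∪ (Y ∩ Q) ↔ x ∈ Q) := by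
    intro x hx
    have : x ∉ X := fun h => hd h hx
    simp only [mem_union, mem_inter]; tauto
  intro e ha hb hne
  rw [mem_union] at ha hb
  rcases ha with ha | ha <;> rcases hb with hb | hb
  · rw [hmX ha, hmX hb]; exact hP e ha hb hne
  · rw [hmX ha, hmY hb]
    have h1 := h e (by rw [mem_cut]; have : G.b e ∉ X := fun h => hd h hb; tauto)
      (by rw [mem_cut]; have := hd ha; tauto)
    rw [inn, if_pos ha, inn, if_neg (hd ha)] at h1
    exact h1
  · rw [hmY ha, hmX hb]
    have h1 := h e (by rw [mem_cut]; have : G.a e ∉ X := fun h => hd h ha; tauto)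
      (by rw [mem_cut]; have := hd hb; tauto)
    rw [inn, if_neg (fun h => hd h ha), inn, if_pos ha] at h1
    tauto
  · rw [hmY ha, hmY hb]; exact hQ e ha hb hne

lemma d_sdiff_add {X Y : Finset V} (F : Finset E)
    (hF : ∀ e ∈ F, (G.a e ∈ X ∩ Y ∧ G.b e ∉ X ∪ Y) ∨ (G.b e ∈ X ∩ Y ∧ G.a e ∉ X ∪ Y)) :
    G.d (X \ Y) + G.d (Y \ X) + 2 * F.card ≤ G.d X + G.d Y := by
  have h1 : 2 * F.card = ∑ e : E, if e ∈ F then 2 else 0 := by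
    rw [← sum_filter, filter_mem_eq_inter, univ_inter, sum_const, smul_eq_mul, mul_comm]
  rw [h1]
  simp only [d_eq_sum, ← sum_add_distrib]
  refine sum_le_sum fun e _ => ?_
  have := hF e
  simp only [mem_sdiff, mem_inter, mem_union] at this ⊢
  by_cases h1 : G.a e ∈ X <;> by_cases h2 : G.a e ∈ Y <;> by_cases h3 : G.b e ∈ X <;>
    by_cases h4 : G.b e ∈ Y <;> by_cases h5 : e ∈ F <;> simp_all

set_option maxHeartbeats 1000000 in
/-- Two crossing pairs of inner cuts exist only in a bipartite side. -/
lemma bip_of_splits (h4 : G.C4) {A : Finset V} (hA : Cyc G A) {i j k l : E}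
    (h : Four G A i j k l) (h1 : G.Split A {i, j}) (h2 : G.Split A {i, k}) : G.Bip A := by
  obtain ⟨hij, hik, hil, hjk, hjl, hkl⟩ := h.ne
  obtain ⟨hi, hj, hk, hl⟩ := h.mem
  have h3 := h2.compl hA.d (card_pair hik)
  have h3' : (G.cut A \ {i, k}) = {j, l} := by
    rw [h.cut_eq]; ext e; simp only [mem_sdiff, mem_insert, mem_singleton]
    constructor
    · tauto
    · rintro (rfl | rfl) <;> simp <;> tauto
  obtain ⟨D, hD, hDd, hDc⟩ := h1
  obtain ⟨D', hD', hDd', hDc'⟩ := h2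
  have hiff : ∀ {X : Finset V}, X ⊆ A → ∀ {e}, e ∈ G.cut A →
      (G.inn A e ∈ X ↔ e ∈ G.cut A ∩ G.cut X) := by
    intro X hX e he
    rw [← mem_cut_iff_inn hX he, mem_inter, and_iff_right he]
  have hDm : ∀ {e}, e ∈ G.cut A → (G.inn A e ∈ D ↔ e = i ∨ e = j) := by
    intro e he; rw [hiff hD he, hDc]; simp
  have hDm' : ∀ {e}, e ∈ G.cut A → (G.inn A e ∈ D' ↔ e = i ∨ e = k) := by
    intro e he; rw [hiff hD' he, hDc']; simp
  have hcut : ∀ {e}, e ∈ G.cut A → (G.a e = G.inn A e ∧ G.b e ∉ A) ∨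
      (G.b e = G.inn A e ∧ G.a e ∉ A) := by
    intro e he
    rw [mem_cut] at he
    by_cases ha : G.a e ∈ A
    · exact Or.inl ⟨(if_pos ha).symm, fun h => he ⟨fun _ => h, fun _ => ha⟩⟩
    · exact Or.inr ⟨(if_neg ha).symm, ha⟩
  set D'' := A \ D' with hD''
  have hDd'' : G.d D'' = 4 := by
    have := d_split (G := G) (A := A) (D := D'')
    rw [hD'', cut_sdiff_of_subset hD', cut_inter_sdiff hD'] at this
    have e1 := d_split (G := G) (A := A) (D := D')
    have e2 : (G.cut A \ G.cut D').card + (G.cut A ∩ G.cut D').card = (G.cut A).card :=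
      card_sdiff_add_card_inter _ _
    have e3 := hA.d
    rw [d] at e3
    rw [hDc', card_pair hik] at e1 e2
    rw [hDd'] at e1
    rw [hD'']; omega
  have hib : ∀ {e} {X Y : Finset V}, X ⊆ A → Y ⊆ A → e ∈ G.cut A → G.inn A e ∈ X →
      G.inn A e ∈ Y → (G.a e ∈ X ∩ Y ∧ G.b e ∉ X ∪ Y) ∨ (G.b e ∈ X ∩ Y ∧ G.a e ∉ X ∪ Y) := by
    intro e X Y hX hY he e1 e2
    simp only [mem_inter, mem_union, not_or]
    rcases hcut he with ⟨e3, e4⟩ | ⟨e3, e4⟩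
    · left; rw [e3]; exact ⟨⟨e1, e2⟩, fun h => e4 (hX h), fun h => e4 (hY h)⟩
    · right; rw [e3]; exact ⟨⟨e1, e2⟩, fun h => e4 (hX h), fun h => e4 (hY h)⟩
  have hD''A : D'' ⊆ A := sdiff_subset
  have him : G.inn A i ∈ D ∧ G.inn A i ∈ D' := by rw [hDm hi, hDm' hi]; exact ⟨Or.inl rfl, Or.inl rfl⟩
  have hjm : G.inn A j ∈ D ∧ G.inn A j ∉ D' := by
    rw [hDm hj, hDm' hj]; exact ⟨Or.inr rfl, not_or.mpr ⟨hij.symm, hjk⟩⟩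
  have hkm : G.inn A k ∉ D ∧ G.inn A k ∈ D' := by
    rw [hDm hk, hDm' hk]; exact ⟨not_or.mpr ⟨hik.symm, hjk.symm⟩, Or.inr rfl⟩
  have hlm : G.inn A l ∉ D ∧ G.inn A l ∉ D' := by
    rw [hDm hl, hDm' hl]; exact ⟨not_or.mpr ⟨hil.symm, hjl.symm⟩, not_or.mpr ⟨hil.symm, hkl.symm⟩⟩
  have hjA := inn_mem hj
  have hlA := inn_mem hl
  have hsm : ∀ {X : Finset V}, X ⊆ A → X.Nonempty → 3 ≤ G.d X ∧ (G.d X = 3 → X.card = 1) := by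
    intro X hX hne
    have e1 := card_le_card (compl_subset_compl.mpr hX)
    have e2 := hA.card'
    have := h4 X hne (by rintro rfl; rw [compl_univ, card_empty] at e1; omega)
    exact ⟨this.1, fun h => by have := this.2 h; omega⟩
  have q1 := hsm (X := D \ D'') (sdiff_subset.trans hD)
    ⟨G.inn A i, mem_sdiff.mpr ⟨him.1, fun h => (mem_sdiff.mp h).2 him.2⟩⟩
  have q2 := hsm (X := D \ D') (sdiff_subset.trans hD) ⟨G.inn A j, mem_sdiff.mpr hjm⟩
  have q3 := hsm (X := D' \ D) (sdiff_subset.trans hD') ⟨G.inn A k, mem_sdiff.mpr hkm.symm⟩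
  have q4 := hsm (X := D'' \ D) (sdiff_subset.trans hD''A)
    ⟨G.inn A l, mem_sdiff.mpr ⟨mem_sdiff.mpr ⟨hlA, hlm.2⟩, hlm.1⟩⟩
  have s1 := d_sdiff_add (G := G) (X := D) (Y := D') {i} (by
    intro e he; rw [mem_singleton] at he; subst he; exact hib hD hD' hi him.1 him.2)
  have s2 := d_sdiff_add (G := G) (X := D) (Y := D'') {j} (by
    intro e he; rw [mem_singleton] at he; subst he
    exact hib hD hD''A hj hjm.1 (mem_sdiff.mpr ⟨hjA, hjm.2⟩))
  rw [card_singleton] at s1 s2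
  have c1 := q1.2 (by omega)
  have c2 := q2.2 (by omega)
  have c3 := q3.2 (by omega)
  have c4 := q4.2 (by omega)
  refine ⟨(D \ D'') ∪ (D'' \ D), fun e ha hb hne => ?_⟩
  have hone : ∀ {X : Finset V}, X.card = 1 → ¬ (G.a e ∈ X ∧ G.b e ∈ X) := by
    rintro X hX ⟨e1, e2⟩
    exact hne (card_le_one.mp hX.le _ e1 _ e2)
  have o1 := hone c1
  have o2 := hone c2
  have o3 := hone c3
  have o4 := hone c4
  have t1 : ¬ ((G.a e ∈ D ∩ D' ∧ G.b e ∉ D ∪ D') ∨ (G.b e ∈ D ∩ D' ∧ G.a e ∉ D ∪ D')) := by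
    intro ht
    have hei : e ≠ i := by
      rintro rfl; rcases hcut hi with h | h
      exacts [h.2 hb, h.2 ha]
    have := d_sdiff_add (G := G) (X := D) (Y := D') {i, e} (by
      intro f hf; rw [mem_insert, mem_singleton] at hf
      rcases hf with rfl | rfl
      · exact hib hD hD' hi him.1 him.2
      · exact ht)
    rw [card_pair hei.symm] at this
    omega
  have t2 : ¬ ((G.a e ∈ D ∩ D'' ∧ G.b e ∉ D ∪ D'') ∨ (G.b e ∈ D ∩ D'' ∧ G.a e ∉ D ∪ D'')) := by
    intro ht
    have hej : e ≠ j := by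
      rintro rfl; rcases hcut hj with h | h
      exacts [h.2 hb, h.2 ha]
    have := d_sdiff_add (G := G) (X := D) (Y := D'') {j, e} (by
      intro f hf; rw [mem_insert, mem_singleton] at hf
      rcases hf with rfl | rfl
      · exact hib hD hD''A hj hjm.1 (mem_sdiff.mpr ⟨hjA, hjm.2⟩)
      · exact ht)
    rw [card_pair hej.symm] at this
    omega
  clear_value D''
  subst hD''
  clear q1 q2 q3 q4 s1 s2 c1 c2 c3 c4 hone hsm hib hcut hDm hDm' hiff him hjm hkm hlm
  simp only [mem_sdiff, mem_inter, mem_union] at o1 o2 o3 o4 t1 t2 ⊢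
  by_cases x1 : G.a e ∈ D <;> by_cases x2 : G.a e ∈ D' <;> by_cases x3 : G.b e ∈ D <;>
    by_cases x4 : G.b e ∈ D' <;> simp only [x1, x2, x3, x4, ha, hb] at o1 o2 o3 o4 t1 t2 ⊢ <;>
    simp at o1 o2 o3 o4 t1 t2 ⊢

lemma bip_cap {A P : Finset V} {I : Finset E} {o : E} (hI : I ⊆ G.cut A)
    (ho : G.a o ∉ A ∧ G.b o ∉ A) (hP : G.BipOn A P)
    (h : ∀ e ∈ G.cut A, (G.inn A e ∈ P ↔ e ∈ I)) : (G.cap A I o).Bip univ := by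
  have hm : ∀ {c : Prop} {x : V}, (toCap A c x ∈ insert Cap.hi (lfc A P) ↔
      if x ∈ A then x ∈ P else ¬ c) := by
    intro c x
    unfold toCap
    by_cases hx : x ∈ A
    · simp [hx, mem_lfc_inn]
    · by_cases hc : c
      · simp [hx, hc, lo_notMem_lfc]
      · simp [hx, hc]
  refine ⟨insert Cap.hi (lfc A P), fun e _ _ hne => ?_⟩
  have hl := cap_link hI ho hne
  simp only [cap, hm]
  have hoc : o ∉ I := fun hh => by have := hI hh; rw [mem_cut] at this; tauto
  rcases hl with rfl | hl
  · simp [ho.1, ho.2, hoc]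
  · rw [mem_union, mem_ins] at hl
    rcases hl with hl | hl
    · have h1 := h e hl
      have heo : e ≠ o := by rintro rfl; rw [mem_cut] at hl; tauto
      rw [mem_cut] at hl
      by_cases ha : G.a e ∈ A
      · have hb : G.b e ∉ A := by tauto
        rw [inn, if_pos ha] at h1
        simp only [ha, hb, if_true, if_false]; tauto
      · have hb : G.b e ∈ A := by tauto
        rw [inn, if_neg ha] at h1
        simp only [ha, hb, if_true, if_false]; tauto
    · simp only [hl.1, hl.2.1, if_true]
      exact hP e hl.1 hl.2.1 hl.2.2

lemma add_le_mul_add_one {a b : ℕ} (ha : 1 ≤ a) (hb : 1 ≤ b) : a + b ≤ a * b + 1 := by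
  nlinarith

lemma add_le_mul_add_four {a b : ℕ} (ha : 2 ≤ a) (hb : 2 ≤ b) : 2 * a + 2 * b ≤ a * b + 4 := by
  nlinarith

lemma exists_two_two {C : Finset E} {p q : E → Prop} (h1 : (C.filter p).card = 2)
    (h2 : (C.filter fun e => ¬ p e).card = 2) (h3 : (C.filter q).card = 2)
    (h4 : ∃ e ∈ C, (p e ↔ q e)) (h5 : ∃ e ∈ C, ¬ (p e ↔ q e)) :
    ∃ i j k l, C = {i, j, k, l} ∧ (p i ∧ q i) ∧ (¬ p j ∧ q j) ∧ (¬ p k ∧ ¬ q k) ∧ (p l ∧ ¬ q l) := by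
  have s1 := card_filter_add_card_filter_not (s := C.filter p) q
  have s2 := card_filter_add_card_filter_not (s := C.filter fun e => ¬ p e) q
  have s3 := card_filter_add_card_filter_not (s := C.filter q) p
  have s4 : (C.filter p).filter q = (C.filter q).filter p := by
    ext; simp only [mem_filter]; tauto
  have s5 : (C.filter fun e => ¬ p e).filter q = (C.filter q).filter fun e => ¬ p e := by
    ext; simp only [mem_filter]; tauto
  rw [← s4, ← s5] at s3
  have p4 : 0 < ((C.filter p).filter q).card ∨
      0 < ((C.filter fun e => ¬ p e).filter fun e => ¬ q e).card := by
    obtain ⟨e, he, h⟩ := h4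
    by_cases hp : p e
    · left; exact card_pos.mpr ⟨e, by simp only [mem_filter]; tauto⟩
    · right; exact card_pos.mpr ⟨e, by simp only [mem_filter]; tauto⟩
  have p5 : 0 < ((C.filter p).filter fun e => ¬ q e).card ∨
      0 < ((C.filter fun e => ¬ p e).filter q).card := by
    obtain ⟨e, he, h⟩ := h5
    by_cases hp : p e
    · left; exact card_pos.mpr ⟨e, by simp only [mem_filter]; tauto⟩
    · right; exact card_pos.mpr ⟨e, by simp only [mem_filter]; tauto⟩
  obtain ⟨i, hi⟩ := card_pos.mp (show 0 < ((C.filter p).filter q).card by omega)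
  obtain ⟨j, hj⟩ := card_pos.mp (show 0 < ((C.filter fun e => ¬ p e).filter q).card by omega)
  obtain ⟨k, hk⟩ := card_pos.mp
    (show 0 < ((C.filter fun e => ¬ p e).filter fun e => ¬ q e).card by omega)
  obtain ⟨l, hl⟩ := card_pos.mp (show 0 < ((C.filter p).filter fun e => ¬ q e).card by omega)
  simp only [mem_filter] at hi hj hk hl
  refine ⟨i, j, k, l, ?_, by tauto, by tauto, by tauto, by tauto⟩
  have hc := card_filter_add_card_filter_not (s := C) p
  symm
  apply eq_of_subset_of_card_le
  · intro e; simp only [mem_insert, mem_singleton]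
    rintro (rfl | rfl | rfl | rfl) <;> tauto
  · have n1 : i ≠ j := by rintro rfl; tauto
    have n2 : i ≠ k := by rintro rfl; tauto
    have n3 : i ≠ l := by rintro rfl; tauto
    have n4 : j ≠ k := by rintro rfl; tauto
    have n5 : j ≠ l := by rintro rfl; tauto
    have n6 : k ≠ l := by rintro rfl; tauto
    have : ({i, j, k, l} : Finset E).card = 4 := by
      rw [card_insert_of_notMem, card_insert_of_notMem, card_pair n6] <;>
        simp only [mem_insert, mem_singleton] <;> tauto
    omega

/-- The link of two colour-crossing pairs on a bipartite side has many factors. -/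
lemma lnk_count_of_bip (hG : G.Cubic) (h4 : G.C4) {A P : Finset V} (hA : Cyc G A)
    (hP : G.BipOn A P) {i j k l : E} (h : Four G A i j k l)
    (hij : ¬ (G.inn A i ∈ P ↔ G.inn A j ∈ P)) (hkl : ¬ (G.inn A k ∈ P ↔ G.inn A l ∈ P)) :
    3 * A.card ≤ 2 * (G.N A ∅ ∅ + G.N A ∅ {i, j} + G.N A ∅ {k, l} + G.N A ∅ (G.cut A)) + 6 := by
  obtain ⟨x, hx⟩ := card_pos.mp (show 0 < A.card by have := hA.card; omega)
  have hc2 : 2 ≤ Aᶜ.card := by have := hA.card'; omega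
  have h1 := count_lnk_le (S := ∅) (v := Sub.mk x hx) hG h4 hA.card hc2 h
  have h2 := bip_lnk (v := Sub.mk x hx) h hP hij hkl
  have : Nonempty (Sub A) := ⟨Sub.mk x hx⟩
  obtain ⟨n, h3, h5⟩ := h2.exists_count_ge (lnk_cubic hG h4 hA.card hc2 h) (lfs A ∅)
  rw [card_sub] at h3
  have := two_mul_le_vg n
  omega

theorem count_ge_of_bip_bip (hG : G.Cubic) (h4 : G.C4) (hb : ¬ G.Bip univ) {A : Finset V}
    (hA : Cyc G A) (h1 : G.Bip A) (h2 : G.Bip Aᶜ) (S : Finset V) :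
    3 * (Fintype.card V + 2 * S.card) ≤ 4 * G.count S + 36 := by
  have hadd := count_add_card_le hG h4 hA.four_le_card hb (disjoint_empty_left S)
  rw [empty_union] at hadd
  obtain ⟨P, hP⟩ := h1
  obtain ⟨P', hP'⟩ := h2
  obtain ⟨b1, b2, -⟩ := hP.balanced hG hA.d
  obtain ⟨b3, -, -⟩ := hP'.balanced hG hA.compl.d
  rw [cut_compl] at b3
  have hun : ∀ {Q}, G.BipOn Aᶜ Q → ∃ e ∈ G.cut A, (G.inn A e ∈ P ↔ G.inn Aᶜ e ∈ Q) := by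
    intro Q hQ
    by_contra hc
    push Not at hc
    apply hb
    rw [← union_compl A]
    refine ⟨_, bip_union disjoint_compl_right hP hQ fun e he _ => ?_⟩
    have := hc e he
    tauto
  have e1 := hun hP'
  obtain ⟨e, he, he'⟩ := hun hP'.compl
  have e2 : ∃ e ∈ G.cut A, ¬ (G.inn A e ∈ P ↔ G.inn Aᶜ e ∈ P') :=
    ⟨e, he, by rw [mem_compl] at he'; tauto⟩
  obtain ⟨i, j, k, l, hc, hi, hj, hk, hl⟩ := exists_two_two
    (p := fun e => G.inn A e ∈ P) (q := fun e => G.inn Aᶜ e ∈ P') (by convert b1) (by convert b2)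
    (by convert b3) e1 e2
  have hf : Four G A i k j l := (show Four G A i j k l from ⟨hc, hA.d⟩).swap
  obtain ⟨mi, mk, mj, ml⟩ := hf.mem
  have hf' := hf.compl
  have mi' := mi; have mk' := mk; have mj' := mj; have ml' := ml
  rw [← cut_compl] at mi' mk' mj' ml'
  have c1 := lnk_count_of_bip hG h4 hA hP hf (by tauto) (by tauto)
  have c2 := lnk_count_of_bip hG h4 hA.compl hP' hf' (by tauto) (by tauto)
  have g := glue_four hf ∅
  have t1 := add_le_mul_add_four (hA.two_le_N_empty (S := ∅) hG h4)
    (hA.compl.two_le_N_empty (S := ∅) hG h4)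
  have t2 := add_le_mul_add_one (hA.one_le_N_pair hG h4 hP (S := ∅) mi mk (by tauto))
    (hA.compl.one_le_N_pair hG h4 hP' (S := ∅) mi' mk' (by tauto))
  have t3 := add_le_mul_add_one (hA.one_le_N_pair hG h4 hP (S := ∅) mj ml (by tauto))
    (hA.compl.one_le_N_pair hG h4 hP' (S := ∅) mj' ml' (by tauto))
  have t4 := add_le_mul_add_one (hA.one_le_N_cut (S := ∅) hG h4 ⟨P, hP⟩)
    (hA.compl.one_le_N_cut (S := ∅) hG h4 ⟨P', hP'⟩)
  rw [cut_compl] at c2 t4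
  have k1 := card_add_card_compl A
  have k2 := hA.card
  have k3 := card_le_univ S
  omega

lemma cap_count (hG : G.Cubic) (h4 : G.C4) {A : Finset V} (hA : Cyc G A) (hb : ¬ G.Bip A)
    {i j k l : E} (h : Four G A i j k l) (S : Finset V) :
    A.card + 2 * (A ∩ S).card ≤ 2 * (G.N A S ∅ + G.N A S {i, k} + G.N A S {i, l}
      + G.N A S {j, k} + G.N A S {j, l}) + 8 ∧ (¬ G.Split A {i, j} →
      A.card + 2 * (A ∩ S).card + 4 ≤ 2 * (G.N A S ∅ + G.N A S {i, k} + G.N A S {i, l}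
      + G.N A S {j, k} + G.N A S {j, l})) := by
  have hc2 : 2 ≤ Aᶜ.card := by have := hA.card'; omega
  obtain ⟨o, ho⟩ := exists_outer hG hA.d hc2
  obtain ⟨hij, -⟩ := h.ne
  obtain ⟨hi, hj, -⟩ := h.mem
  have hI : ({i, j} : Finset E) ⊆ G.cut A := by
    intro e; simp only [mem_insert, mem_singleton]; rintro (rfl | rfl) <;> assumption
  have hI2 := card_pair hij
  have h1 := count_cap_le (S := S) h ho
  have hcub := cap_cubic hG hA.d hI hI2 ho
  have hcard : 4 ≤ Fintype.card (Cap A) := by rw [card_cap]; have := hA.card; omega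
  constructor
  · have := (clBound _ hcub (cap_EC3 hG h4 hA.card hc2 hA.d hI hI2 ho) hcard le_rfl (lfc A S)).1
    rw [card_cap, card_lfc] at this
    omega
  · intro hs
    have := count_ge_of_C4_nonbip hcub (cap_C4 hG h4 hA.card hc2 hA.d hI hI2 ho hs) hcard
      (fun h => hb (bip_of_cap h)) (lfc A S)
    rw [card_cap, card_lfc] at this
    omega

lemma side_count (hG : G.Cubic) (h4 : G.C4) {A : Finset V} (hA : Cyc G A) (hb : ¬ G.Bip A)
    {i j k l : E} (h : Four G A i j k l) (S : Finset V) :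
    3 * (A.card + 2 * (A ∩ S).card) ≤ 2 * (3 * G.N A S ∅ + 2 * (G.N A S {i, j} + G.N A S {i, k} +
      G.N A S {i, l} + G.N A S {j, k} + G.N A S {j, l} + G.N A S {k, l})) := by
  have f2 : Four G A i k l j := h.perm (by ext; simp only [mem_insert, mem_singleton]; tauto)
  have f3 : Four G A i l j k := h.perm (by ext; simp only [mem_insert, mem_singleton]; tauto)
  obtain ⟨a1, a2⟩ := cap_count hG h4 hA hb h S
  obtain ⟨b1, b2⟩ := cap_count hG h4 hA hb f2 S
  obtain ⟨c1, c2⟩ := cap_count hG h4 hA hb f3 S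
  have x1 := fun u v => hb (bip_of_splits h4 hA h u v)
  have x2 := fun u v => hb (bip_of_splits h4 hA f2 u v)
  have x3 := fun u v => hb (bip_of_splits h4 hA f3 u v)
  rw [pair_comm k j] at b1 b2
  rw [pair_comm l j, pair_comm l k] at c1 c2
  by_cases s1 : G.Split A {i, j}
  · have := b2 fun u => x1 s1 u
    have := c2 fun u => x3 u s1
    omega
  · have := a2 s1
    by_cases s2 : G.Split A {i, k}
    · have := c2 fun u => x2 s2 u
      omega
    · have := b2 s2
      omega

lemma card_inter_add_compl (A S : Finset V) : (A ∩ S).card + (Aᶜ ∩ S).card = S.card := by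
  rw [inter_comm A, inter_comm Aᶜ, ← card_inter_add_card_sdiff S A, sdiff_eq_inter_compl]

theorem count_ge_of_not_bip_not_bip (hG : G.Cubic) (h4 : G.C4) {A : Finset V}
    (hA : Cyc G A) (h1 : ¬ G.Bip A) (h2 : ¬ G.Bip Aᶜ) (S : Finset V) :
    3 * (Fintype.card V + 2 * S.card) ≤ 4 * G.count S + 36 := by
  obtain ⟨i, j, k, l, h⟩ := exists_four' hA.d
  obtain ⟨hij, hik, hil, hjk, hjl, hkl⟩ := h.ne
  obtain ⟨mi, mj, mk, ml⟩ := h.mem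
  have c1 := side_count hG h4 hA h1 h S
  have c2 := side_count hG h4 hA.compl h2 h.compl S
  have g := glue_four h S
  have t0 := add_le_mul_add_four (hA.two_le_N_empty (S := S) hG h4)
    (hA.compl.two_le_N_empty (S := S) hG h4)
  have z1 := hA.two_le_N_empty (S := S) hG h4
  have z2 := hA.compl.two_le_N_empty (S := S) hG h4
  have t : ∀ {p q}, p ∈ G.cut A → q ∈ G.cut A → p ≠ q →
      G.N A S {p, q} + G.N Aᶜ S {p, q} ≤ G.N A S {p, q} * G.N Aᶜ S {p, q} + 1 :=
    fun {p q} hp hq hpq => add_le_mul_add_one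
      (hA.one_le_N_pair_of_not_bip hG h4 h1 hp hq hpq)
      (hA.compl.one_le_N_pair_of_not_bip hG h4 h2 (by rwa [cut_compl]) (by rwa [cut_compl]) hpq)
  have t1 := t mi mj hij
  have t2 := t mi mk hik
  have t3 := t mi ml hil
  have t4 := t mj mk hjk
  have t5 := t mj ml hjl
  have t6 := t mk ml hkl
  have k1 := card_add_card_compl A
  have k2 := card_inter_add_compl A S
  have k3 := Nat.zero_le (G.N A S (G.cut A) * G.N Aᶜ S (G.cut A))
  omega

lemma star_subset_ins (u : V) : G.cut {u} ⊆ G.ins univ := by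
  intro e he
  rw [mem_ins]; exact ⟨mem_univ _, mem_univ _, link_of_mem_cut he⟩

/-- Degrees in the complement of the symmetric difference of two perfect matchings. -/
lemma compl_symmDiff_star (hG : G.Cubic) {M M' : Finset E} {u : V}
    (hM1 : (M ∩ G.cut {u}).card = 1) (hM2 : (M' ∩ G.cut {u}).card = 1) :
    (M ∩ G.cut {u} = M' ∩ G.cut {u} →
      (G.ins univ \ ((M \ M') ∪ (M' \ M))) ∩ G.cut {u} = G.cut {u}) ∧
    (M ∩ G.cut {u} ≠ M' ∩ G.cut {u} →
      ((G.ins univ \ ((M \ M') ∪ (M' \ M))) ∩ G.cut {u}).card = 1) := by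
  constructor
  · intro h1
    ext e
    have h2 := Finset.ext_iff.mp h1 e
    have h3 := @star_subset_ins _ _ _ _ G u e
    simp only [mem_inter, mem_sdiff, mem_union] at h2 ⊢
    tauto
  · intro h1
    obtain ⟨x, hx⟩ := card_eq_one.mp (hM1)
    obtain ⟨y, hy⟩ := card_eq_one.mp (hM2)
    have hxy : x ≠ y := by rintro rfl; exact h1 (hx.trans hy.symm)
    have hx' := Finset.ext_iff.mp hx
    have hy' := Finset.ext_iff.mp hy
    simp only [mem_inter, mem_singleton] at hx' hy'
    have : (G.ins univ \ ((M \ M') ∪ (M' \ M))) ∩ G.cut {u} = G.cut {u} \ {x, y} := by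
      ext e
      have h2 := hx' e
      have h3 := hy' e
      have h4 := @star_subset_ins _ _ _ _ G u e
      simp only [mem_inter, mem_sdiff, mem_union, mem_insert, mem_singleton]
      have : ¬ (e = x ∧ e = y) := by rintro ⟨rfl, rfl⟩; exact hxy rfl
      tauto
    rw [this, card_sdiff_of_subset, card_pair hxy, show (G.cut {u}).card = 3 from hG u]
    intro e; simp only [mem_insert, mem_singleton]
    rintro (rfl | rfl)
    · exact ((hx' e).mpr rfl).2
    · exact ((hy' e).mpr rfl).2

lemma count_add_two_le (hG : G.Cubic) (h : 4 ≤ G.count ∅) : G.count ∅ + 2 ≤ G.count univ := by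
  have hV : Nonempty V := by
    by_contra hV
    rw [not_nonempty_iff] at hV
    have : G.part univ ∅ ∅ ⊆ {∅} := by
      intro F hF
      rw [mem_part, isPart_univ] at hF
      rw [mem_singleton, eq_empty_iff_forall_notMem]
      intro e
      exact hV.elim (G.a e)
    have := card_le_card this
    rw [card_singleton] at this
    have h' : (G.part univ ∅ ∅).card = G.count ∅ := rfl
    omega
  obtain ⟨v⟩ := hV
  have hcard : ((cut G {v}).powersetCard 1).card < (G.part univ ∅ ∅).card := by
    rw [card_powersetCard, show (G.cut {v}).card = 3 from hG v]
    exact h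
  obtain ⟨M, hM, M', hM', hne, heq⟩ := exists_ne_map_eq_of_card_lt_of_maps_to hcard
    (f := fun M => M ∩ G.cut {v}) (by
      intro F hF
      rw [mem_coe, mem_part, isPart_univ] at hF
      rw [mem_coe, mem_powersetCard]
      refine ⟨inter_subset_right, ?_⟩
      simpa using hF.2 v)
  rw [mem_part, isPart_univ] at hM hM'
  have hM1 : ∀ u, (M ∩ G.cut {u}).card = 1 := by simpa using hM.2
  have hM2 : ∀ u, (M' ∩ G.cut {u}).card = 1 := by simpa using hM'.2
  set F := G.ins univ \ ((M \ M') ∪ (M' \ M)) with hF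
  have hst := fun u => star_subset_ins (G := G) u
  have hFu := fun u => compl_symmDiff_star hG (hM1 u) (hM2 u)
  simp only [← hF] at hFu
  have i1 : F ∈ G.part univ univ ∅ := by
    rw [mem_part, isPart_univ]
    refine ⟨fun e he => (mem_ins.mp (mem_sdiff.mp he).1).2.2, fun u => ?_⟩
    by_cases hu : M ∩ G.cut {u} = M' ∩ G.cut {u}
    · right; exact ⟨mem_univ _, by rw [(hFu u).1 hu]; exact hG u⟩
    · left; exact (hFu u).2 hu
  have i2 : G.ins univ ∈ G.part univ univ ∅ := by
    rw [mem_part, isPart_univ]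
    refine ⟨fun e he => (mem_ins.mp he).2.2, fun u => ?_⟩
    right; exact ⟨mem_univ _, by rw [inter_eq_right.mpr (hst u)]; exact hG u⟩
  have n1 : F ∉ G.part univ ∅ ∅ := by
    rw [mem_part, isPart_univ]
    rintro ⟨-, h2⟩
    have h2 := h2 v
    rw [(hFu v).1 heq, show (G.cut {v}).card = 3 from hG v] at h2
    simp at h2
  have n2 : G.ins univ ∉ G.part univ ∅ ∅ := by
    rw [mem_part, isPart_univ]
    rintro ⟨-, h2⟩
    have h2 := h2 v
    rw [inter_eq_right.mpr (hst v), show (G.cut {v}).card = 3 from hG v] at h2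
    simp at h2
  have n3 : F ≠ G.ins univ := by
    intro h1
    apply hne
    ext e
    have h2 := Finset.ext_iff.mp h1 e
    have hl : ∀ {N : Finset E}, (∀ e ∈ N, G.a e ≠ G.b e) → e ∈ N → e ∈ G.ins univ := by
      intro N hN he; rw [mem_ins]; exact ⟨mem_univ _, mem_univ _, hN e he⟩
    have h3 := hl hM.1
    have h4 := hl hM'.1
    simp only [hF, mem_sdiff, mem_union] at h2
    clear hFu hst hl i1 i2 n1 n2 hM hM' hM1 hM2 heq hcard hne
    tauto
  have hsub : insert F (insert (G.ins univ) (G.part univ ∅ ∅)) ⊆ G.part univ univ ∅ := by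
    intro X hX
    rw [mem_insert, mem_insert] at hX
    rcases hX with rfl | rfl | hX
    · exact i1
    · exact i2
    · exact part_mono (empty_subset _) hX
  have := card_le_card hsub
  rw [card_insert_of_notMem (by rw [mem_insert]; tauto), card_insert_of_notMem n2] at this
  exact this

theorem count_ge_of_bip (hG : G.Cubic) (hn : 8 ≤ Fintype.card V) (hb : G.Bip univ)
    (S : Finset V) : 3 * (Fintype.card V + 2 * S.card) ≤ 4 * G.count S + 36 := by
  have : Nonempty V := Fintype.card_pos_iff.mp (by omega)
  by_cases hS : S = univ
  · subst hS
    obtain ⟨n, h1, h2⟩ := hb.exists_count_ge hG ∅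
    have h3 := three_mul_le_vg n
    have h4 := two_mul_le_vg n
    have := count_add_two_le hG (by omega)
    rw [Finset.card_univ]
    omega
  · obtain ⟨n, h1, h2⟩ := hb.exists_count_ge hG S
    have h3 := three_mul_le_vg n
    have h4 : S.card < Fintype.card V := by
      rw [← Finset.card_univ]; exact card_lt_card ((ssubset_univ_iff).mpr hS)
    omega

lemma bip_two {X : Finset V} (h : X.card = 2) : G.Bip X := by
  obtain ⟨p, q, hpq, rfl⟩ := card_eq_two.mp h
  refine ⟨{p}, fun e ha hb hne => ?_⟩
  simp only [mem_insert, mem_singleton] at ha hb ⊢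
  have hqp := hpq.symm
  rcases ha with ha | ha <;> rcases hb with hb | hb <;> rw [ha, hb] at hne ⊢ <;> tauto

lemma bip_join {X Y P Q : Finset V} {i j : E} (hXY : Disjoint X Y) (hP : G.BipOn X P)
    (hQ : G.BipOn Y Q) (hc : ∀ e ∈ G.cut X, e ∈ G.cut Y → e = i ∨ e = j)
    (hk : (G.inn X i ∈ P ↔ G.inn X j ∈ P) ↔ (G.inn Y i ∈ Q ↔ G.inn Y j ∈ Q)) :
    G.Bip (X ∪ Y) := by
  by_cases h : G.inn X i ∈ P ↔ G.inn Y i ∈ Q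
  · refine ⟨_, bip_union hXY hP hQ.compl fun e h1 h2 => ?_⟩
    rw [mem_compl]
    rcases hc e h1 h2 with rfl | rfl <;> tauto
  · refine ⟨_, bip_union hXY hP hQ fun e h1 h2 => ?_⟩
    rcases hc e h1 h2 with rfl | rfl <;> tauto

lemma Four.same_iff (hG : G.Cubic) {A P : Finset V} {i j k l : E} (h : Four G A i j k l)
    (hP : G.BipOn A P) :
    (G.inn A i ∈ P ↔ G.inn A j ∈ P) ↔ (G.inn A k ∈ P ↔ G.inn A l ∈ P) := by
  obtain ⟨h1, -, -⟩ := hP.balanced hG h.card_eq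
  obtain ⟨hij, hik, hil, hjk, hjl, hkl⟩ := h.ne
  rw [card_filter, h.cut_eq, sum_insert, sum_insert, sum_insert, sum_singleton] at h1
  · by_cases c1 : G.inn A i ∈ P <;> by_cases c2 : G.inn A j ∈ P <;> by_cases c3 : G.inn A k ∈ P <;>
      by_cases c4 : G.inn A l ∈ P <;> simp [c1, c2, c3, c4] at h1 ⊢
  · simp [hkl]
  · simp [hjk, hjl]
  · simp [hij, hik, hil]

lemma exists_link_of_two (hG : G.Cubic) {X : Finset V} (hd : G.d X = 4) (hX : X.card = 2)
    {u v : V} (hu : u ∈ X) (hv : v ∈ X) (huv : u ≠ v) :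
    ∃ z ∈ G.ins X, (G.a z = u ∧ G.b z = v) ∨ (G.a z = v ∧ G.b z = u) := by
  have h1 := hG.sum X
  have h2 : 0 < (G.ins X).card := by omega
  obtain ⟨z, hz⟩ := card_pos.mp h2
  refine ⟨z, hz, ?_⟩
  rw [mem_ins] at hz
  have hXe : X = {u, v} := by
    symm; apply eq_of_subset_of_card_le
    · intro x; simp only [mem_insert, mem_singleton]; rintro (rfl | rfl) <;> assumption
    · rw [card_pair huv, hX]
  obtain ⟨ha, hb, hne⟩ := hz
  rw [hXe, mem_insert, mem_singleton] at ha hb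
  rcases ha with ha | ha <;> rcases hb with hb | hb
  · rw [ha, hb] at hne; exact absurd rfl hne
  · exact Or.inl ⟨ha, hb⟩
  · exact Or.inr ⟨ha, hb⟩
  · rw [ha, hb] at hne; exact absurd rfl hne

lemma opp_of_two (hG : G.Cubic) {X Q : Finset V} (hd : G.d X = 4) (hX : X.card = 2)
    (hQ : G.BipOn X Q) {u v : V} (hu : u ∈ X) (hv : v ∈ X) (huv : u ≠ v) :
    ¬ (u ∈ Q ↔ v ∈ Q) := by
  obtain ⟨z, hz, h⟩ := exists_link_of_two hG hd hX hu hv huv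
  rw [mem_ins] at hz
  have := hQ z hz.1 hz.2.1 hz.2.2
  rcases h with ⟨h1, h2⟩ | ⟨h1, h2⟩ <;> rw [h1, h2] at this <;> tauto

lemma inn_of_subset {A D : Finset V} (hD : D ⊆ A) {e : E} (h1 : e ∈ G.cut A) (h2 : e ∈ G.cut D) :
    G.inn D e = G.inn A e := by
  symm; exact inn_eq_of_mem h1 (hD (inn_mem h2)) (mem_star_inn h2)

/-- A largest bipartite side of a cyclic cut of size four, when every such cut has exactly one
bipartite side. -/
structure Ext (G : Gr V E) (A : Finset V) : Prop where
  cyc : Cyc G A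
  bip : G.Bip A
  nbip : ¬ G.Bip Aᶜ
  max : ∀ X, Cyc G X → G.Bip X → X.card ≤ A.card
  dich : ∀ X, Cyc G X → G.Bip X ∨ G.Bip Xᶜ

/-- The two pieces of a split of the complement of `A`. -/
structure Pieces (G : Gr V E) (A D D' : Finset V) (i j k l f g : E) : Prop where
  union : D ∪ D' = Aᶜ
  disj : Disjoint D D'
  inter : ∀ e ∈ G.cut D, e ∈ G.cut D' → e = f ∨ e = g
  interA : ∀ e ∈ G.cut A, e ∈ G.cut D → e = i ∨ e = j
  interA' : ∀ e ∈ G.cut A, e ∈ G.cut D' → e = k ∨ e = l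
  four : Four G A i j k l
  fourD : Four G D i j f g
  fourD' : Four G D' k l f g

lemma Pieces.symm {A D D' : Finset V} {i j k l f g : E} (h : Pieces G A D D' i j k l f g) :
    Pieces G A D' D k l i j f g :=
  ⟨by rw [union_comm, h.union], h.disj.symm, fun e h1 h2 => h.inter e h2 h1, h.interA', h.interA,
    h.four.perm (by ext; simp only [mem_insert, mem_singleton]; tauto), h.fourD', h.fourD⟩

lemma exists_pieces {A : Finset V} {i j k l : E} (h : Four G A i j k l)
    (hs : G.Split Aᶜ {i, j}) : ∃ D D' f g, Pieces G A D D' i j k l f g := by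
  obtain ⟨hij, hik, hil, hjk, hjl, hkl⟩ := h.ne
  obtain ⟨D, hD, hDd, hDc⟩ := hs
  have e1 := d_split (G := G) (A := Aᶜ) (D := D)
  have e2 := d_split (G := G) (A := Aᶜ) (D := Aᶜ \ D)
  have e3 : (G.cut Aᶜ \ G.cut D).card + (G.cut Aᶜ ∩ G.cut D).card = (G.cut Aᶜ).card :=
    card_sdiff_add_card_inter _ _
  have e4 : (G.cut Aᶜ).card = 4 := by rw [cut_compl]; exact h.card_eq
  rw [cut_sdiff_of_subset hD, cut_inter_sdiff hD] at e2
  rw [hDc, card_pair hij] at e1 e3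
  obtain ⟨f, g, hfg, hF⟩ := card_eq_two.mp (show (G.cut D \ G.cut Aᶜ).card = 2 by omega)
  have c1 : G.cut D = {i, j, f, g} := by
    rw [← sdiff_union_inter (G.cut D) (G.cut Aᶜ), hF, inter_comm, hDc]
    ext; simp only [mem_union, mem_insert, mem_singleton]; tauto
  have c2 : G.cut (Aᶜ \ D) = {k, l, f, g} := by
    rw [← sdiff_union_inter (G.cut (Aᶜ \ D)) (G.cut Aᶜ), cut_sdiff_of_subset hD, hF, inter_comm,
      cut_inter_sdiff hD]
    have : G.cut Aᶜ \ G.cut D = {k, l} := by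
      have : G.cut Aᶜ \ G.cut D = G.cut Aᶜ \ (G.cut Aᶜ ∩ G.cut D) := by
        ext; simp only [mem_sdiff, mem_inter]; tauto
      rw [this, hDc, cut_compl, h.cut_eq]
      ext e; simp only [mem_sdiff, mem_insert, mem_singleton]
      constructor
      · tauto
      · rintro (rfl | rfl) <;> simp <;> tauto
    rw [this]
    ext; simp only [mem_union, mem_insert, mem_singleton]; tauto
  have hfg' : ∀ {e}, e = f ∨ e = g → e ∉ G.cut A := by
    intro e he
    have : e ∈ G.cut D \ G.cut Aᶜ := by rw [hF, mem_insert, mem_singleton]; exact he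
    rw [← cut_compl]; exact (mem_sdiff.mp this).2
  obtain ⟨mi, mj, mk, ml⟩ := h.mem
  refine ⟨D, Aᶜ \ D, f, g, union_sdiff_of_subset hD, disjoint_sdiff, ?_, ?_, ?_, h,
    ⟨c1, hDd⟩, ⟨c2, by omega⟩⟩
  · intro e
    rw [c1, c2]; simp only [mem_insert, mem_singleton]
    have h1 : e = i → ¬ (e = k ∨ e = l ∨ e = f ∨ e = g) := by
      rintro rfl (h | h | h)
      · exact hik h
      · exact hil h
      · exact hfg' h mi
    have h2 : e = j → ¬ (e = k ∨ e = l ∨ e = f ∨ e = g) := by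
      rintro rfl (h | h | h)
      · exact hjk h
      · exact hjl h
      · exact hfg' h mj
    tauto
  · intro e h1
    rw [c1]; simp only [mem_insert, mem_singleton]
    have := fun h => hfg' h (e := e) h1
    tauto
  · intro e h1
    rw [c2]; simp only [mem_insert, mem_singleton]
    have := fun h => hfg' h (e := e) h1
    tauto

section Pieces

variable {A D D' P Q Q' : Finset V} {i j k l f g : E}

lemma Pieces.subset (h : Pieces G A D D' i j k l f g) : D ⊆ Aᶜ := by
  rw [← h.union]; exact subset_union_left

lemma Pieces.two_le (hG : G.Cubic) (h : Pieces G A D D' i j k l f g) : 2 ≤ D.card := by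
  have h1 := hG.parity D
  rw [h.fourD.card_eq] at h1
  have h2 : 0 < D.card := card_pos.mpr ⟨_, inn_mem h.fourD.mem.1⟩
  omega

lemma Pieces.even (hG : G.Cubic) (h : Pieces G A D D' i j k l f g) : D.card % 2 = 0 := by
  have h1 := hG.parity D
  rw [h.fourD.card_eq] at h1
  omega

lemma Pieces.card (h : Pieces G A D D' i j k l f g) : D.card + D'.card = Aᶜ.card := by
  rw [← h.union, card_union_of_disjoint h.disj]

lemma Pieces.compl_eq (h : Pieces G A D D' i j k l f g) : (A ∪ D)ᶜ = D' := by
  have h1 := h.union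
  have h2 := h.disj
  ext x
  have h3 := Finset.ext_iff.mp h1 x
  have h4 : x ∈ D → x ∉ D' := fun h => disjoint_left.mp h2 h
  simp only [mem_union, mem_compl] at h3 ⊢
  tauto

lemma Pieces.disjA (h : Pieces G A D D' i j k l f g) : Disjoint A D :=
  disjoint_compl_right.mono_right h.subset

lemma Pieces.bip (hG : G.Cubic) (hA : Ext G A) (h : Pieces G A D D' i j k l f g) : G.Bip D := by
  by_cases h2 : D.card = 2
  · exact bip_two h2
  · have h3 := h.two_le hG
    have h4 := h.even hG
    have h5 := card_le_card (h.subset)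
    have h6 : A.card < Dᶜ.card := by
      have := card_add_card_compl D
      have := card_add_card_compl A
      have := h.card
      have := h.symm.two_le hG
      omega
    have hc : Cyc G D := ⟨h.fourD.card_eq, by omega, by have := hA.cyc.card; omega⟩
    rcases hA.dich D hc with hb | hb
    · exact hb
    · have := hA.max _ hc.compl hb; omega

lemma Pieces.kinds (hG : G.Cubic) (hA : Ext G A) (h : Pieces G A D D' i j k l f g)
    (hQ : G.BipOn D Q) (hQ' : G.BipOn D' Q') :
    ¬ ((G.inn D i ∈ Q ↔ G.inn D j ∈ Q) ↔ (G.inn D' k ∈ Q' ↔ G.inn D' l ∈ Q')) := by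
  intro hk
  rw [h.fourD.same_iff hG hQ, h.fourD'.same_iff hG hQ'] at hk
  apply hA.nbip
  rw [← h.union]
  exact bip_join h.disj hQ hQ' h.inter hk

lemma Pieces.card_eq_two (hG : G.Cubic) (hA : Ext G A) (h : Pieces G A D D' i j k l f g)
    (hP : G.BipOn A P) (hQ : G.BipOn D Q)
    (hk : (G.inn A i ∈ P ↔ G.inn A j ∈ P) ↔ (G.inn D i ∈ Q ↔ G.inn D j ∈ Q)) : D'.card = 2 := by
  have h1 := bip_join h.disjA hP hQ h.interA hk
  have h2 := h.symm.two_le hG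
  have h3 := h.symm.even hG
  by_contra h4
  have h5 := card_union_of_disjoint h.disjA
  have h6 := h.two_le hG
  have hc : Cyc G (A ∪ D) := ⟨by rw [← d_compl, h.compl_eq, h.fourD'.card_eq],
    by have := hA.cyc.card; omega, by rw [h.compl_eq]; omega⟩
  have := hA.max _ hc h1
  omega

lemma Pieces.inn_ne (hG : G.Cubic) (h4 : G.C4) (hA : Ext G A)
    (h : Pieces G A D D' i j k l f g) : G.inn D i ≠ G.inn D j := by
  obtain ⟨hi, hj, -⟩ := h.fourD.mem
  obtain ⟨hi', hj', -⟩ := h.four.mem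
  obtain ⟨hij, -⟩ := h.four.ne
  rw [← cut_compl] at hi' hj'
  rw [inn_of_subset h.subset hi' hi, inn_of_subset h.subset hj' hj]
  intro he
  exact hij (inn_inj h4 hG hA.cyc.compl.card (by rw [compl_compl]; have := hA.cyc.card; omega)
    (by rw [hA.cyc.compl.d]) hi' hj' he)

lemma Pieces.opp (hG : G.Cubic) (h4 : G.C4) (hA : Ext G A) (h : Pieces G A D D' i j k l f g)
    (hQ : G.BipOn D Q) (hc : D.card = 2) : ¬ (G.inn D i ∈ Q ↔ G.inn D j ∈ Q) := by
  obtain ⟨hi, hj, -⟩ := h.fourD.mem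
  exact opp_of_two hG h.fourD.card_eq hc hQ (inn_mem hi) (inn_mem hj) (h.inn_ne hG h4 hA)

end Pieces

/-- The complement of `A` does not split along two edges with differently coloured ends. -/
lemma Ext.not_split (hG : G.Cubic) (h4 : G.C4) {A P : Finset V} (hA : Ext G A)
    (hP : G.BipOn A P) {i j k l : E} (h : Four G A i j k l)
    (hc : ¬ (G.inn A i ∈ P ↔ G.inn A j ∈ P)) : ¬ G.Split Aᶜ {i, j} := by
  intro hs
  obtain ⟨D, D', f, g, hp⟩ := exists_pieces h hs
  obtain ⟨Q, hQ⟩ := hp.bip hG hA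
  obtain ⟨Q', hQ'⟩ := hp.symm.bip hG hA
  have hk := hp.kinds hG hA hQ hQ'
  have hc' : ¬ (G.inn A k ∈ P ↔ G.inn A l ∈ P) := by rwa [← h.same_iff hG hP]
  by_cases h1 : G.inn D i ∈ Q ↔ G.inn D j ∈ Q
  · have h2 := hp.symm.card_eq_two hG hA hP hQ'
      (iff_of_false hc' fun h => hk (iff_of_true h1 h))
    exact hp.opp hG h4 hA hQ h2 h1
  · have h2 := hp.card_eq_two hG hA hP hQ (iff_of_false hc h1)
    exact hk (iff_of_false h1 (hp.symm.opp hG h4 hA hQ' h2))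

/-- A split along two edges with equally coloured ends cuts off two adjacent vertices. -/
lemma Ext.split (hG : G.Cubic) {A P : Finset V} (hA : Ext G A)
    (hP : G.BipOn A P) {i j k l : E} (h : Four G A i j k l)
    (hc : G.inn A i ∈ P ↔ G.inn A j ∈ P) (hs : G.Split Aᶜ {i, j}) :
    ∃ D D' f g, (∃ Q, G.BipOn D Q ∧ (G.inn D i ∈ Q ↔ G.inn D j ∈ Q) ∧
      Pieces G A D D' i j k l f g ∧ D'.card = 2) ∨ (∃ Q, G.BipOn D Q ∧
      (G.inn D k ∈ Q ↔ G.inn D l ∈ Q) ∧ Pieces G A D D' k l i j f g ∧ D'.card = 2) := by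
  obtain ⟨D, D', f, g, hp⟩ := exists_pieces h hs
  obtain ⟨Q, hQ⟩ := hp.bip hG hA
  obtain ⟨Q', hQ'⟩ := hp.symm.bip hG hA
  have hk := hp.kinds hG hA hQ hQ'
  have hc' : G.inn A k ∈ P ↔ G.inn A l ∈ P := by rwa [← h.same_iff hG hP]
  by_cases h1 : G.inn D i ∈ Q ↔ G.inn D j ∈ Q
  · exact ⟨D, D', f, g, Or.inl ⟨Q, hQ, h1, hp, hp.card_eq_two hG hA hP hQ (iff_of_true hc h1)⟩⟩
  · have h2 : G.inn D' k ∈ Q' ↔ G.inn D' l ∈ Q' := by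
      by_contra h2; exact hk (iff_of_false h1 h2)
    exact ⟨D', D, f, g, Or.inr ⟨Q', hQ', h2, hp.symm,
      hp.symm.card_eq_two hG hA hP hQ' (iff_of_true hc' h2)⟩⟩

lemma Four.opp (hG : G.Cubic) {A P : Finset V} {i j k l : E} (h : Four G A i j k l)
    (hP : G.BipOn A P) (hij : G.inn A i ∈ P ↔ G.inn A j ∈ P) :
    ¬ (G.inn A i ∈ P ↔ G.inn A k ∈ P) ∧ ¬ (G.inn A i ∈ P ↔ G.inn A l ∈ P) := by
  obtain ⟨h1, -, -⟩ := hP.balanced hG h.card_eq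
  obtain ⟨n1, n2, n3, n4, n5, n6⟩ := h.ne
  rw [card_filter, h.cut_eq, sum_insert, sum_insert, sum_insert, sum_singleton] at h1
  · by_cases c1 : G.inn A i ∈ P <;> by_cases c2 : G.inn A j ∈ P <;> by_cases c3 : G.inn A k ∈ P <;>
      by_cases c4 : G.inn A l ∈ P <;> simp [c1, c2, c3, c4] at h1 hij ⊢
  · simp [n6]
  · simp [n4, n5]
  · simp [n1, n2, n3]

lemma cap_count_of_bip (hG : G.Cubic) {X P : Finset V} {i j k l : E} (h : Four G X i j k l)
    (hXc : 2 ≤ Xᶜ.card) (hP : G.BipOn X P) (hij : G.inn X i ∈ P ↔ G.inn X j ∈ P)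
    (S : Finset V) : 3 * X.card ≤ 2 * (G.N X S ∅ + G.N X S {i, k} + G.N X S {i, l}
      + G.N X S {j, k} + G.N X S {j, l}) := by
  obtain ⟨o, ho⟩ := exists_outer hG h.card_eq hXc
  obtain ⟨n1, n2, n3, n4, n5, n6⟩ := h.ne
  obtain ⟨hi, hj, -⟩ := h.mem
  have hI : ({i, j} : Finset E) ⊆ G.cut X := by
    intro e; simp only [mem_insert, mem_singleton]; rintro (rfl | rfl) <;> assumption
  have h1 := count_cap_le (S := S) h ho
  have hcub := cap_cubic hG h.card_eq hI (card_pair n1) ho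
  obtain ⟨o1, o2⟩ := h.opp hG hP hij
  have hb : (G.cap X {i, j} o).Bip univ := by
    by_cases hiP : G.inn X i ∈ P
    · refine bip_cap hI ho hP fun e he => ?_
      rw [h.cut_eq] at he
      simp only [mem_insert, mem_singleton] at he ⊢
      rcases he with rfl | rfl | rfl | rfl
      · simp [hiP]
      · simp [← hij, hiP]
      · simp [n2.symm, n4.symm]; tauto
      · simp [n3.symm, n5.symm]; tauto
    · refine bip_cap hI ho hP.compl fun e he => ?_
      rw [h.cut_eq] at he
      simp only [mem_insert, mem_singleton, mem_compl] at he ⊢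
      rcases he with rfl | rfl | rfl | rfl
      · simp [hiP]
      · simp [← hij, hiP]
      · simp [n2.symm, n4.symm]; tauto
      · simp [n3.symm, n5.symm]; tauto
  have : Nonempty (Cap X) := ⟨Cap.lo⟩
  obtain ⟨n, h3, h5⟩ := hb.exists_count_ge hcub (lfc X S)
  rw [card_cap] at h3
  have := two_mul_le_vg n
  omega

lemma N_extend {B D : Finset V} {X X' Z : Finset E} (hD : D ⊆ B)
    (hZ : ∀ e ∈ Z, e ∈ G.cut B ∪ G.ins B ∧ e ∉ G.cut D ∪ G.ins D)
    (hX : (X ∪ Z) ∩ G.cut B = X') (hv : ∀ v ∈ B, v ∉ D → ((X ∪ Z) ∩ G.cut {v}).card = 1) :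
    G.N D ∅ X ≤ G.N B ∅ X' := by
  refine card_le_card_of_injOn (· ∪ Z) ?_ ?_
  · intro F hF
    rw [mem_coe, mem_part] at hF ⊢
    obtain ⟨h1, h2, h3⟩ := hF
    have hsub : F ⊆ G.cut B ∪ G.ins B := by
      intro e he
      have := h1 he
      rw [mem_union, mem_cut, mem_ins] at this ⊢
      have ha : G.a e ∈ D → G.a e ∈ B := fun h => hD h
      have hb : G.b e ∈ D → G.b e ∈ B := fun h => hD h
      have hab : G.a e ≠ G.b e := by
        rcases this with h | h
        · intro heq; rw [heq] at h; exact h Iff.rfl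
        · exact h.2.2
      tauto
    refine ⟨union_subset hsub fun e he => (hZ e he).1, ?_, fun v hvB => ?_⟩
    · rw [← hX, union_inter_distrib_right, union_inter_distrib_right]
      congr 1
      ext e
      rw [← h2]
      simp only [mem_inter]
      constructor
      · rintro ⟨e1, e2⟩
        refine ⟨⟨e1, ?_⟩, e2⟩
        have := h1 e1
        rw [mem_union] at this
        rcases this with h | h
        · exact h
        · rw [mem_ins] at h
          rw [mem_cut] at e2
          exact absurd (iff_of_true (hD h.1) (hD h.2.1)) e2
      · tauto
    · left
      by_cases hvD : v ∈ D
      · have e1 : (F ∪ Z) ∩ G.cut {v} = F ∩ G.cut {v} := by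
          rw [union_inter_distrib_right]
          have : Z ∩ G.cut {v} = ∅ := by
            rw [eq_empty_iff_forall_notMem]
            intro e he
            rw [mem_inter] at he
            exact (hZ e he.1).2 (star_subset hvD he.2)
          rw [this, union_empty]
        rw [e1]
        simpa using h3 v hvD
      · rw [← hv v hvB hvD]
        congr 1
        rw [union_inter_distrib_right, union_inter_distrib_right]
        congr 1
        ext e
        rw [← h2]
        simp only [mem_inter]
        constructor
        · rintro ⟨e1, e2⟩
          refine ⟨⟨e1, ?_⟩, e2⟩
          have := h1 e1
          rw [mem_union] at this
          rcases this with h | h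
          · exact h
          · rw [mem_ins] at h
            rw [mem_star] at e2
            have n1 : G.a e ≠ v := by rintro rfl; exact hvD h.1
            have n2 : G.b e ≠ v := by rintro rfl; exact hvD h.2.1
            exact absurd (iff_of_false n1 n2) e2
        · tauto
  · intro F hF F' hF' heq
    have hdis : ∀ {F}, F ∈ G.part D ∅ X → (F ∪ Z) \ Z = F := by
      intro F hF
      rw [mem_part] at hF
      rw [union_sdiff_right, Finset.sdiff_eq_self_iff_disjoint, disjoint_left]
      intro e h1 h2
      exact (hZ e h2).2 (hF.1 h1)
    rw [← hdis hF, ← hdis hF']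
    exact congrArg (· \ Z) heq

section Pieces

variable {A D D' P Q Q' : Finset V} {i j k l f g : E}

lemma Pieces.swap (h : Pieces G A D D' i j k l f g) : Pieces G A D D' i j l k g f :=
  ⟨h.union, h.disj, fun e h1 h2 => (h.inter e h1 h2).symm, h.interA,
    fun e h1 h2 => (h.interA' e h1 h2).symm,
    h.four.perm (by ext; simp only [mem_insert, mem_singleton]; tauto),
    h.fourD.perm (by ext; simp only [mem_insert, mem_singleton]; tauto),
    h.fourD'.perm (by ext; simp only [mem_insert, mem_singleton]; tauto)⟩

lemma Pieces.swap' (h : Pieces G A D D' i j k l f g) : Pieces G A D D' i j k l g f :=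
  ⟨h.union, h.disj, fun e h1 h2 => (h.inter e h1 h2).symm, h.interA, h.interA', h.four,
    h.fourD.perm (by ext; simp only [mem_insert, mem_singleton]; tauto),
    h.fourD'.perm (by ext; simp only [mem_insert, mem_singleton]; tauto)⟩

lemma Pieces.mem_or (h : Pieces G A D D' i j k l f g) (hc : D'.card = 2)
    (hne : G.inn D' k ≠ G.inn D' l) {v : V} (hv : v ∈ Aᶜ) (hvD : v ∉ D) :
    v = G.inn D' k ∨ v = G.inn D' l := by
  obtain ⟨mk, ml, -⟩ := h.fourD'.mem
  have hv' : v ∈ D' := by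
    rw [← h.union, mem_union] at hv; tauto
  have : ({G.inn D' k, G.inn D' l} : Finset V) = D' := by
    apply eq_of_subset_of_card_le
    · intro x; simp only [mem_insert, mem_singleton]
      rintro (rfl | rfl)
      · exact inn_mem mk
      · exact inn_mem ml
    · rw [card_pair hne, hc]
  rw [← this] at hv'
  simpa using hv'

lemma star_of_four {X : Finset V} {e : E} (he : e ∈ G.cut X) {v : V} (hv : v ∈ X) :
    e ∈ G.cut {v} ↔ G.inn X e = v :=
  ⟨fun h => inn_eq_of_mem he hv h, fun h => h ▸ mem_star_inn he⟩

lemma Pieces.N_le_empty (hG : G.Cubic) (h : Pieces G A D D' i j k l f g) (hc : D'.card = 2)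
    (hne : G.inn D' k ≠ G.inn D' l) : G.N D ∅ ∅ ≤ G.N Aᶜ ∅ ∅ := by
  obtain ⟨mk, ml, -⟩ := h.fourD'.mem
  obtain ⟨z, hz, hz'⟩ := exists_link_of_two hG h.fourD'.card_eq hc (inn_mem mk) (inn_mem ml) hne
  rw [mem_ins] at hz
  have ha := h.symm.subset hz.1
  have hb := h.symm.subset hz.2.1
  have ha' := disjoint_right.mp h.disj hz.1
  have hb' := disjoint_right.mp h.disj hz.2.1
  refine N_extend (Z := {z}) h.subset ?_ ?_ ?_
  · intro e he
    rw [mem_singleton] at he; subst he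
    rw [mem_union, mem_union, mem_cut, mem_ins, mem_cut, mem_ins]
    exact ⟨Or.inr ⟨ha, hb, hz.2.2⟩, by tauto⟩
  · rw [empty_union, eq_empty_iff_forall_notMem]
    intro e he
    rw [mem_inter, mem_singleton] at he
    rw [he.1, mem_cut] at he
    exact he.2 (iff_of_true ha hb)
  · intro v hv hvD
    have hzv : z ∈ G.cut {v} := by
      rw [mem_star]
      have hab := hz.2.2
      rcases h.mem_or hc hne hv hvD with rfl | rfl <;> rcases hz' with ⟨h1, h2⟩ | ⟨h1, h2⟩ <;>
        rw [h1, h2] at hab ⊢ <;> tauto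
    rw [empty_union, inter_eq_left.mpr (by simpa using hzv), card_singleton]

lemma Pieces.N_le_pair (h : Pieces G A D D' i j k l f g) (hc : D'.card = 2)
    (hne : G.inn D' k ≠ G.inn D' l) (hf : G.inn D' f = G.inn D' k) {x : E}
    (hx : x = i ∨ x = j) : G.N D ∅ {x, f} ≤ G.N Aᶜ ∅ {x, l} := by
  obtain ⟨mk', ml', mf', -⟩ := h.fourD'.mem
  obtain ⟨mi, mj, mk, ml⟩ := h.four.mem
  obtain ⟨nij, nik, nil, njk, njl, nkl⟩ := h.four.ne
  have mx : x ∈ G.cut A := by rcases hx with rfl | rfl <;> assumption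
  have nxk : x ≠ k := by rcases hx with rfl | rfl <;> assumption
  have nxl : x ≠ l := by rcases hx with rfl | rfl <;> assumption
  have nx' : x ∉ G.cut D' := fun hh => by
    rcases h.interA' x mx hh with h1 | h1
    · exact nxk h1
    · exact nxl h1
  have nlD : l ∉ G.cut D := fun hh => by
    rcases h.interA l ml hh with h1 | h1
    · exact nil h1.symm
    · exact njl h1.symm
  have nfA : f ∉ G.cut A := fun hh => by
    have n := h.fourD'.ne
    rcases h.interA' f hh mf' with h1 | h1
    · exact n.2.1 h1.symm
    · exact n.2.2.2.1 h1.symm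
  have nlf : l ≠ f := by rintro rfl; exact nfA ml
  refine N_extend (Z := {l}) h.subset ?_ ?_ ?_
  · intro e he
    rw [mem_singleton] at he; subst he
    rw [mem_union, mem_union, cut_compl]
    refine ⟨Or.inl ml, ?_⟩
    rintro (h1 | h1)
    · exact nlD h1
    · rw [mem_ins] at h1
      have h2 := h.subset h1.1
      have h3 := h.subset h1.2.1
      rw [← cut_compl, mem_cut] at ml
      exact ml (iff_of_true h2 h3)
  · ext e
    rw [cut_compl]
    simp only [mem_inter, mem_union, mem_insert, mem_singleton]
    constructor
    · rintro ⟨(rfl | rfl) | rfl, h2⟩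
      · exact Or.inl rfl
      · exact absurd h2 nfA
      · exact Or.inr rfl
    · rintro (rfl | rfl)
      · exact ⟨Or.inl (Or.inl rfl), mx⟩
      · exact ⟨Or.inr rfl, ml⟩
  · intro v hv hvD
    have hvD' : v ∈ D' := by rw [← h.union, mem_union] at hv; tauto
    have hxv : x ∉ G.cut {v} := by
      intro hh
      have := star_subset hvD' hh
      rw [mem_union] at this
      rcases this with h1 | h1
      · exact nx' h1
      · rw [mem_ins] at h1
        have h2 := h.symm.subset h1.1
        have h3 := h.symm.subset h1.2.1
        rw [← cut_compl, mem_cut] at mx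
        exact mx (iff_of_true h2 h3)
    have hfv := star_of_four mf' hvD'
    have hlv := star_of_four ml' hvD'
    rw [hf] at hfv
    rcases h.mem_or hc hne hv hvD with hvk | hvl
    · have h1 : f ∈ G.cut {v} := hfv.mpr hvk.symm
      have h2 : l ∉ G.cut {v} := fun hh => hne (hvk.symm.trans (hlv.mp hh).symm)
      have : ({x, f} ∪ {l}) ∩ G.cut {v} = {f} := by
        ext e; simp only [mem_inter, mem_union, mem_insert, mem_singleton]
        constructor
        · rintro ⟨(rfl | rfl) | rfl, h3⟩
          · exact absurd h3 hxv
          · rfl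
          · exact absurd h3 h2
        · rintro rfl; exact ⟨Or.inl (Or.inr rfl), h1⟩
      rw [this, card_singleton]
    · have h1 : l ∈ G.cut {v} := hlv.mpr hvl.symm
      have h2 : f ∉ G.cut {v} := fun hh => hne ((hfv.mp hh).trans hvl)
      have : ({x, f} ∪ {l}) ∩ G.cut {v} = {l} := by
        ext e; simp only [mem_inter, mem_union, mem_insert, mem_singleton]
        constructor
        · rintro ⟨(rfl | rfl) | rfl, h3⟩
          · exact absurd h3 hxv
          · exact absurd h3 h2
          · rfl
        · rintro rfl; exact ⟨Or.inr rfl, h1⟩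
      rw [this, card_singleton]

/-- The case that the complement of `A` consists of a piece `D` and two adjacent vertices. -/
lemma Pieces.count_ge (hG : G.Cubic) (h4 : G.C4) (hb : ¬ G.Bip univ) (hA : Ext G A)
    (hP : G.BipOn A P) (h : Pieces G A D D' i j k l f g) (hij : G.inn A i ∈ P ↔ G.inn A j ∈ P)
    (hQ : G.BipOn D Q) (hQij : G.inn D i ∈ Q ↔ G.inn D j ∈ Q) (hc : D'.card = 2)
    (S : Finset V) : 3 * (Fintype.card V + 2 * S.card) ≤ 4 * G.count S + 36 := by
  have hne := h.symm.inn_ne hG h4 hA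
  obtain ⟨Q', hQ'⟩ := bip_two (G := G) hc
  have hopp := h.symm.opp hG h4 hA hQ' hc
  rw [h.fourD'.same_iff hG hQ'] at hopp
  have hfg : G.inn D' f ≠ G.inn D' g := by
    intro he; rw [he] at hopp; exact hopp Iff.rfl
  obtain ⟨mk', ml', mf', mg'⟩ := h.fourD'.mem
  have hm : ∀ {e}, e ∈ G.cut D' → G.inn D' e = G.inn D' k ∨ G.inn D' e = G.inn D' l :=
    fun {e} he => h.mem_or hc hne (h.symm.subset (inn_mem he))
      (disjoint_right.mp h.disj (inn_mem he))
  wlog hf : G.inn D' f = G.inn D' k generalizing f g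
  · have hf' : G.inn D' f = G.inn D' l := (hm mf').resolve_left hf
    have hg' : G.inn D' g = G.inn D' k := (hm mg').resolve_right fun h => hfg (hf'.trans h.symm)
    exact this h.swap' (fun h => hopp h.symm) hfg.symm mg' mf' hg'
  have hg : G.inn D' g = G.inn D' l := (hm mg').resolve_left fun h => hfg (hf.trans h.symm)
  obtain ⟨mi, mj, mk, ml⟩ := h.four.mem
  obtain ⟨nij, nik, nil, njk, njl, nkl⟩ := h.four.ne
  have hB := hA.cyc.compl
  have hadd := count_add_card_le hG h4 hA.cyc.four_le_card hb (disjoint_empty_left S)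
  rw [empty_union] at hadd
  have hDc : 2 ≤ Dᶜ.card := by
    have := card_le_card (compl_subset_compl.mpr h.subset)
    rw [compl_compl] at this
    have := hA.cyc.card
    omega
  have s1 := cap_count_of_bip hG h.four (by have := hB.card; omega) hP hij ∅
  have s2 := cap_count_of_bip hG h.fourD hDc hQ hQij ∅
  have u0 := h.N_le_empty hG hc hne
  have u1 := h.N_le_pair hc hne hf (Or.inl rfl)
  have u2 := h.N_le_pair hc hne hf (Or.inr rfl)
  have u3 := h.swap.N_le_pair hc hne.symm hg (Or.inl rfl)
  have u4 := h.swap.N_le_pair hc hne.symm hg (Or.inr rfl)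
  obtain ⟨o1, o2⟩ := h.four.opp hG hP hij
  have gl := glue_four h.four ∅
  have t0 := add_le_mul_add_one ((hA.cyc.two_le_N_empty (S := ∅) hG h4).trans' one_le_two)
    ((hB.two_le_N_empty (S := ∅) hG h4).trans' one_le_two)
  have t : ∀ {p q}, p ∈ G.cut A → q ∈ G.cut A → p ≠ q → ¬ (G.inn A p ∈ P ↔ G.inn A q ∈ P) →
      G.N A ∅ {p, q} + G.N Aᶜ ∅ {p, q} ≤ G.N A ∅ {p, q} * G.N Aᶜ ∅ {p, q} + 1 :=
    fun {p q} hp hq hpq hc => add_le_mul_add_one (hA.cyc.one_le_N_pair hG h4 hP hp hq hc)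
      (hB.one_le_N_pair_of_not_bip hG h4 hA.nbip (by rwa [cut_compl]) (by rwa [cut_compl]) hpq)
  have t1 := t mi mk nik o1
  have t2 := t mi ml nil o2
  have t3 := t mj mk njk (by rwa [← hij])
  have t4 := t mj ml njl (by rwa [← hij])
  have k1 := card_add_card_compl A
  have k2 := h.card
  have k3 := card_le_univ S
  omega

end Pieces

set_option maxHeartbeats 1000000 in
/-- The remaining case: no split along the two edges with equally coloured ends. -/
lemma Ext.count_ge_of_not_split (hG : G.Cubic) (h4 : G.C4) (hb : ¬ G.Bip univ)
    {A P : Finset V} (hA : Ext G A) (hP : G.BipOn A P) {i j k l : E} (h : Four G A i j k l)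
    (hij : G.inn A i ∈ P ↔ G.inn A j ∈ P) (hs : ¬ G.Split Aᶜ {i, j}) (S : Finset V) :
    3 * (Fintype.card V + 2 * S.card) ≤ 4 * G.count S + 36 := by
  obtain ⟨mi, mj, mk, ml⟩ := h.mem
  obtain ⟨nij, nik, nil, njk, njl, nkl⟩ := h.ne
  obtain ⟨o1, o2⟩ := h.opp hG hP hij
  have hB := hA.cyc.compl
  have hBc : 2 ≤ Aᶜᶜ.card := by have := hB.card'; omega
  set T := S ∩ Aᶜ with hT
  have hadd := count_add_card_le hG h4 hA.cyc.four_le_card hb (S := T) (T := S ∩ A)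
    (by rw [hT, disjoint_left]; intro x; simp only [mem_inter, mem_compl]; tauto)
  have hTS : T ∪ (S ∩ A) = S := by
    rw [hT]; ext x; simp only [mem_union, mem_inter, mem_compl]; tauto
  rw [hTS] at hadd
  have hBT : Aᶜ ∩ T = Aᶜ ∩ S := by
    rw [hT]; ext x; simp only [mem_inter]; tauto
  have s1 := cap_count_of_bip hG h (by have := hB.card; omega) hP hij T
  have h' := h.compl
  have f1 : Four G A i k j l := h.swap
  have f2 : Four G A i l j k := h.perm (by ext; simp only [mem_insert, mem_singleton]; tauto)
  have w1 := hA.not_split hG h4 hP f1 o1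
  have w2 := hA.not_split hG h4 hP f2 o2
  obtain ⟨x, hx⟩ := card_pos.mp (show 0 < Aᶜ.card by have := hB.card; omega)
  have hcs : 4 ≤ Fintype.card (Sub Aᶜ) := by rw [card_sub]; exact hB.card
  have e1 := (clBound _ (lnk_cubic (v := Sub.mk x hx) hG h4 hB.card hBc f1.compl)
    (lnk_EC3 hG h4 hB.card hBc f1.compl w1) hcs le_rfl (lfs Aᶜ T)).1
  have e2 := (clBound _ (lnk_cubic (v := Sub.mk x hx) hG h4 hB.card hBc f2.compl)
    (lnk_EC3 hG h4 hB.card hBc f2.compl w2) hcs le_rfl (lfs Aᶜ T)).1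
  have e1' := count_lnk_le (S := T) (v := Sub.mk x hx) hG h4 hB.card hBc f1.compl
  have e2' := count_lnk_le (S := T) (v := Sub.mk x hx) hG h4 hB.card hBc f2.compl
  have e3 := (cap_count hG h4 hB hA.nbip h' T).2 hs
  rw [card_sub, card_lfs, hBT] at e1 e2
  rw [hBT] at e3
  rw [cut_compl] at e1' e2'
  have gl := glue_four h T
  have z1 := hA.cyc.two_le_N_empty (S := T) hG h4
  have z2 := hB.two_le_N_empty (S := T) hG h4
  have t0 : G.N A T ∅ + 2 * G.N Aᶜ T ∅ ≤ G.N A T ∅ * G.N Aᶜ T ∅ + 2 := by nlinarith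
  have t : ∀ {p q}, p ∈ G.cut A → q ∈ G.cut A → p ≠ q → ¬ (G.inn A p ∈ P ↔ G.inn A q ∈ P) →
      G.N A T {p, q} + G.N Aᶜ T {p, q} ≤ G.N A T {p, q} * G.N Aᶜ T {p, q} + 1 :=
    fun {p q} hp hq hpq hc => add_le_mul_add_one (hA.cyc.one_le_N_pair hG h4 hP hp hq hc)
      (hB.one_le_N_pair_of_not_bip hG h4 hA.nbip (by rwa [cut_compl]) (by rwa [cut_compl]) hpq)
  have t1 := t mi mk nik o1
  have t2 := t mi ml nil o2
  have t3 := t mj mk njk (by rwa [← hij])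
  have t4 := t mj ml njl (by rwa [← hij])
  have t5 : G.N Aᶜ T (G.cut A) ≤ G.N A T (G.cut A) * G.N Aᶜ T (G.cut A) :=
    Nat.le_mul_of_pos_left _ (hA.cyc.one_le_N_cut (S := T) hG h4 hA.bip)
  have k1 := card_add_card_compl A
  have k2 := card_inter_add_compl A S
  have k3 := card_le_card (inter_subset_left (s₁ := A) (s₂ := S))
  rw [inter_comm S A] at hadd
  clear t w1 w2 hs o1 o2 hij hTS hBT hT
  omega

lemma Ext.count_ge (hG : G.Cubic) (h4 : G.C4) (hb : ¬ G.Bip univ) {A : Finset V}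
    (hA : Ext G A) (S : Finset V) :
    3 * (Fintype.card V + 2 * S.card) ≤ 4 * G.count S + 36 := by
  obtain ⟨P, hP⟩ := hA.bip
  obtain ⟨b1, b2, -⟩ := hP.balanced hG hA.cyc.d
  obtain ⟨i, j, hij, hF⟩ := card_eq_two.mp b1
  have hi : i ∈ ({i, j} : Finset E) := by simp
  have hj : j ∈ ({i, j} : Finset E) := by simp
  rw [← hF, mem_filter] at hi hj
  obtain ⟨k, l, h⟩ := exists_four hA.cyc.d hi.1 hj.1 hij
  have hs : G.inn A i ∈ P ↔ G.inn A j ∈ P := iff_of_true hi.2 hj.2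
  by_cases hsp : G.Split Aᶜ {i, j}
  · obtain ⟨D, D', f, g, ⟨Q, hQ, hk, hp, hc⟩ | ⟨Q, hQ, hk, hp, hc⟩⟩ :=
      hA.split hG hP h hs hsp
    · exact hp.count_ge hG h4 hb hA hP hs hQ hk hc S
    · exact hp.count_ge hG h4 hb hA hP (by rwa [← h.same_iff hG hP]) hQ hk hc S
  · exact hA.count_ge_of_not_split hG h4 hb hP h hs hsp S

/-- The main counting theorem, for cyclically 4-edge-connected graphs with a cyclic 4-cut. -/
theorem count_ge_of_cyc (hG : G.Cubic) (h4 : G.C4) {A : Finset V} (hA : Cyc G A)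
    (S : Finset V) : 3 * (Fintype.card V + 2 * S.card) ≤ 4 * G.count S + 36 := by
  by_cases hb : G.Bip univ
  · have := hA.card
    have := hA.card'
    have := card_add_card_compl A
    exact count_ge_of_bip hG (by omega) hb S
  by_cases h1 : ∃ X, Cyc G X ∧ G.Bip X ∧ G.Bip Xᶜ
  · obtain ⟨X, hX, hX1, hX2⟩ := h1
    exact count_ge_of_bip_bip hG h4 hb hX hX1 hX2 S
  by_cases h2 : ∃ X, Cyc G X ∧ ¬ G.Bip X ∧ ¬ G.Bip Xᶜ
  · obtain ⟨X, hX, hX1, hX2⟩ := h2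
    exact count_ge_of_not_bip_not_bip hG h4 hX hX1 hX2 S
  have hdich : ∀ X, Cyc G X → G.Bip X ∨ G.Bip Xᶜ := by
    intro X hX
    by_contra hc
    exact h2 ⟨X, hX, not_or.mp hc⟩
  have hne : (univ.filter fun X => Cyc G X ∧ G.Bip X).Nonempty := by
    rcases hdich A hA with h | h
    · exact ⟨A, by simp [hA, h]⟩
    · exact ⟨Aᶜ, by simp [hA.compl, h]⟩
  obtain ⟨X, hX, hmax⟩ := exists_max_image _ card hne
  rw [mem_filter] at hX
  have hext : Ext G X := ⟨hX.2.1, hX.2.2, fun h => h1 ⟨X, hX.2.1, hX.2.2, h⟩,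
    fun Y hY hY' => hmax Y (by simp [hY, hY']), hdich⟩
  exact hext.count_ge hG h4 hb S

end Gr

namespace Multigraph

open Finset

variable (M : Multigraph)

/-- A multigraph with an arbitrary choice of orientation. -/
def toGr : Gr M.V M.E where
  a e := (M.ends e).out.1
  b e := (M.ends e).out.2

variable {M}

lemma ends_eq_toGr (e : M.E) : M.ends e = s(M.toGr.a e, M.toGr.b e) :=
  (Quot.out_eq (M.ends e)).symm

lemma mem_ends {v : M.V} {e : M.E} :
    v ∈ M.ends e ↔ v = M.toGr.a e ∨ v = M.toGr.b e := by
  rw [ends_eq_toGr, Sym2.mem_iff]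

lemma isDiag_ends {e : M.E} : (M.ends e).IsDiag ↔ M.toGr.a e = M.toGr.b e := by
  rw [ends_eq_toGr, Sym2.mk_isDiag_iff]

lemma ends_eq_diag {v : M.V} {e : M.E} :
    M.ends e = Sym2.diag v ↔ M.toGr.a e = v ∧ M.toGr.b e = v := by
  rw [ends_eq_toGr, Sym2.diag, Sym2.eq_iff]
  tauto

lemma mem_ends_iff_mem_star {v : M.V} {e : M.E} (he : M.toGr.a e ≠ M.toGr.b e) :
    v ∈ M.ends e ↔ e ∈ M.toGr.cut {v} := by
  rw [mem_ends, Gr.mem_star]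
  constructor
  · rintro (rfl | rfl)
    · exact fun h => he (h.mp rfl).symm
    · exact fun h => he (h.mpr rfl)
  · intro h
    by_contra hc
    rw [not_or] at hc
    exact h (iff_of_false (Ne.symm hc.1) (Ne.symm hc.2))

lemma inc_eq (v : M.V) (e : M.E) :
    M.inc v e = (if e ∈ M.toGr.cut {v} then 1 else 0) +
      2 * (if M.ends e = Sym2.diag v then 1 else 0) := by
  rw [inc]
  by_cases h : M.ends e = Sym2.diag v
  · have h' := ends_eq_diag.mp h
    have : e ∉ M.toGr.cut {v} := by
      rw [Gr.mem_star, not_not]; exact iff_of_true h'.1 h'.2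
    simp [h, this]
  · by_cases hl : M.toGr.a e = M.toGr.b e
    · have h1 : e ∉ M.toGr.cut {v} := fun hc => Gr.link_of_mem_cut hc hl
      have h2 : v ∉ M.ends e := by
        rw [mem_ends]
        rintro (h2 | h2)
        · exact h (ends_eq_diag.mpr ⟨h2.symm, hl ▸ h2.symm⟩)
        · exact h (ends_eq_diag.mpr ⟨hl.trans h2.symm, h2.symm⟩)
      simp [h, h1, h2]
    · simp [h, mem_ends_iff_mem_star hl]

lemma sum_inc_eq_card {F : Finset M.E} (hF : ∀ e ∈ F, M.toGr.a e ≠ M.toGr.b e) (v : M.V) :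
    ∑ e ∈ F, M.inc v e = (F ∩ M.toGr.cut {v}).card := by
  rw [← filter_mem_eq_inter, card_filter]
  refine sum_congr rfl fun e he => ?_
  have : M.ends e ≠ Sym2.diag v := fun h =>
    hF e he ((ends_eq_diag.mp h).1.trans (ends_eq_diag.mp h).2.symm)
  simp [inc_eq, this]

lemma degree_eq (v : M.V) :
    M.degree v = M.toGr.d {v} + 2 * (univ.filter fun e => M.ends e = Sym2.diag v).card := by
  rw [degree, sum_congr rfl fun e _ => inc_eq v e, sum_add_distrib, ← mul_sum, ← card_filter,
    ← card_filter, Gr.d]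
  simp

lemma ncard_cutEdges (X : Finset M.V) : (M.cutEdges X).ncard = M.toGr.d X := by
  rw [Gr.d, ← Set.ncard_coe_finset]
  congr 1
  ext e
  simp only [cutEdges, Set.mem_ofPred_eq, mem_coe, Gr.mem_cut, ends_eq_toGr e, Sym2.eq_iff]
  constructor
  · rintro ⟨u, v, ⟨rfl, rfl⟩ | ⟨rfl, rfl⟩, hu, hv⟩ <;> tauto
  · intro h
    by_cases h1 : M.toGr.a e ∈ X
    · exact ⟨_, _, Or.inl ⟨rfl, rfl⟩, h1, by tauto⟩
    · exact ⟨_, _, Or.inr ⟨rfl, rfl⟩, by tauto, h1⟩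

/-- A vertex set spanning at least as many edges as it has vertices contains a cycle. -/
lemma hasCycleWithin_of_card_le (X : Finset M.V) (hX : X.Nonempty)
    (h : X.card ≤ (M.toGr.ins X).card) : M.HasCycleWithin X := by
  induction hn : X.card generalizing X with
  | zero => exact absurd (card_eq_zero.mp hn) hX.ne_empty
  | succ n ih =>
    by_cases hv : ∃ v ∈ X, (M.toGr.ins X ∩ M.toGr.cut {v}).card = 1
    · obtain ⟨v, hv, h1⟩ := hv
      obtain ⟨e, he⟩ := card_eq_one.mp h1
      have hsub : (M.toGr.ins X).erase e ⊆ M.toGr.ins (X.erase v) := by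
        intro f hf
        rw [mem_erase] at hf
        have hf' := Gr.mem_ins.mp hf.2
        have hfv : f ∉ M.toGr.cut {v} := by
          intro hc
          have : f ∈ ({e} : Finset M.E) := he ▸ mem_inter.mpr ⟨hf.2, hc⟩
          exact hf.1 (mem_singleton.mp this)
        rw [Gr.mem_star, not_not] at hfv
        rw [Gr.mem_ins, mem_erase, mem_erase]
        exact ⟨⟨fun h2 => hf'.2.2 (h2.trans (hfv.mp h2).symm), hf'.1⟩,
          ⟨fun h2 => hf'.2.2 ((hfv.mpr h2).trans h2.symm), hf'.2.1⟩, hf'.2.2⟩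
      have hc := card_le_card hsub
      have heX : e ∈ M.toGr.ins X := mem_of_mem_inter_left
        (show e ∈ M.toGr.ins X ∩ M.toGr.cut {v} by rw [he]; exact mem_singleton_self e)
      rw [card_erase_of_mem heX] at hc
      have hcX := card_erase_of_mem hv
      have hne : (X.erase v).Nonempty := by
        have ha := Gr.mem_ins.mp heX
        by_cases h2 : M.toGr.a e = v
        · exact ⟨_, mem_erase.mpr ⟨fun h3 => ha.2.2 (h2.trans h3.symm), ha.2.1⟩⟩
        · exact ⟨_, mem_erase.mpr ⟨h2, ha.1⟩⟩
      obtain ⟨F, hF, hF1, hF2⟩ := ih (X.erase v) hne (by omega) (by omega)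
      exact ⟨F, hF, fun e he w hw => mem_of_mem_erase (mem_coe.mp (hF1 e he w hw)), hF2⟩
    · refine ⟨M.toGr.ins X, card_pos.mp (by omega), ?_, ?_⟩
      · intro e he w hw
        have he' := Gr.mem_ins.mp he
        rcases mem_ends.mp hw with rfl | rfl
        · exact he'.1
        · exact he'.2.1
      · intro v
        rw [sum_inc_eq_card fun e he => (Gr.mem_ins.mp he).2.2]
        intro hc
        refine hv ⟨v, ?_, hc⟩
        obtain ⟨e, he⟩ := card_pos.mp (show 0 < (M.toGr.ins X ∩ M.toGr.cut {v}).card by omega)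
        rw [mem_inter, Gr.mem_ins] at he
        rcases mem_ends.mp ((mem_ends_iff_mem_star he.1.2.2).mpr he.2) with h | h
        · exact h ▸ he.1.1
        · exact h ▸ he.1.2.1

/-- A cyclically 4-edge-connected cubic graph has no loops. -/
lemma no_loop (hc : M.IsCubic) (h4 : M.CyclicallyEdgeConnected 4) (e : M.E) :
    M.toGr.a e ≠ M.toGr.b e := by
  intro hl
  obtain ⟨v, hv⟩ : ∃ v, M.ends e = Sym2.diag v :=
    ⟨M.toGr.a e, ends_eq_diag.mpr ⟨rfl, hl.symm⟩⟩
  have hpos : 0 < (univ.filter fun e => M.ends e = Sym2.diag v).card :=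
    card_pos.mpr ⟨e, by simp [hv]⟩
  have hd := hc v
  rw [degree_eq] at hd
  have loopCycle : ∀ {f w} {A : Set M.V}, M.ends f = Sym2.diag w → w ∈ A →
      M.HasCycleWithin A := by
    intro f w A hf hw
    refine ⟨{f}, singleton_nonempty f, ?_, ?_⟩
    · intro g hg u hu
      rw [mem_singleton.mp hg, hf] at hu
      rcases Sym2.mem_iff.mp hu with rfl | rfl <;> exact hw
    · intro u
      rw [sum_singleton, inc, hf]
      by_cases h : w = u
      · simp [h]
      · have : u ∉ Sym2.diag w := by
          intro hu; rcases Sym2.mem_iff.mp hu with rfl | rfl <;> exact h rfl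
        rw [if_neg this]
        split_ifs <;> omega
  have hcompl : M.HasCycleWithin (({v} : Finset M.V) : Set M.V)ᶜ := by
    rw [← coe_compl]
    by_cases hf : ∃ f w, w ≠ v ∧ M.ends f = Sym2.diag w
    · obtain ⟨f, w, hw, hf⟩ := hf
      exact loopCycle hf (by simpa using hw)
    · have h3 : ∀ w ∈ ({v} : Finset M.V)ᶜ, M.toGr.d {w} = 3 := by
        intro w hw
        have hw' : w ≠ v := by simpa using hw
        have := hc w
        rw [degree_eq, filter_false_of_mem fun f _ h => hf ⟨f, w, hw', h⟩] at this
        simpa using this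
      have hs := Gr.d_star (G := M.toGr) {v}ᶜ
      rw [sum_congr rfl h3, Gr.d_compl] at hs
      simp only [sum_const, smul_eq_mul] at hs
      have hp : 0 < ({v}ᶜ : Finset M.V).card := by omega
      exact hasCycleWithin_of_card_le _ (card_pos.mp hp) (by omega)
  have := h4 _ ⟨loopCycle hv (by simp : v ∈ ((({v} : Finset M.V)) : Set M.V)), hcompl⟩
  rw [ncard_cutEdges] at this
  omega

lemma toGr_cubic (hc : M.IsCubic) (h4 : M.CyclicallyEdgeConnected 4) : M.toGr.Cubic := by
  intro v
  have := hc v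
  rw [degree_eq, filter_false_of_mem fun e _ h => no_loop hc h4 e
    ((ends_eq_diag.mp h).1.trans (ends_eq_diag.mp h).2.symm)] at this
  simpa using this

lemma card_add_two_le (hG : M.toGr.Cubic) {X : Finset M.V} (hX : X.Nonempty)
    (h : ¬ M.HasCycleWithin X) : X.card + 2 ≤ M.toGr.d X := by
  have h1 := hG.sum X
  have h2 : ¬ X.card ≤ (M.toGr.ins X).card := fun h2 => h (hasCycleWithin_of_card_le X hX h2)
  omega

lemma toGr_C4 (hc : M.IsCubic) (h4 : M.CyclicallyEdgeConnected 4) : M.toGr.C4 := by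
  have hG := toGr_cubic hc h4
  intro X hX hX'
  have hXc : Xᶜ.Nonempty := by
    rw [nonempty_iff_ne_empty, Ne, compl_eq_empty_iff]; exact hX'
  have p1 := card_pos.mpr hX
  have p2 := card_pos.mpr hXc
  by_cases h1 : M.HasCycleWithin X
  · by_cases h2 : M.HasCycleWithin (Xᶜ : Finset M.V)
    · have := h4 X ⟨h1, by rwa [← coe_compl]⟩
      rw [ncard_cutEdges] at this
      omega
    · have := card_add_two_le hG hXc h2
      rw [Gr.d_compl] at this
      omega
  · have := card_add_two_le hG hX h1
    omega

lemma four_le_card_of_hasCycleWithin (hG : M.toGr.Cubic)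
    (hl : ∀ e, M.toGr.a e ≠ M.toGr.b e) {X : Finset M.V} (hd : M.toGr.d X = 4)
    (h : M.HasCycleWithin X) : 4 ≤ X.card := by
  obtain ⟨F, ⟨e, he⟩, hF, hF'⟩ := h
  have hsub : F ⊆ M.toGr.ins X := fun f hf => Gr.mem_ins.mpr
    ⟨hF f hf _ (mem_ends.mpr (Or.inl rfl)), hF f hf _ (mem_ends.mpr (Or.inr rfl)), hl f⟩
  have hp := hG.parity X
  have hs := hG.sum X
  have hpos := card_pos.mpr ⟨_, (Gr.mem_ins.mp (hsub he)).1⟩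
  by_contra hc
  have h1 : (M.toGr.ins X).card = 1 := by omega
  have hFe : F = {e} :=
    (eq_of_subset_of_card_le (singleton_subset_iff.mpr he) (by
      rw [card_singleton, ← h1]; exact card_le_card hsub)).symm
  apply hF' (M.toGr.a e)
  rw [sum_inc_eq_card fun e _ => hl e, hFe, inter_eq_left.mpr, card_singleton]
  rw [singleton_subset_iff, ← mem_ends_iff_mem_star (hl e)]
  exact mem_ends.mpr (Or.inl rfl)

lemma exists_cyc (hc : M.IsCubic) (h4 : M.CyclicallyEdgeConnected 4)
    (h5 : ¬ M.CyclicallyEdgeConnected 5) : ∃ A, Gr.Cyc M.toGr A := by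
  have hG := toGr_cubic hc h4
  have hl := no_loop hc h4
  rw [CyclicallyEdgeConnected] at h5
  push Not at h5
  obtain ⟨A, hA, h5⟩ := h5
  have hA4 := h4 A hA
  obtain ⟨X, rfl⟩ : ∃ X : Finset M.V, (X : Set M.V) = A := ⟨A.toFinset, A.coe_toFinset⟩
  rw [ncard_cutEdges] at h5 hA4
  have hd : M.toGr.d X = 4 := by omega
  have h2 := hA.2
  rw [← coe_compl] at h2
  exact ⟨X, hd, four_le_card_of_hasCycleWithin hG hl hd hA.1,
    four_le_card_of_hasCycleWithin hG hl (by rwa [Gr.d_compl]) h2⟩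

/-! ### Expansions -/

lemma pmCount_le_of_iso {M₁ M₂ : Multigraph} (h : Iso M₁ M₂) : M₁.pmCount ≤ M₂.pmCount := by
  obtain ⟨f, g, hfg⟩ := h
  refine Nat.card_le_card_of_injective
    (fun F => ⟨F.1.map g.toEmbedding, ?_, ?_⟩) ?_
  · intro e he
    rw [mem_map_equiv] at he
    obtain ⟨e, rfl⟩ := g.surjective e
    rw [g.symm_apply_apply] at he
    rw [hfg, Sym2.isDiag_map f.injective]
    exact F.2.1 e he
  · intro v
    obtain ⟨v, rfl⟩ := f.surjective v
    obtain ⟨e, ⟨he, hv⟩, hu⟩ := F.2.2 v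
    refine ⟨g e, ⟨by simpa using he, ?_⟩, ?_⟩
    · rw [hfg]; exact Sym2.mem_map.mpr ⟨v, hv, rfl⟩
    · intro e' ⟨he', hv'⟩
      obtain ⟨e', rfl⟩ := g.surjective e'
      rw [mem_map_equiv, g.symm_apply_apply] at he'
      rw [hfg] at hv'
      obtain ⟨w, hw, hwv⟩ := Sym2.mem_map.mp hv'
      rw [f.injective hwv] at hw
      rw [hu e' ⟨he', hw⟩]
  · intro F F' h
    exact Subtype.ext (map_injective _ (Subtype.ext_iff.mp h))

lemma card_eq_of_iso {M₁ M₂ : Multigraph} (h : Iso M₁ M₂) :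
    Fintype.card M₁.V = Fintype.card M₂.V := by
  obtain ⟨f, -⟩ := h
  exact Fintype.card_congr f

section Expansion

variable {S : Set M.V} {σ : M.E → M.V → Fin 3}

lemma card_expandTriangles :
    Fintype.card (M.expandTriangles S σ).V = Fintype.card M.V + 2 * S.toFinset.card := by
  have h1 : Fintype.card (M.expandTriangles S σ).V
      = Fintype.card ({x : M.V // x ∉ S} ⊕ (S × Fin 3)) := Fintype.card_congr (Equiv.refl _)
  have h2 := Fintype.card_subtype_compl (fun x => x ∈ S)
  have h3 : Fintype.card S ≤ Fintype.card M.V := Fintype.card_subtype_le _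
  rw [h1, Fintype.card_sum, Fintype.card_prod, Fintype.card_fin, Set.toFinset_card]
  have h4 : Fintype.card {x // x ∈ S} = Fintype.card S := Fintype.card_congr (Equiv.refl _)
  rw [h2, h4]
  omega

variable (S σ) in
/-- A vertex that is not expanded. -/
def oldV (x : {x : M.V // x ∉ S}) : (M.expandTriangles S σ).V := Sum.inl x

variable (S σ) in
/-- A vertex of a triangle. -/
def triV (w : S) (i : Fin 3) : (M.expandTriangles S σ).V := Sum.inr (w, i)

variable (S σ) in
/-- An edge of the original graph. -/
def oldE (e : M.E) : (M.expandTriangles S σ).E := Sum.inl e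

variable (S σ) in
/-- An edge of a triangle. -/
def triE (w : S) (i : Fin 3) : (M.expandTriangles S σ).E := Sum.inr (w, i)

lemma oldV_inj {x y} : oldV S σ x = oldV S σ y ↔ x = y :=
  ⟨fun h => Sum.inl.inj h, fun h => h ▸ rfl⟩

lemma triV_inj {w w' i i'} : triV S σ w i = triV S σ w' i' ↔ w = w' ∧ i = i' :=
  ⟨fun h => Prod.mk.inj (Sum.inr.inj h), fun h => h.1 ▸ h.2 ▸ rfl⟩

lemma oldV_ne_triV {x w i} : oldV S σ x ≠ triV S σ w i := fun h => Sum.inl_ne_inr h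

lemma oldE_inj {e f} : oldE S σ e = oldE S σ f ↔ e = f :=
  ⟨fun h => Sum.inl.inj h, fun h => h ▸ rfl⟩

lemma triE_inj {w w' i i'} : triE S σ w i = triE S σ w' i' ↔ w = w' ∧ i = i' :=
  ⟨fun h => Prod.mk.inj (Sum.inr.inj h), fun h => h.1 ▸ h.2 ▸ rfl⟩

lemma oldE_ne_triE {e w i} : oldE S σ e ≠ triE S σ w i := fun h => Sum.inl_ne_inr h

lemma expand_vertex_cases (v : (M.expandTriangles S σ).V) :
    (∃ x, v = oldV S σ x) ∨ ∃ w i, v = triV S σ w i :=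
  match v with
  | Sum.inl x => Or.inl ⟨x, rfl⟩
  | Sum.inr (w, i) => Or.inr ⟨w, i, rfl⟩

lemma expand_edge_cases (e : (M.expandTriangles S σ).E) :
    (∃ f, e = oldE S σ f) ∨ ∃ w i, e = triE S σ w i :=
  match e with
  | Sum.inl x => Or.inl ⟨x, rfl⟩
  | Sum.inr (w, i) => Or.inr ⟨w, i, rfl⟩

/-- The vertex of the expansion to which the end `x` of `e` gets attached. -/
def attach (S : Set M.V) (σ : M.E → M.V → Fin 3) (e : M.E) (x : M.V) :
    (M.expandTriangles S σ).V :=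
  if h : x ∈ S then triV S σ ⟨x, h⟩ (σ e x) else oldV S σ ⟨x, h⟩

lemma ends_oldE (e : M.E) :
    (M.expandTriangles S σ).ends (oldE S σ e) = (M.ends e).map (attach S σ e) := rfl

lemma ends_triE (w : S) (i : Fin 3) : (M.expandTriangles S σ).ends (triE S σ w i) =
    s(triV S σ w (i + 1), triV S σ w (i + 2)) := rfl

lemma attach_eq_oldV {e : M.E} {x : M.V} {y : {x : M.V // x ∉ S}} :
    attach S σ e x = oldV S σ y ↔ x = y := by
  rw [attach]
  split_ifs with h
  · exact iff_of_false (Ne.symm oldV_ne_triV) fun hx => y.2 (hx ▸ h)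
  · rw [oldV_inj, Subtype.ext_iff]

lemma attach_eq_triV {e : M.E} {x : M.V} {w : S} {i : Fin 3} :
    attach S σ e x = triV S σ w i ↔ x = w ∧ σ e x = i := by
  rw [attach]
  split_ifs with h
  · rw [triV_inj, Subtype.ext_iff]
  · exact iff_of_false oldV_ne_triV fun hx => h (hx.1 ▸ w.2)

lemma attach_injective (e : M.E) : Function.Injective (attach S σ e) := by
  intro x y h
  obtain ⟨z, hy⟩ | ⟨w, i, hy⟩ := expand_vertex_cases (attach S σ e y)
  · rw [hy] at h
    exact (attach_eq_oldV.mp h).trans (attach_eq_oldV.mp hy).symm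
  · rw [hy] at h
    exact (attach_eq_triV.mp h).1.trans (attach_eq_triV.mp hy).1.symm

lemma oldV_mem_ends_oldE {e : M.E} {x : {x : M.V // x ∉ S}} :
    oldV S σ x ∈ (M.expandTriangles S σ).ends (oldE S σ e) ↔ (x : M.V) ∈ M.ends e := by
  rw [ends_oldE, Sym2.mem_map]
  constructor
  · rintro ⟨y, hy, h⟩
    rw [← attach_eq_oldV.mp h]; exact hy
  · intro h
    exact ⟨x, h, attach_eq_oldV.mpr rfl⟩

lemma triV_mem_ends_oldE {e : M.E} {w : S} {i : Fin 3} :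
    triV S σ w i ∈ (M.expandTriangles S σ).ends (oldE S σ e) ↔
      (w : M.V) ∈ M.ends e ∧ σ e w = i := by
  rw [ends_oldE, Sym2.mem_map]
  constructor
  · rintro ⟨y, hy, h⟩
    obtain ⟨rfl, h⟩ := attach_eq_triV.mp h
    exact ⟨hy, h⟩
  · intro h
    exact ⟨w, h.1, attach_eq_triV.mpr ⟨rfl, h.2⟩⟩

lemma oldV_notMem_ends_triE {x : {x : M.V // x ∉ S}} {w : S} {i : Fin 3} :
    oldV S σ x ∉ (M.expandTriangles S σ).ends (triE S σ w i) := by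
  rw [ends_triE, Sym2.mem_iff]
  exact not_or.mpr ⟨oldV_ne_triV, oldV_ne_triV⟩

lemma triV_mem_ends_triE {v w : S} {i j : Fin 3} :
    triV S σ v j ∈ (M.expandTriangles S σ).ends (triE S σ w i) ↔ v = w ∧ j ≠ i := by
  rw [ends_triE, Sym2.mem_iff, triV_inj, triV_inj, ← and_or_left]
  refine and_congr_right fun _ => ?_
  revert i j; decide

/-- Extends a set of edges with odd degrees over the triangles. -/
def liftMatching (S : Set M.V) (σ : M.E → M.V → Fin 3) (F : Finset M.E) :
    Finset (M.expandTriangles S σ).E :=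
  univ.filter fun e => (∃ f ∈ F, e = oldE S σ f) ∨
    ∃ w i, e = triE S σ w i ∧ ∃ f, F ∩ M.toGr.cut {(w : M.V)} = {f} ∧ σ f w = i

lemma oldE_mem_liftMatching {F : Finset M.E} {e : M.E} :
    oldE S σ e ∈ liftMatching S σ F ↔ e ∈ F := by
  simp only [liftMatching, mem_filter, mem_univ, true_and]
  constructor
  · rintro (⟨f, hf, h⟩ | ⟨w', i', h, -⟩)
    · exact oldE_inj.mp h ▸ hf
    · exact absurd h oldE_ne_triE
  · exact fun h => Or.inl ⟨e, h, rfl⟩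

lemma triE_mem_liftMatching {F : Finset M.E} {w : S} {i : Fin 3} :
    triE S σ w i ∈ liftMatching S σ F ↔
      ∃ f, F ∩ M.toGr.cut {(w : M.V)} = {f} ∧ σ f w = i := by
  simp only [liftMatching, mem_filter, mem_univ, true_and]
  constructor
  · rintro (⟨f, -, h⟩ | ⟨w', i', h, f, h1, h2⟩)
    · exact absurd h.symm oldE_ne_triE
    · obtain ⟨rfl, rfl⟩ := triE_inj.mp h; exact ⟨f, h1, h2⟩
  · rintro ⟨f, h⟩
    exact Or.inr ⟨w, i, rfl, f, h⟩

lemma isPerfectMatching_liftMatching (hG : M.toGr.Cubic)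
    (hl : ∀ e, M.toGr.a e ≠ M.toGr.b e)
    (hσ : ∀ v ∈ S, Set.InjOn (fun e => σ e v) {e : M.E | v ∈ M.ends e}) {F : Finset M.E}
    (hF : M.toGr.IsPart univ S.toFinset ∅ F) :
    (M.expandTriangles S σ).IsPerfectMatching (liftMatching S σ F) := by
  rw [Gr.isPart_univ] at hF
  have hF := hF.2
  have hm : ∀ {v e}, v ∈ M.ends e ↔ e ∈ M.toGr.cut {v} := mem_ends_iff_mem_star (hl _)
  constructor
  · intro e' _
    obtain ⟨e, rfl⟩ | ⟨w, i, rfl⟩ := expand_edge_cases e'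
    · rw [ends_oldE, Sym2.isDiag_map (attach_injective e), isDiag_ends]
      exact hl e
    · rw [ends_triE, Sym2.mk_isDiag_iff, triV_inj, not_and]
      exact fun _ => (by decide : ∀ i : Fin 3, i + 1 ≠ i + 2) i
  intro v
  obtain ⟨x, rfl⟩ | ⟨w, j, rfl⟩ := expand_vertex_cases v
  · rcases hF x with h | h
    · obtain ⟨e, he⟩ := card_eq_one.mp h
      have he' : e ∈ F ∩ M.toGr.cut {(x : M.V)} := by rw [he]; exact mem_singleton_self e
      rw [mem_inter] at he'
      refine ⟨oldE S σ e, ⟨oldE_mem_liftMatching.mpr he'.1,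
        oldV_mem_ends_oldE.mpr (hm.mpr he'.2)⟩, ?_⟩
      rintro e' ⟨h1, h2⟩
      obtain ⟨f, rfl⟩ | ⟨w, i, rfl⟩ := expand_edge_cases e'
      · have : f ∈ F ∩ M.toGr.cut {(x : M.V)} :=
          mem_inter.mpr ⟨oldE_mem_liftMatching.mp h1, hm.mp (oldV_mem_ends_oldE.mp h2)⟩
        rw [he, mem_singleton] at this
        rw [this]
      · exact absurd h2 oldV_notMem_ends_triE
    · exact absurd (Set.mem_toFinset.mp h.1) x.2
  · rcases hF w with h | ⟨-, h⟩
    · obtain ⟨e, he⟩ := card_eq_one.mp h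
      have he' : e ∈ F ∩ M.toGr.cut {(w : M.V)} := by rw [he]; exact mem_singleton_self e
      rw [mem_inter] at he'
      have hinl : ∀ f, oldE S σ f ∈ liftMatching S σ F →
          triV S σ w j ∈ (M.expandTriangles S σ).ends (oldE S σ f) → f = e ∧ σ e w = j := by
        intro f h1 h2
        have h3 := triV_mem_ends_oldE.mp h2
        have : f ∈ F ∩ M.toGr.cut {(w : M.V)} :=
          mem_inter.mpr ⟨oldE_mem_liftMatching.mp h1, hm.mp h3.1⟩
        rw [he, mem_singleton] at this
        exact ⟨this, this ▸ h3.2⟩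
      have hinr : ∀ w' i, triE S σ w' i ∈ liftMatching S σ F →
          triV S σ w j ∈ (M.expandTriangles S σ).ends (triE S σ w' i) →
          w' = w ∧ i = σ e w ∧ j ≠ i := by
        intro w' i h1 h2
        obtain ⟨rfl, h3⟩ := triV_mem_ends_triE.mp h2
        obtain ⟨f, h4, h5⟩ := triE_mem_liftMatching.mp h1
        rw [he, singleton_inj] at h4
        exact ⟨rfl, h4 ▸ h5.symm, h3⟩
      by_cases hj : σ e w = j
      · refine ⟨oldE S σ e, ⟨oldE_mem_liftMatching.mpr he'.1,
          triV_mem_ends_oldE.mpr ⟨hm.mpr he'.2, hj⟩⟩, ?_⟩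
        rintro e' ⟨h1, h2⟩
        obtain ⟨f, rfl⟩ | ⟨w', i, rfl⟩ := expand_edge_cases e'
        · rw [(hinl f h1 h2).1]
        · obtain ⟨-, h3, h4⟩ := hinr w' i h1 h2
          exact absurd (hj.symm.trans h3.symm) h4
      · refine ⟨triE S σ w (σ e w), ⟨triE_mem_liftMatching.mpr ⟨e, he, rfl⟩,
          triV_mem_ends_triE.mpr ⟨rfl, Ne.symm hj⟩⟩, ?_⟩
        rintro e' ⟨h1, h2⟩
        obtain ⟨f, rfl⟩ | ⟨w', i, rfl⟩ := expand_edge_cases e'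
        · exact absurd (hinl f h1 h2).2 hj
        · obtain ⟨rfl, rfl, -⟩ := hinr w' i h1 h2
          rfl
    · have hsub : F ∩ M.toGr.cut {(w : M.V)} = M.toGr.cut {(w : M.V)} :=
        eq_of_subset_of_card_le inter_subset_right (by rw [h]; exact (hG w).le)
      have hinj : Set.InjOn (fun e => σ e w) (M.toGr.cut {(w : M.V)}) := fun e he f hf =>
        hσ w w.2 (hm.mpr (mem_coe.mp he)) (hm.mpr (mem_coe.mp hf))
      have himg : (M.toGr.cut {(w : M.V)}).image (fun e => σ e w) = univ := by
        apply eq_univ_of_card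
        rw [card_image_of_injOn hinj, Fintype.card_fin]; exact hG w
      obtain ⟨e, he, hej⟩ := mem_image.mp (himg ▸ mem_univ j)
      have heF : e ∈ F := mem_of_mem_inter_left (hsub.symm ▸ he)
      refine ⟨oldE S σ e, ⟨oldE_mem_liftMatching.mpr heF,
        triV_mem_ends_oldE.mpr ⟨hm.mpr he, hej⟩⟩, ?_⟩
      rintro e' ⟨h1, h2⟩
      obtain ⟨f, rfl⟩ | ⟨w', i, rfl⟩ := expand_edge_cases e'
      · have h3 := triV_mem_ends_oldE.mp h2
        rw [hinj (mem_coe.mpr (hm.mp h3.1)) (mem_coe.mpr he) (h3.2.trans hej.symm)]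
      · obtain ⟨rfl, -⟩ := triV_mem_ends_triE.mp h2
        obtain ⟨f, h4, -⟩ := triE_mem_liftMatching.mp h1
        rw [h4, card_singleton] at h
        omega

lemma count_le_pmCount_expandTriangles (hG : M.toGr.Cubic)
    (hl : ∀ e, M.toGr.a e ≠ M.toGr.b e)
    (hσ : ∀ v ∈ S, Set.InjOn (fun e => σ e v) {e : M.E | v ∈ M.ends e}) :
    M.toGr.count S.toFinset ≤ (M.expandTriangles S σ).pmCount := by
  rw [Gr.count, Gr.N, ← Nat.card_eq_finsetCard]
  refine Nat.card_le_card_of_injective (fun F => ⟨liftMatching S σ F.1,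
    isPerfectMatching_liftMatching hG hl hσ (Gr.mem_part.mp F.2)⟩) ?_
  intro F F' h
  have h' := Subtype.ext_iff.mp h
  refine Subtype.ext (Finset.ext fun e => ?_)
  rw [← oldE_mem_liftMatching (S := S) (σ := σ), ← oldE_mem_liftMatching (S := S) (σ := σ)]
  exact Finset.ext_iff.mp h' _

end Expansion

end Multigraph

open Multigraph
/-- Let `H` be a cyclically 4-edge-connected cubic graph that is
not cyclically 5-edge-connected. If `G` is a graph of order `n` obtained from `H`
by replacing some (possibly none) of its vertices with triangles, then `G` has at
least `3n/4 - 9` perfect matchings. -/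
theorem cyclically4ec_triangle_expansion_many_perfect_matchings
    (H : Multigraph) (hcubic : H.IsCubic)
    (h4 : H.CyclicallyEdgeConnected 4) (h5 : ¬ H.CyclicallyEdgeConnected 5)
    (G : Multigraph) (S : Set H.V) (hexp : IsTriangleExpansion H S G) :
    3 * (Fintype.card G.V : ℝ) / 4 - 9 ≤ (G.pmCount : ℝ) := by
  obtain ⟨σ, -, hσ, hiso⟩ := hexp
  have hG := toGr_cubic hcubic h4
  obtain ⟨A, hA⟩ := exists_cyc hcubic h4 h5
  have h1 := Gr.count_ge_of_cyc hG (toGr_C4 hcubic h4) hA S.toFinset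
  have h2 := count_le_pmCount_expandTriangles hG (no_loop hcubic h4) hσ
  have h3 := pmCount_le_of_iso hiso
  have h5 := card_eq_of_iso hiso
  rw [card_expandTriangles] at h5
  rw [h5] at h1
  have h6 : 3 * Fintype.card G.V ≤ 4 * G.pmCount + 36 := by omega
  have h7 : 3 * (Fintype.card G.V : ℝ) ≤ 4 * G.pmCount + 36 := by exact_mod_cast h6
  linarith
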